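/- Let N = 2 and let (u,v) be a solution of the system Δu = u v², Δv = v u², u > 0, v > 0 on ℝ² which is half-monotone, i.e. at least one of the two conditions '∂u/∂x₂ > 0 everywhere on ℝ²' or '∂v/∂x₂ < 0 everywhere on ℝ²' holds, and which has at most algebraic growth at infinity, i.e. there exist constants C > 0 and α ≥ 1 such that u(x) + v(x) ≤ C(1 + |x|)^α for all x ∈ ℝ². Then (u,v) is one dimensional: there exist functions U, V : ℝ → ℝ and a unit vector ν ∈ ℝ² such that u(x) = U(ν·x) and v(x) = V(ν·x) for every x ∈ ℝ². -/

import Mathlib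

open MeasureTheory
open scoped RealInnerProductSpace

/-- The Laplacian of `f : ℝ² → ℝ`, as the sum of the second partial derivatives. -/
noncomputable def lapl (f : EuclideanSpace ℝ (Fin 2) → ℝ) (x : EuclideanSpace ℝ (Fin 2)) : ℝ :=
  ∑ i, fderiv ℝ (fun y => fderiv ℝ f y (EuclideanSpace.single i 1)) x (EuclideanSpace.single i 1)

namespace HM
open Real Set Filter Topology

/-! ### Generic calculus lemmas -/

lemma hasDerivAt_param {F F' : ℝ → ℝ → ℝ} (x y : ℝ)
    (hF : Continuous fun q : ℝ × ℝ => F q.1 q.2)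
    (hF' : Continuous fun q : ℝ × ℝ => F' q.1 q.2)
    (hd : ∀ t p, HasDerivAt (fun t => F t p) (F' t p) t) (t : ℝ) :
    HasDerivAt (fun t => ∫ p in x..y, F t p) (∫ p in x..y, F' t p) t := by
  obtain ⟨M, hM⟩ : ∃ M, ∀ q ∈ (Icc (t-1) (t+1) ×ˢ uIcc x y), ‖F' q.1 q.2‖ ≤ M := by
    have hc : IsCompact (Icc (t-1) (t+1) ×ˢ uIcc x y) := isCompact_Icc.prod isCompact_uIcc
    exact hc.exists_bound_of_continuousOn hF'.continuousOn
  have hFs : ∀ t, Continuous (F t) := fun t => hF.comp (by fun_prop : Continuous fun p : ℝ => (t, p))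
  have hFs' : ∀ t, Continuous (F' t) := fun t => hF'.comp (by fun_prop : Continuous fun p : ℝ => (t, p))
  refine (intervalIntegral.hasDerivAt_integral_of_dominated_loc_of_deriv_le
    (F := F) (F' := F') (x₀ := t) (s := Icc (t-1) (t+1)) (bound := fun _ => M)
    (Icc_mem_nhds (by linarith) (by linarith)) ?_ ?_ ?_ ?_ ?_ ?_).2
  · exact Eventually.of_forall fun t => (hFs t).aestronglyMeasurable
  · exact (hFs t).intervalIntegrable _ _
  · exact (hFs' t).aestronglyMeasurable
  · refine Eventually.of_forall fun p hp s hs => hM (s, p) ⟨hs, uIoc_subset_uIcc hp⟩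
  · exact intervalIntegrable_const
  · exact Eventually.of_forall fun p _ s _ => hd s p

lemma continuous_param {F : ℝ → ℝ → ℝ} (x y : ℝ)
    (hF : Continuous fun q : ℝ × ℝ => F q.1 q.2) :
    Continuous fun t => ∫ p in x..y, F t p :=
  intervalIntegral.continuous_parametric_intervalIntegral_of_continuous' (f := F) hF x y

lemma swap_param {F : ℝ → ℝ → ℝ} (x y z w : ℝ)
    (hF : Continuous fun q : ℝ × ℝ => F q.1 q.2) :
    ∫ t in x..y, ∫ p in z..w, F t p = ∫ p in z..w, ∫ t in x..y, F t p := by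
  apply MeasureTheory.intervalIntegral_intervalIntegral_swap
  have h := (hF.continuousOn (s := uIcc x y ×ˢ uIcc z w)).integrableOn_compact
      (μ := volume) (isCompact_uIcc.prod isCompact_uIcc)
  exact h.mono_set (prod_mono uIoc_subset_uIcc uIoc_subset_uIcc)

/-- A function with `f' ≤ g'` pointwise. -/
lemma sub_le_sub_of_deriv_le {f g f' g' : ℝ → ℝ} (hf : ∀ t, HasDerivAt f (f' t) t)
    (hg : ∀ t, HasDerivAt g (g' t) t) {x y : ℝ} (hxy : x ≤ y)
    (h : ∀ t ∈ Ioo x y, f' t ≤ g' t) : f y - f x ≤ g y - g x := by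
  have hd : ∀ t, HasDerivAt (fun t => g t - f t) (g' t - f' t) t := fun t => (hg t).sub (hf t)
  have : MonotoneOn (fun t => g t - f t) (Icc x y) := by
    apply monotoneOn_of_deriv_nonneg (convex_Icc x y)
    · exact fun t _ => (hd t).continuousAt.continuousWithinAt
    · exact fun t _ => (hd t).differentiableAt.differentiableWithinAt
    · intro t ht
      rw [interior_Icc] at ht
      rw [(hd t).deriv]; linarith [h t ht]
  have := this ⟨le_rfl, hxy⟩ ⟨hxy, le_rfl⟩ hxy
  simp only at this; linarith

lemma antitone_of_deriv {f f' : ℝ → ℝ} (hf : ∀ t, HasDerivAt f (f' t) t) (h : ∀ t, f' t ≤ 0) :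
    Antitone f := by
  intro x y hxy
  have := sub_le_sub_of_deriv_le hf (fun t => hasDerivAt_const t (0:ℝ)) hxy (fun t _ => h t)
  linarith

lemma monotone_of_deriv {f f' : ℝ → ℝ} (hf : ∀ t, HasDerivAt f (f' t) t) (h : ∀ t, 0 ≤ f' t) :
    Monotone f := by
  intro x y hxy
  have := sub_le_sub_of_deriv_le (fun t => hasDerivAt_const t (0:ℝ)) hf hxy (fun t _ => h t)
  linarith

/-! ### Functions in log-polar coordinates -/

/-- A `C²` function of `(t, p)`, `2π`-periodic in `p`, with its derivatives. -/
structure Fn where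
  f : ℝ → ℝ → ℝ
  ft : ℝ → ℝ → ℝ
  fp : ℝ → ℝ → ℝ
  ftt : ℝ → ℝ → ℝ
  ftp : ℝ → ℝ → ℝ
  fpp : ℝ → ℝ → ℝ
  cf : Continuous fun q : ℝ × ℝ => f q.1 q.2
  cft : Continuous fun q : ℝ × ℝ => ft q.1 q.2
  cfp : Continuous fun q : ℝ × ℝ => fp q.1 q.2
  cftt : Continuous fun q : ℝ × ℝ => ftt q.1 q.2
  cftp : Continuous fun q : ℝ × ℝ => ftp q.1 q.2
  cfpp : Continuous fun q : ℝ × ℝ => fpp q.1 q.2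
  dt : ∀ t p, HasDerivAt (fun t => f t p) (ft t p) t
  dp : ∀ t p, HasDerivAt (fun p => f t p) (fp t p) p
  dtt : ∀ t p, HasDerivAt (fun t => ft t p) (ftt t p) t
  dpt : ∀ t p, HasDerivAt (fun t => fp t p) (ftp t p) t
  dtp : ∀ t p, HasDerivAt (fun p => ft t p) (ftp t p) p
  dpp : ∀ t p, HasDerivAt (fun p => fp t p) (fpp t p) p
  per : ∀ t p, f t (p + 2 * π) = f t p
  pert : ∀ t p, ft t (p + 2 * π) = ft t p
  perp : ∀ t p, fp t (p + 2 * π) = fp t p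
  pos : ∀ t p, 0 < f t p

section cont
variable {X : Type*} [TopologicalSpace X] {g h : X → ℝ} (a : Fn)
@[fun_prop] lemma Fn.cf' (hg : Continuous g) (hh : Continuous h) :
    Continuous fun x => a.f (g x) (h x) := a.cf.comp (hg.prodMk hh)
@[fun_prop] lemma Fn.cft' (hg : Continuous g) (hh : Continuous h) :
    Continuous fun x => a.ft (g x) (h x) := a.cft.comp (hg.prodMk hh)
@[fun_prop] lemma Fn.cfp' (hg : Continuous g) (hh : Continuous h) :
    Continuous fun x => a.fp (g x) (h x) := a.cfp.comp (hg.prodMk hh)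
@[fun_prop] lemma Fn.cftt' (hg : Continuous g) (hh : Continuous h) :
    Continuous fun x => a.ftt (g x) (h x) := a.cftt.comp (hg.prodMk hh)
@[fun_prop] lemma Fn.cftp' (hg : Continuous g) (hh : Continuous h) :
    Continuous fun x => a.ftp (g x) (h x) := a.cftp.comp (hg.prodMk hh)
@[fun_prop] lemma Fn.cfpp' (hg : Continuous g) (hh : Continuous h) :
    Continuous fun x => a.fpp (g x) (h x) := a.cfpp.comp (hg.prodMk hh)
end cont

/-- The system in log-polar coordinates. -/
structure Sys (a b : Fn) : Prop where
  eqa : ∀ t p, a.ftt t p + a.fpp t p = exp (2 * t) * a.f t p * (b.f t p) ^ 2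
  eqb : ∀ t p, b.ftt t p + b.fpp t p = exp (2 * t) * b.f t p * (a.f t p) ^ 2
  bdd : ∃ C, ∀ t ≤ 0, ∀ p, |a.f t p| ≤ C ∧ |b.f t p| ≤ C ∧ |a.ft t p| ≤ C * exp t ∧
    |b.ft t p| ≤ C * exp t ∧ |a.fp t p| ≤ C * exp t ∧ |b.fp t p| ≤ C * exp t
  growth : ∃ C β, ∀ t, 0 ≤ t → ∀ p, a.f t p ≤ C * exp (β * t) ∧ b.f t p ≤ C * exp (β * t)

lemma Sys.symm {a b : Fn} (h : Sys a b) : Sys b a := by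
  obtain ⟨C, hC⟩ := h.bdd
  obtain ⟨C', β, hC'⟩ := h.growth
  refine ⟨h.eqb, h.eqa, ⟨C, fun t ht p => ?_⟩, ⟨C', β, fun t ht p => (hC' t ht p).symm⟩⟩
  obtain ⟨h1, h2, h3, h4, h5, h6⟩ := hC t ht p
  exact ⟨h2, h1, h4, h3, h6, h5⟩

/-- integral over the circle of an exact derivative -/
lemma int_per {F F' : ℝ → ℝ} (hF : ∀ p, HasDerivAt F (F' p) p) (hc : Continuous F')
    (hper : F π = F (-π)) : ∫ p in (-π)..π, F' p = 0 := by
  rw [intervalIntegral.integral_eq_sub_of_hasDerivAt (fun p _ => hF p) (hc.intervalIntegrable _ _),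
    hper, sub_self]

lemma Fn.per' (a : Fn) (t : ℝ) : a.f t π = a.f t (-π) := by
  rw [← a.per t (-π)]; congr 1; ring
lemma Fn.pert' (a : Fn) (t : ℝ) : a.ft t π = a.ft t (-π) := by
  rw [← a.pert t (-π)]; congr 1; ring
lemma Fn.perp' (a : Fn) (t : ℝ) : a.fp t π = a.fp t (-π) := by
  rw [← a.perp t (-π)]; congr 1; ring

noncomputable section
variable (a b : Fn)
def H (t : ℝ) : ℝ := ∫ p in (-π)..π, ((a.f t p) ^ 2 + (b.f t p) ^ 2)
def D (t : ℝ) : ℝ := ∫ p in (-π)..π, (a.f t p * a.ft t p + b.f t p * b.ft t p)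
def S (t : ℝ) : ℝ := ∫ p in (-π)..π, ((a.ft t p) ^ 2 + (b.ft t p) ^ 2)
def Th (t : ℝ) : ℝ := ∫ p in (-π)..π, ((a.fp t p) ^ 2 + (b.fp t p) ^ 2)
def G (t : ℝ) : ℝ := ∫ p in (-π)..π, (exp (2 * t) * (a.f t p) ^ 2 * (b.f t p) ^ 2)
def K (t : ℝ) : ℝ := ∫ p in (-π)..π, ((a.ft t p) ^ 2 + (b.ft t p) ^ 2 - (a.fp t p) ^ 2
  - (b.fp t p) ^ 2 - exp (2 * t) * (a.f t p) ^ 2 * (b.f t p) ^ 2)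
def Nf (t : ℝ) : ℝ := D a b t / H a b t
def Df (t : ℝ) : ℝ := ∫ p in (-π)..π, ((a.ft t p - Nf a b t * a.f t p) ^ 2
  + (b.ft t p - Nf a b t * b.f t p) ^ 2)
def Nf' (t : ℝ) : ℝ := (2 * Df a b t + G a b t - K a b t) / H a b t
end

variable {a b : Fn}

lemma pi_neg_lt : -π < π := by linarith [pi_pos]

lemma H_pos (t : ℝ) : 0 < H a b t := by
  apply intervalIntegral.intervalIntegral_pos_of_pos_on
  · exact Continuous.intervalIntegrable (by fun_prop) _ _
  · intro p _; have := a.pos t p; positivity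
  · exact pi_neg_lt

lemma G_nonneg (t : ℝ) : 0 ≤ G a b t :=
  intervalIntegral.integral_nonneg pi_neg_lt.le fun p _ => by positivity
lemma S_nonneg (t : ℝ) : 0 ≤ S a b t :=
  intervalIntegral.integral_nonneg pi_neg_lt.le fun p _ => by positivity
lemma Th_nonneg (t : ℝ) : 0 ≤ Th a b t :=
  intervalIntegral.integral_nonneg pi_neg_lt.le fun p _ => by positivity
lemma Df_nonneg (t : ℝ) : 0 ≤ Df a b t :=
  intervalIntegral.integral_nonneg pi_neg_lt.le fun p _ => by positivity

lemma ii_add {x y : ℝ} {f g : ℝ → ℝ} (hf : Continuous f) (hg : Continuous g) :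
    ∫ p in x..y, (f p + g p) = (∫ p in x..y, f p) + ∫ p in x..y, g p :=
  intervalIntegral.integral_add (hf.intervalIntegrable _ _) (hg.intervalIntegrable _ _)
lemma ii_sub {x y : ℝ} {f g : ℝ → ℝ} (hf : Continuous f) (hg : Continuous g) :
    ∫ p in x..y, (f p - g p) = (∫ p in x..y, f p) - ∫ p in x..y, g p :=
  intervalIntegral.integral_sub (hf.intervalIntegrable _ _) (hg.intervalIntegrable _ _)
lemma ii_smul {x y : ℝ} (c : ℝ) (f : ℝ → ℝ) :
    ∫ p in x..y, c * f p = c * ∫ p in x..y, f p := intervalIntegral.integral_const_mul _ _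
lemma ii_mono {x y : ℝ} (hxy : x ≤ y) {f g : ℝ → ℝ} (hf : Continuous f) (hg : Continuous g)
    (h : ∀ p ∈ Icc x y, f p ≤ g p) : ∫ p in x..y, f p ≤ ∫ p in x..y, g p :=
  intervalIntegral.integral_mono_on hxy (hf.intervalIntegrable _ _) (hg.intervalIntegrable _ _) h

lemma H_deriv (t : ℝ) : HasDerivAt (H a b) (2 * D a b t) t := by
  have := hasDerivAt_param (F := fun t p => (a.f t p) ^ 2 + (b.f t p) ^ 2)
    (F' := fun t p => 2 * (a.f t p * a.ft t p + b.f t p * b.ft t p)) (-π) π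
    (by fun_prop) (by fun_prop) (fun t p =>
      (((a.dt t p).pow 2).add ((b.dt t p).pow 2)).congr_deriv (by simp; ring)) t
  exact this.congr_deriv (ii_smul _ _)

lemma K_eq (t : ℝ) : K a b t = S a b t - Th a b t - G a b t := by
  rw [S, Th, G, ← ii_sub (by fun_prop) (by fun_prop), ← ii_sub (by fun_prop) (by fun_prop), K]
  congr 1; ext p; ring

lemma D_deriv (h : Sys a b) (t : ℝ) :
    HasDerivAt (D a b) (S a b t + Th a b t + 2 * G a b t) t := by
  have := hasDerivAt_param (F := fun t p => a.f t p * a.ft t p + b.f t p * b.ft t p)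
    (F' := fun t p => (a.ft t p * a.ft t p + a.f t p * a.ftt t p)
      + (b.ft t p * b.ft t p + b.f t p * b.ftt t p)) (-π) π
    (by fun_prop) (by fun_prop) (fun t p =>
      ((a.dt t p).mul (a.dtt t p)).add ((b.dt t p).mul (b.dtt t p))) t
  refine this.congr_deriv ?_
  have h0 := int_per (F := fun p => a.f t p * a.fp t p + b.f t p * b.fp t p)
    (F' := fun p => (a.fp t p * a.fp t p + a.f t p * a.fpp t p)
      + (b.fp t p * b.fp t p + b.f t p * b.fpp t p))
    (fun p => ((a.dp t p).mul (a.dpp t p)).add ((b.dp t p).mul (b.dpp t p))) (by fun_prop)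
    (by rw [a.per', b.per', a.perp', b.perp'])
  rw [eq_comm, S, Th, G, ← ii_smul, ← ii_add (by fun_prop) (by fun_prop),
    ← ii_add (by fun_prop) (by fun_prop), ← sub_zero (∫ p in (-π)..π, (_ : ℝ)), ← h0,
    ← ii_sub (by fun_prop) (by fun_prop)]
  congr 1; ext p
  linear_combination (-a.f t p) * h.eqa t p - (b.f t p) * h.eqb t p

lemma K_deriv (h : Sys a b) (t : ℝ) : HasDerivAt (K a b) (-2 * G a b t) t := by
  have := hasDerivAt_param (F := fun t p => (a.ft t p) ^ 2 + (b.ft t p) ^ 2 - (a.fp t p) ^ 2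
      - (b.fp t p) ^ 2 - exp (2 * t) * (a.f t p) ^ 2 * (b.f t p) ^ 2)
    (F' := fun t p => 2 * a.ft t p * a.ftt t p + 2 * b.ft t p * b.ftt t p
      - 2 * a.fp t p * a.ftp t p - 2 * b.fp t p * b.ftp t p
      - ((2 * exp (2 * t) * (a.f t p) ^ 2 + exp (2 * t) * (2 * a.f t p * a.ft t p)) * (b.f t p) ^ 2
        + exp (2 * t) * (a.f t p) ^ 2 * (2 * b.f t p * b.ft t p))) (-π) π
    (by fun_prop) (by fun_prop) (fun t p => by
      have e : HasDerivAt (fun t => exp (2 * t)) (2 * exp (2 * t)) t := by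
        simpa [mul_comm] using ((hasDerivAt_id t).const_mul 2).exp
      refine ((((((a.dtt t p).pow 2).add ((b.dtt t p).pow 2)).sub ((a.dpt t p).pow 2)).sub
        ((b.dpt t p).pow 2)).sub ((e.mul ((a.dt t p).pow 2)).mul ((b.dt t p).pow 2))).congr_deriv ?_
      simp) t
  refine this.congr_deriv ?_
  have h0 := int_per (F := fun p => a.ft t p * a.fp t p + b.ft t p * b.fp t p)
    (F' := fun p => (a.ftp t p * a.fp t p + a.ft t p * a.fpp t p)
      + (b.ftp t p * b.fp t p + b.ft t p * b.fpp t p))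
    (fun p => ((a.dtp t p).mul (a.dpp t p)).add ((b.dtp t p).mul (b.dpp t p))) (by fun_prop)
    (by rw [a.pert', b.pert', a.perp', b.perp'])
  replace h0 := congrArg (fun x => 2 * x) h0
  simp only [mul_zero] at h0
  rw [← ii_smul] at h0
  rw [G, ← ii_smul, ← sub_zero (∫ p in (-π)..π, -2 * (_ : ℝ)), ← h0,
    ← ii_sub (by fun_prop) (by fun_prop)]
  congr 1; ext p
  linear_combination (2 * a.ft t p) * h.eqa t p + (2 * b.ft t p) * h.eqb t p

lemma int_abs_le {F : ℝ → ℝ} {C : ℝ} (h : ∀ p, |F p| ≤ C) :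
    |∫ p in (-π)..π, F p| ≤ C * (2 * π) := by
  have := intervalIntegral.norm_integral_le_of_norm_le_const (a := -π) (b := π) (f := F) (C := C)
    (fun p _ => h p)
  rw [Real.norm_eq_abs] at this
  refine this.trans (le_of_eq ?_)
  rw [abs_of_pos (by linarith [pi_pos])]; ring

lemma tendsto_zero_of_bound {F : ℝ → ℝ} {C : ℝ} (h : ∀ t ≤ 0, |F t| ≤ C * exp t) :
    Tendsto F atBot (𝓝 0) := by
  apply squeeze_zero_norm' (a := fun t => C * exp t)
  · filter_upwards [eventually_le_atBot 0] with t ht using h t ht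
  · simpa using tendsto_exp_atBot.const_mul C

lemma K_nonpos (h : Sys a b) (t : ℝ) : K a b t ≤ 0 := by
  have hanti : Antitone (K a b) := antitone_of_deriv (K_deriv h) (fun t => by
    have := G_nonneg (a := a) (b := b) t; linarith)
  obtain ⟨C, hC⟩ := h.bdd
  have hb : ∀ t ≤ 0, |K a b t| ≤ ((4 * C ^ 2 + C ^ 4) * (2 * π)) * exp t := by
    intro t ht
    have : |K a b t| ≤ ((4 * C ^ 2 + C ^ 4) * exp t) * (2 * π) := by
      apply int_abs_le
      intro p
      obtain ⟨h1, h2, h3, h4, h5, h6⟩ := hC t ht p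
      have e1 : exp t ≤ 1 := exp_le_one_iff.2 ht
      have e0 := exp_pos t
      have hC0 : 0 ≤ C := (abs_nonneg _).trans h1
      have q : ∀ x, |x| ≤ C * exp t → x ^ 2 ≤ C ^ 2 * exp t := by
        intro x hx
        have := pow_le_pow_left₀ (abs_nonneg x) hx 2
        rw [sq_abs] at this
        refine this.trans ?_
        rw [mul_pow]; gcongr; nlinarith
      have q3 := q _ h3
      have q4 := q _ h4
      have q5 := q _ h5
      have q6 := q _ h6
      have r1 : (a.f t p) ^ 2 ≤ C ^ 2 := by
        rw [← sq_abs]; exact pow_le_pow_left₀ (abs_nonneg _) h1 2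
      have r2 : (b.f t p) ^ 2 ≤ C ^ 2 := by
        rw [← sq_abs]; exact pow_le_pow_left₀ (abs_nonneg _) h2 2
      have e2 : exp (2 * t) ≤ exp t := exp_le_exp.2 (by linarith)
      have r3 : exp (2 * t) * (a.f t p) ^ 2 * (b.f t p) ^ 2 ≤ exp t * C ^ 2 * C ^ 2 := by
        gcongr
      have r4 : 0 ≤ exp (2 * t) * (a.f t p) ^ 2 * (b.f t p) ^ 2 := by positivity
      have s1 := sq_nonneg (a.ft t p)
      have s2 := sq_nonneg (b.ft t p)
      have s3 := sq_nonneg (a.fp t p)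
      have s4 := sq_nonneg (b.fp t p)
      have s5 : 0 ≤ C ^ 2 * exp t := by positivity
      have s6 : 0 ≤ C ^ 4 * exp t := by positivity
      rw [abs_le]; constructor <;> nlinarith
    linarith
  exact hanti.ge_of_tendsto (tendsto_zero_of_bound hb) t

lemma D_nonneg (h : Sys a b) (t : ℝ) : 0 ≤ D a b t := by
  have hmono : Monotone (D a b) := monotone_of_deriv (D_deriv h) (fun t => by
    have := G_nonneg (a := a) (b := b) t
    have := S_nonneg (a := a) (b := b) t
    have := Th_nonneg (a := a) (b := b) t
    linarith)
  obtain ⟨C, hC⟩ := h.bdd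
  have hb : ∀ t ≤ 0, |D a b t| ≤ ((2 * C ^ 2) * (2 * π)) * exp t := by
    intro t ht
    have : |D a b t| ≤ ((2 * C ^ 2) * exp t) * (2 * π) := by
      apply int_abs_le
      intro p
      obtain ⟨h1, h2, h3, h4, h5, h6⟩ := hC t ht p
      have hC0 : 0 ≤ C := (abs_nonneg _).trans h1
      calc |a.f t p * a.ft t p + b.f t p * b.ft t p|
          ≤ |a.f t p| * |a.ft t p| + |b.f t p| * |b.ft t p| := by
            rw [← abs_mul, ← abs_mul]; exact abs_add_le _ _
        _ ≤ C * (C * exp t) + C * (C * exp t) := by gcongr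
        _ = _ := by ring
    linarith
  exact hmono.le_of_tendsto (tendsto_zero_of_bound hb) t

lemma N_nonneg (h : Sys a b) (t : ℝ) : 0 ≤ Nf a b t := div_nonneg (D_nonneg h t) (H_pos t).le

lemma D_eq (t : ℝ) : D a b t = Nf a b t * H a b t := by
  rw [Nf, div_mul_cancel₀ _ (H_pos t).ne']

lemma Df_eq (t : ℝ) : Df a b t = S a b t - Nf a b t ^ 2 * H a b t := by
  have : Df a b t = S a b t - 2 * Nf a b t * D a b t + Nf a b t ^ 2 * H a b t := by
    rw [S, D, H, ← ii_smul, ← ii_smul, ← ii_sub (by fun_prop) (by fun_prop),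
      ← ii_add (by fun_prop) (by fun_prop), Df]
    congr 1; ext p; ring
  rw [this, D_eq]; ring

lemma N_deriv (h : Sys a b) (t : ℝ) : HasDerivAt (Nf a b) (Nf' a b t) t := by
  have := (D_deriv h t).div (H_deriv (a := a) (b := b) t) (H_pos t).ne'
  refine this.congr_deriv ?_
  have hH := (H_pos (a := a) (b := b) t).ne'
  rw [Nf', Df_eq, K_eq, D_eq]
  field_simp
  ring

lemma N'_H (t : ℝ) : Nf' a b t * H a b t = 2 * Df a b t + G a b t - K a b t := by
  rw [Nf', div_mul_cancel₀ _ (H_pos t).ne']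

lemma N'_nonneg (h : Sys a b) (t : ℝ) : 0 ≤ Nf' a b t :=
  div_nonneg (by
    have := Df_nonneg (a := a) (b := b) t
    have := G_nonneg (a := a) (b := b) t
    linarith [K_nonpos h t]) (H_pos t).le

lemma N_mono (h : Sys a b) : Monotone (Nf a b) := monotone_of_deriv (N_deriv h) (N'_nonneg h)

lemma Df_G_le (h : Sys a b) (t : ℝ) : Df a b t + G a b t ≤ Nf' a b t * H a b t := by
  rw [N'_H]; linarith [Df_nonneg (a := a) (b := b) t, K_nonpos h t]

lemma Th_le (t : ℝ) : Th a b t ≤ (Nf' a b t + Nf a b t ^ 2) * H a b t := by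
  have h1 := N'_H (a := a) (b := b) t
  have h2 := Df_eq (a := a) (b := b) t
  have h3 := K_eq (a := a) (b := b) t
  have := G_nonneg (a := a) (b := b) t
  have := Df_nonneg (a := a) (b := b) t
  nlinarith

/-- logarithmic bounds for H -/
lemma H_le (h : Sys a b) {c : ℝ} {s t : ℝ} (hst : s ≤ t) (hc : Nf a b t ≤ c) :
    H a b t ≤ H a b s * exp (2 * c * (t - s)) := by
  have hd : ∀ t, HasDerivAt (fun t => Real.log (H a b t)) (2 * Nf a b t) t := fun t => by
    refine ((H_deriv t).log (H_pos t).ne').congr_deriv ?_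
    rw [Nf]; ring
  have := sub_le_sub_of_deriv_le hd (g := fun t => 2 * c * t) (g' := fun _ => 2 * c)
    (fun t => by simpa using (hasDerivAt_id t).const_mul (2 * c)) hst (fun r hr => by
      have := N_mono h hr.2.le; linarith)
  have h1 : Real.log (H a b t) ≤ Real.log (H a b s) + 2 * c * (t - s) := by linarith
  rw [← Real.log_exp (2 * c * (t - s)), ← Real.log_mul (H_pos s).ne' (exp_pos _).ne'] at h1
  exact (Real.log_le_log_iff (H_pos t) (mul_pos (H_pos s) (exp_pos _))).1 h1

lemma le_H (h : Sys a b) {c : ℝ} {s t : ℝ} (hst : s ≤ t) (hc : c ≤ Nf a b s) :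
    H a b s * exp (2 * c * (t - s)) ≤ H a b t := by
  have hd : ∀ t, HasDerivAt (fun t => Real.log (H a b t)) (2 * Nf a b t) t := fun t => by
    refine ((H_deriv t).log (H_pos t).ne').congr_deriv ?_
    rw [Nf]; ring
  have := sub_le_sub_of_deriv_le (f := fun t => 2 * c * t) (f' := fun _ => 2 * c)
    (fun t => by simpa using (hasDerivAt_id t).const_mul (2 * c)) hd hst (fun r hr => by
      have := N_mono h hr.1.le; linarith)
  have h1 : Real.log (H a b s) + 2 * c * (t - s) ≤ Real.log (H a b t) := by linarith
  rw [← Real.log_exp (2 * c * (t - s)), ← Real.log_mul (H_pos s).ne' (exp_pos _).ne'] at h1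
  exact (Real.log_le_log_iff (mul_pos (H_pos s) (exp_pos _)) (H_pos t)).1 h1

lemma H_mono (h : Sys a b) : Monotone (H a b) := fun s t hst => by
  have := le_H h hst (N_nonneg h s); simpa using this

lemma N_bdd (h : Sys a b) : ∃ β, ∀ t, Nf a b t ≤ β := by
  obtain ⟨C, β, hC⟩ := h.growth
  refine ⟨β, fun t => ?_⟩
  by_contra! hlt
  set c := Nf a b t with hcdef
  have hC0 : 0 ≤ C := by
    have := (hC 0 le_rfl 0).1.trans' (a.pos 0 0).le
    simpa using this
  -- upper bound of H
  have hup : ∀ s, 0 ≤ s → H a b s ≤ (2 * C ^ 2 * (2 * π)) * exp (2 * β * s) := by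
    intro s hs
    have := int_abs_le (F := fun p => (a.f s p) ^ 2 + (b.f s p) ^ 2)
      (C := 2 * C ^ 2 * exp (2 * β * s)) (fun p => by
        have ⟨h1, h2⟩ := hC s hs p
        have e : exp (2 * β * s) = exp (β * s) ^ 2 := by rw [← exp_nat_mul]; ring_nf
        have h1' := pow_le_pow_left₀ (a.pos s p).le h1 2
        have h2' := pow_le_pow_left₀ (b.pos s p).le h2 2
        rw [abs_of_nonneg (by positivity), e]
        nlinarith)
    have := (le_abs_self _).trans this
    change H a b s ≤ _ at this
    linarith
  have hlow : ∀ s, t ≤ s → H a b t * exp (2 * c * (s - t)) ≤ H a b s := fun s hs =>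
    le_H h hs le_rfl
  -- contradiction
  have hlim : Tendsto (fun s => exp (2 * (c - β) * s)) atTop atTop :=
    tendsto_exp_atTop.comp (tendsto_id.const_mul_atTop (by linarith))
  have hHt := H_pos (a := a) (b := b) t
  obtain ⟨s, hs1, hs2⟩ := ((hlim.eventually_gt_atTop
    ((2 * C ^ 2 * (2 * π)) * exp (2 * c * t) / H a b t)).and
    (eventually_ge_atTop (max t 0))).exists
  have h1 := (hlow s ((le_max_left _ _).trans hs2)).trans (hup s ((le_max_right _ _).trans hs2))
  rw [div_lt_iff₀ hHt] at hs1
  have e1 : exp (2 * c * (s - t)) = exp (2 * (c - β) * s) * exp (2 * β * s) / exp (2 * c * t) := by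
    rw [← exp_add, ← exp_sub]; ring_nf
  rw [e1, ← mul_div_assoc, div_le_iff₀ (exp_pos _)] at h1
  have := exp_pos (2 * β * s)
  nlinarith

end HM

namespace HM
open Real Set Filter Topology
variable {a b : Fn}

lemma H_comm : H a b = H b a := by ext t; simp only [H]; congr 1; ext p; ring
lemma D_comm : D a b = D b a := by ext t; simp only [D]; congr 1; ext p; ring
lemma Nf_comm : Nf a b = Nf b a := by ext t; simp only [Nf, H_comm (a := a), D_comm (a := a)]

lemma exists_lim (h : Sys a b) : ∃ d, Tendsto (Nf a b) atTop (𝓝 d) ∧ ∀ t, Nf a b t ≤ d := by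
  obtain ⟨β, hβ⟩ := N_bdd h
  have hb : BddAbove (range (Nf a b)) := ⟨β, by rintro _ ⟨t, rfl⟩; exact hβ t⟩
  exact ⟨_, tendsto_atTop_ciSup (N_mono h) hb, fun t => le_ciSup hb t⟩

lemma osc_small {f : ℝ → ℝ} {d : ℝ} (hd : Tendsto f atTop (𝓝 d)) (L M : ℝ) {ω : ℝ} (hω : 0 < ω) :
    ∀ᶠ T in atTop, f (T + L) - f (T - M) ≤ ω := by
  have h1 : Tendsto (fun T => f (T + L) - f (T - M)) atTop (𝓝 (d - d)) :=
    (hd.comp (tendsto_atTop_add_const_right _ L tendsto_id)).sub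
      (hd.comp (tendsto_atTop_add_const_right _ (-M) tendsto_id))
  rw [sub_self] at h1
  exact (h1.eventually_lt_const hω).mono fun T hT => hT.le

lemma arc_le {F : ℝ → ℝ} (hF : Continuous F) (hper : ∀ p, F (p + 2 * π) = F p)
    (h0 : ∀ p, 0 ≤ F p) {x y : ℝ} (hxy : x ≤ y) (hy : y - x ≤ 2 * π) :
    ∫ p in x..y, F p ≤ ∫ p in (-π)..π, F p := by
  have h1 : ∫ p in x..y, F p ≤ ∫ p in x..(x + 2 * π), F p := by
    apply intervalIntegral.integral_mono_interval le_rfl hxy (by linarith)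
    · exact Eventually.of_forall h0
    · exact hF.intervalIntegrable _ _
  have h2 := Function.Periodic.intervalIntegral_add_eq (f := F) (T := 2 * π) hper x (-π)
  rw [h2] at h1
  convert h1 using 2; ring

lemma slow {y y' N N' : ℝ → ℝ} {C : ℝ} (hN : ∀ t, HasDerivAt N (N' t) t)
    (hy : ∀ t, HasDerivAt y (y' t) t) {δ : ℝ}
    (hb : ∀ t, |y' t| ≤ C * (δ + N' t / δ)) {s t : ℝ} (hst : s ≤ t) :
    |y t - y s| ≤ C * (δ * (t - s) + (N t - N s) / δ) := by
  have hg : ∀ t, HasDerivAt (fun t => C * (δ * t + N t / δ)) (C * (δ + N' t / δ)) t := fun t => by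
    have := (((hasDerivAt_id t).const_mul δ).add ((hN t).div_const δ)).const_mul C
    simpa using this
  have h1 := sub_le_sub_of_deriv_le hy hg hst (fun t _ => (le_abs_self _).trans (hb t))
  have h2 := sub_le_sub_of_deriv_le (fun t => (hy t).neg) hg hst
    (fun t _ => (neg_le_abs _).trans (hb t))
  simp only [Pi.neg_apply] at h2
  have e : C * (δ * t + N t / δ) - C * (δ * s + N s / δ)
    = C * (δ * (t - s) + (N t - N s) / δ) := by ring
  rw [abs_le]; constructor <;> linarith

/-- mean value theorem for N -/
lemma exists_slice (h : Sys a b) {s t : ℝ} (hst : s < t) :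
    ∃ r ∈ Ioo s t, Nf' a b r = (Nf a b t - Nf a b s) / (t - s) := by
  obtain ⟨r, hr, h2⟩ := exists_hasDerivAt_eq_slope (Nf a b) (Nf' a b) hst
    (fun r _ => (N_deriv h r).continuousAt.continuousWithinAt) (fun r _ => N_deriv h r)
  exact ⟨r, hr, h2⟩

lemma sqrtH_deriv (t : ℝ) :
    HasDerivAt (fun t => √(H a b t)) (Nf a b t * √(H a b t)) t := by
  refine ((H_deriv t).sqrt (H_pos t).ne').congr_deriv ?_
  have hs := Real.sqrt_pos.2 (H_pos (a := a) (b := b) t)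
  rw [D_eq]
  have := Real.mul_self_sqrt (H_pos (a := a) (b := b) t).le
  field_simp
  rw [Real.sq_sqrt (H_pos (a := a) (b := b) t).le]

/-- error from the deficit: `L¹` version. -/
lemma err1 (h : Sys a b) {w : ℝ → ℝ} (hw : Continuous w) (hw1 : ∀ p, |w p| ≤ 1) {x y : ℝ}
    (hxy : x ≤ y) (hy : y - x ≤ 2 * π) {δ : ℝ} (hδ : 0 < δ) (t : ℝ) :
    |(∫ p in x..y, (a.ft t p - Nf a b t * a.f t p) * w p) / √(H a b t)|
      ≤ 2 * π * (δ + Nf' a b t / δ) := by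
  have hH := H_pos (a := a) (b := b) t
  have hs := Real.sqrt_pos.2 hH
  rw [abs_div, abs_of_pos hs, div_le_iff₀ hs]
  have h1 : |∫ p in x..y, (a.ft t p - Nf a b t * a.f t p) * w p|
      ≤ ∫ p in x..y, (δ * √(H a b t) + (a.ft t p - Nf a b t * a.f t p) ^ 2 / (δ * √(H a b t))) := by
    refine (intervalIntegral.abs_integral_le_integral_abs hxy).trans ?_
    apply ii_mono hxy (by fun_prop) (by fun_prop)
    intro p _
    rw [abs_mul]
    set z := a.ft t p - Nf a b t * a.f t p
    set q := δ * √(H a b t)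
    have hq : 0 < q := mul_pos hδ hs
    have : |z| ≤ q + z ^ 2 / q := by
      rw [← sub_nonneg, ← sq_abs z]
      have : q + |z| ^ 2 / q - |z| = (q ^ 2 + |z| ^ 2 - |z| * q) / q := by field_simp
      rw [this]; apply div_nonneg _ hq.le
      nlinarith [sq_nonneg (q - |z|), sq_nonneg q, sq_nonneg |z|]
    calc |z| * |w p| ≤ |z| * 1 := by gcongr; exact hw1 p
      _ ≤ _ := by linarith
  rw [ii_add (by fun_prop) (by fun_prop), intervalIntegral.integral_const,
    intervalIntegral.integral_div] at h1
  have h2 : ∫ p in x..y, (a.ft t p - Nf a b t * a.f t p) ^ 2 ≤ Df a b t := by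
    refine (arc_le (by fun_prop) (fun p => by rw [a.pert, a.per]) (fun p => sq_nonneg _) hxy hy).trans ?_
    exact ii_mono pi_neg_lt.le (by fun_prop) (by fun_prop) (fun p _ => by
      have := sq_nonneg (b.ft t p - Nf a b t * b.f t p); linarith)
  have h3 : Df a b t ≤ Nf' a b t * (√(H a b t) * √(H a b t)) := by
    rw [Real.mul_self_sqrt hH.le]
    have := G_nonneg (a := a) (b := b) t
    linarith [Df_G_le h t]
  have h4 : (∫ p in x..y, (a.ft t p - Nf a b t * a.f t p) ^ 2) / (δ * √(H a b t))
      ≤ Nf' a b t / δ * √(H a b t) := by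
    rw [div_le_iff₀ (by positivity)]
    calc _ ≤ _ := h2.trans h3
      _ = _ := by field_simp
  have h5 : (y - x) • (δ * √(H a b t)) ≤ 2 * π * (δ * √(H a b t)) := by
    rw [smul_eq_mul]; gcongr
  have h6 : 0 ≤ Nf' a b t / δ * √(H a b t) := by
    have := N'_nonneg h t; positivity
  have h7 := Real.pi_gt_three
  nlinarith

noncomputable section
/-- normalized first moment -/
def mu (a b : Fn) (x y : ℝ) (w : ℝ → ℝ) (t : ℝ) : ℝ := (∫ p in x..y, a.f t p * w p) / √(H a b t)
def er (a b : Fn) (x y : ℝ) (w : ℝ → ℝ) (t : ℝ) : ℝ :=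
  (∫ p in x..y, (a.ft t p - Nf a b t * a.f t p) * w p) / √(H a b t)
/-- normalized quadratic mass -/
def ms (a b : Fn) (x y : ℝ) (t : ℝ) : ℝ := (∫ p in x..y, (a.f t p) ^ 2) / H a b t
end

lemma er_eq {w : ℝ → ℝ} (hw : Continuous w) (x y t : ℝ) :
    (∫ p in x..y, a.ft t p * w p) / √(H a b t) = er a b x y w t + Nf a b t * mu a b x y w t := by
  rw [er, mu, mul_div_assoc', ← add_div, ← ii_smul, ← ii_add (by fun_prop) (by fun_prop)]
  congr 2; ext p; ring

lemma mu_deriv {w : ℝ → ℝ} (hw : Continuous w) (x y t : ℝ) :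
    HasDerivAt (mu a b x y w) (er a b x y w t) t := by
  have h1 := hasDerivAt_param (F := fun t p => a.f t p * w p) (F' := fun t p => a.ft t p * w p) x y
    (by fun_prop) (by fun_prop) (fun t p => (a.dt t p).mul_const (w p)) t
  have hs := Real.sqrt_pos.2 (H_pos (a := a) (b := b) t)
  refine (h1.div (sqrtH_deriv (a := a) (b := b) t) hs.ne').congr_deriv ?_
  have := er_eq (a := a) (b := b) hw x y t
  rw [← sub_eq_iff_eq_add] at this
  rw [← this, mu]
  field_simp

/-- slow variation of first moments -/
lemma mu_slow (h : Sys a b) {w : ℝ → ℝ} (hw : Continuous w) (hw1 : ∀ p, |w p| ≤ 1) {x y : ℝ}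
    (hxy : x ≤ y) (hy : y - x ≤ 2 * π) {δ : ℝ} (hδ : 0 < δ) {s t : ℝ} (hst : s ≤ t) :
    |mu a b x y w t - mu a b x y w s| ≤ 2 * π * (δ * (t - s) + (Nf a b t - Nf a b s) / δ) :=
  slow (N_deriv h) (mu_deriv hw x y) (err1 h hw hw1 hxy hy hδ) hst

lemma ms_nonneg {x y : ℝ} (hxy : x ≤ y) (t : ℝ) : 0 ≤ ms a b x y t :=
  div_nonneg (intervalIntegral.integral_nonneg hxy fun p _ => sq_nonneg _) (H_pos t).le

set_option maxHeartbeats 1000000 in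
/-- Eigenvalue contradiction. -/
lemma eigen (h : Sys a b) {d : ℝ} (hd : Tendsto (Nf a b) atTop (𝓝 d)) {x y : ℝ} (hxy : x < y)
    (hy : y - x ≤ 2 * π) (hlam : π / (y - x) < d) {c : ℝ} (hc : 0 < c) (C : ℝ) :
    ∀ᶠ T in atTop, (∫ t in T..(T + 3), ∫ p in x..y, exp (2 * t) * (b.f t p) ^ 2) ≤ C →
      c ≤ mu a b x y (fun p => sin (π / (y - x) * (p - x))) T → False := by
  set l := π / (y - x) with hl
  have hl0 : 0 < l := div_pos pi_pos (by linarith)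
  set w : ℝ → ℝ := fun p => sin (l * (p - x)) with hw
  have hwc : Continuous w := by fun_prop
  have hw1 : ∀ p, |w p| ≤ 1 := fun p => abs_sin_le_one _
  obtain ⟨β, hβ⟩ := N_bdd h
  have hβ0 : 0 ≤ β := (N_nonneg h 0).trans (hβ 0)
  set κ := (d ^ 2 - l ^ 2) / 2 with hκ
  have hκ0 : 0 < κ := by
    have : l ^ 2 < d ^ 2 := pow_lt_pow_left₀ hlam hl0.le two_ne_zero
    linarith
  have hN2 : ∀ᶠ T in atTop, l ^ 2 + κ ≤ Nf a b T ^ 2 := by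
    have : Tendsto (fun T => Nf a b T ^ 2) atTop (𝓝 (d ^ 2)) := hd.pow 2
    exact (this.eventually_const_lt (by linarith : l ^ 2 + κ < d ^ 2)).mono fun T hT => hT.le
  -- constants
  set A := |C| + 1 + 20 * π * β + 8 * π with hA
  have hA0 : 0 < A := by have := pi_pos; positivity
  set δ := min (κ * c / (8 * A)) (c / (16 * π)) with hδdef
  have hδ : 0 < δ := by have := pi_pos; rw [hδdef]; positivity
  have hδ1 : A * δ ≤ κ * c / 8 := by
    have : δ ≤ κ * c / (8 * A) := min_le_left _ _
    rw [le_div_iff₀ (by positivity)] at this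
    linarith
  have hδ2 : 8 * π * δ ≤ c / 2 := by
    have : δ ≤ c / (16 * π) := min_le_right _ _
    rw [le_div_iff₀ (by have := pi_pos; positivity)] at this
    linarith
  filter_upwards [hN2, osc_small hd 3 0 (pow_pos hδ 2)] with T hT1 hT2 hCb hmu
  rw [sub_zero] at hT2
  -- windows
  have hosc : ∀ {s t}, T ≤ s → s ≤ t → t ≤ T + 3 → (Nf a b t - Nf a b s) / δ ≤ δ := by
    intro s t h1 h2 h3
    rw [div_le_iff₀ hδ, ← pow_two]
    have := N_mono h h1
    have := N_mono h h3
    linarith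
  have hmus : ∀ {s t}, T ≤ s → s ≤ t → t ≤ T + 3 → |mu a b x y w t - mu a b x y w s| ≤ 8 * π * δ := by
    intro s t h1 h2 h3
    have h4 := mu_slow h hwc hw1 hxy.le hy hδ h2
    have h5 := hosc h1 h2 h3
    have : δ * (t - s) ≤ δ * 3 := by gcongr; linarith
    have h6 : 0 ≤ 2 * π := by have := pi_pos; positivity
    have := mul_le_mul_of_nonneg_left (add_le_add this h5) h6
    linarith
  have hmu2 : ∀ t, T ≤ t → t ≤ T + 3 → c / 2 ≤ mu a b x y w t := by
    intro t h1 h2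
    have := (abs_le.1 (hmus le_rfl h1 h2)).1
    linarith
  -- the function M1
  set M1 : ℝ → ℝ := fun t => er a b x y w t + Nf a b t * mu a b x y w t with hM1
  set Q : ℝ → ℝ := fun t => ∫ p in x..y, exp (2 * t) * a.f t p * (b.f t p) ^ 2 * w p with hQ
  set m : ℝ → ℝ := fun t => ∫ p in x..y, a.f t p * w p with hm
  have hM1d : ∀ t, HasDerivAt M1 (l ^ 2 * mu a b x y w t
      + (Q t - l * (a.f t x + a.f t y)) / √(H a b t) - Nf a b t * M1 t) t := by
    intro t
    have h1 := hasDerivAt_param (F := fun t p => a.ft t p * w p) (F' := fun t p => a.ftt t p * w p)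
      x y (by fun_prop) (by fun_prop) (fun t p => (a.dtt t p).mul_const (w p)) t
    have hs := Real.sqrt_pos.2 (H_pos (a := a) (b := b) t)
    have hM1' : M1 = fun t => (∫ p in x..y, a.ft t p * w p) / √(H a b t) := by
      ext t; rw [er_eq hwc]
    rw [hM1']
    refine (h1.div (sqrtH_deriv (a := a) (b := b) t) hs.ne').congr_deriv ?_
    have hwd : ∀ p, HasDerivAt w (l * cos (l * (p - x))) p := fun p => by
      have := (((hasDerivAt_id p).sub_const x).const_mul l).sin
      simpa [mul_comm] using this
    have hwdd : ∀ p, HasDerivAt (fun p => l * cos (l * (p - x))) (- l ^ 2 * w p) p := fun p => by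
      have := ((((hasDerivAt_id p).sub_const x).const_mul l).cos).const_mul l
      refine this.congr_deriv ?_
      simp [hw]; ring
    have h0 := intervalIntegral.integral_eq_sub_of_hasDerivAt (a := x) (b := y)
      (f := fun p => a.fp t p * w p - a.f t p * (l * cos (l * (p - x))))
      (f' := fun p => a.fpp t p * w p + l ^ 2 * (a.f t p * w p))
      (fun p _ => (((a.dpp t p).mul (hwd p)).sub ((a.dp t p).mul (hwdd p))).congr_deriv (by ring))
      (Continuous.intervalIntegrable (by fun_prop) _ _)
    have wx : w x = 0 := by simp [hw]
    have hly : l * (y - x) = π := by rw [hl]; field_simp [(by linarith : y - x ≠ 0)]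
    have wy : w y = 0 := by simp [hw, hly]
    rw [ii_add (by fun_prop) (by fun_prop), ii_smul] at h0
    simp only [wx, wy, hly, sub_self, mul_zero, cos_zero, cos_pi] at h0
    have h2 : (∫ p in x..y, a.ftt t p * w p) = l ^ 2 * m t + Q t - l * (a.f t x + a.f t y) := by
      have h3 : (∫ p in x..y, a.ftt t p * w p) + (∫ p in x..y, a.fpp t p * w p) = Q t := by
        rw [← ii_add (by fun_prop) (by fun_prop)]
        congr 1; ext p
        linear_combination (w p) * h.eqa t p
      linear_combination h3 - h0
    rw [h2, mu]
    field_simp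
    ring
  have hwnn : ∀ p ∈ Icc x y, 0 ≤ w p := by
    intro p hp
    have hly : l * (y - x) = π := by rw [hl]; field_simp [(by linarith : y - x ≠ 0)]
    apply sin_nonneg_of_nonneg_of_le_pi
    · exact mul_nonneg hl0.le (by linarith [hp.1])
    · rw [← hly]; gcongr; exact hp.2
  have hQb : ∀ t, Q t / √(H a b t) ≤
      δ * (∫ p in x..y, exp (2 * t) * (b.f t p) ^ 2) + Nf' a b t / δ := by
    intro t
    have hH := H_pos (a := a) (b := b) t
    have hs := Real.sqrt_pos.2 hH
    have h1 : Q t ≤ ∫ p in x..y, (δ * √(H a b t) * (exp (2 * t) * (b.f t p) ^ 2)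
        + 1 / (δ * √(H a b t)) * (exp (2 * t) * (a.f t p) ^ 2 * (b.f t p) ^ 2)) := by
      apply ii_mono hxy.le (by fun_prop) (by fun_prop)
      intro p hp
      have w1 : w p ≤ 1 := (le_abs_self _).trans (hw1 p)
      set q := δ * √(H a b t)
      have hq : 0 < q := mul_pos hδ hs
      have : a.f t p ≤ q + 1 / q * (a.f t p) ^ 2 := by
        rw [← sub_nonneg]
        have : q + 1 / q * (a.f t p) ^ 2 - a.f t p = (q ^ 2 + (a.f t p) ^ 2 - a.f t p * q) / q := by
          field_simp
        rw [this]; apply div_nonneg _ hq.le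
        nlinarith [sq_nonneg (q - a.f t p), sq_nonneg q, sq_nonneg (a.f t p)]
      have hE : 0 ≤ exp (2 * t) * (b.f t p) ^ 2 := by positivity
      have ha := a.pos t p
      calc exp (2 * t) * a.f t p * (b.f t p) ^ 2 * w p
          ≤ exp (2 * t) * a.f t p * (b.f t p) ^ 2 * 1 := by gcongr
        _ = (exp (2 * t) * (b.f t p) ^ 2) * a.f t p := by ring
        _ ≤ (exp (2 * t) * (b.f t p) ^ 2) * (q + 1 / q * (a.f t p) ^ 2) := by gcongr
        _ = _ := by ring
    rw [ii_add (by fun_prop) (by fun_prop), ii_smul (δ * √(H a b t)),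
      ii_smul (1 / (δ * √(H a b t)))] at h1
    have h2 : ∫ p in x..y, exp (2 * t) * (a.f t p) ^ 2 * (b.f t p) ^ 2 ≤ Nf' a b t * (√(H a b t) * √(H a b t)) := by
      rw [Real.mul_self_sqrt hH.le]
      have := arc_le (F := fun p => exp (2 * t) * (a.f t p) ^ 2 * (b.f t p) ^ 2) (by fun_prop)
        (fun p => by rw [a.per, b.per]) (fun p => by positivity) hxy.le hy
      change _ ≤ G a b t at this
      have := Df_nonneg (a := a) (b := b) t
      linarith [Df_G_le h t]
    rw [div_le_iff₀ hs]
    refine h1.trans ?_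
    have h3 : 1 / (δ * √(H a b t)) * (∫ p in x..y, exp (2 * t) * (a.f t p) ^ 2 * (b.f t p) ^ 2)
        ≤ Nf' a b t / δ * √(H a b t) := by
      rw [one_div, inv_mul_le_iff₀ (by positivity)]
      calc _ ≤ _ := h2
        _ = _ := by field_simp
    linarith
  have herr : ∀ t, |er a b x y w t| ≤ 2 * π * (δ + Nf' a b t / δ) := err1 h hwc hw1 hxy.le hy hδ
  -- derivative bound
  have hM1b : ∀ t, T ≤ t → t ≤ T + 3 → l ^ 2 * mu a b x y w t
      + (Q t - l * (a.f t x + a.f t y)) / √(H a b t) - Nf a b t * M1 t ≤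
      - (κ * c / 2) + (δ * (∫ p in x..y, exp (2 * t) * (b.f t p) ^ 2) + Nf' a b t / δ)
        + β * (2 * π * (δ + Nf' a b t / δ)) := by
    intro t h1 h2
    have hs := Real.sqrt_pos.2 (H_pos (a := a) (b := b) t)
    have e1 : (Q t - l * (a.f t x + a.f t y)) / √(H a b t) ≤ Q t / √(H a b t) := by
      gcongr
      have := a.pos t x
      have := a.pos t y
      nlinarith
    have e2 := hQb t
    have e3 := hmu2 t h1 h2
    have e4 : l ^ 2 + κ ≤ Nf a b t ^ 2 :=
      hT1.trans (pow_le_pow_left₀ (N_nonneg h T) (N_mono h h1) 2)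
    have e5 : - (Nf a b t * er a b x y w t) ≤ β * (2 * π * (δ + Nf' a b t / δ)) := by
      have : - (Nf a b t * er a b x y w t) ≤ Nf a b t * |er a b x y w t| := by
        have := neg_le_abs (er a b x y w t)
        have := N_nonneg h t
        nlinarith
      refine this.trans ?_
      exact mul_le_mul (hβ t) (herr t) (abs_nonneg _) hβ0
    have e6 : (κ * c / 2) ≤ (Nf a b t ^ 2 - l ^ 2) * mu a b x y w t := by
      have : κ * (c / 2) ≤ (Nf a b t ^ 2 - l ^ 2) * mu a b x y w t :=
        mul_le_mul (by linarith) e3 (by positivity) (by linarith)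
      linarith
    simp only [hM1]
    linarith
  -- slices
  obtain ⟨t1, ht1, hs1⟩ := exists_slice h (by linarith : T < T + 1)
  obtain ⟨t2, ht2, hs2⟩ := exists_slice h (by linarith : T + 2 < T + 3)
  have hs1' : Nf' a b t1 / δ ≤ δ := by
    rw [hs1]
    have := hosc (s := T) (t := T + 1) le_rfl (by linarith) (by linarith)
    simpa using this
  have hs2' : Nf' a b t2 / δ ≤ δ := by
    rw [hs2]
    have := hosc (s := T + 2) (t := T + 3) (by linarith) (by linarith) (by linarith)
    have e : T + 3 - (T + 2) = 1 := by ring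
    rw [e]; simpa using this
  have h12 : t1 ≤ t2 := by linarith [ht1.2, ht2.1]
  -- antiderivative
  set wf : ℝ → ℝ := fun t => ∫ p in x..y, exp (2 * t) * (b.f t p) ^ 2 with hwf
  have hwfc : Continuous wf := continuous_param x y (by fun_prop)
  have hWd : ∀ t, HasDerivAt (fun t => ∫ s in T..t, wf s) (wf t) t := fun t =>
    intervalIntegral.integral_hasDerivAt_right (hwfc.intervalIntegrable _ _)
      (hwfc.stronglyMeasurableAtFilter _ _) hwfc.continuousAt
  have hwf0 : ∀ t, 0 ≤ wf t := fun t => intervalIntegral.integral_nonneg hxy.le fun p _ => by positivity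
  have hgd : ∀ t, HasDerivAt (fun t => - (κ * c / 2) * t + (δ * (∫ s in T..t, wf s) + Nf a b t / δ)
        + β * (2 * π * (δ * t + Nf a b t / δ)))
      (- (κ * c / 2) + (δ * wf t + Nf' a b t / δ) + β * (2 * π * (δ + Nf' a b t / δ))) t := by
    intro t
    have e1 := (hasDerivAt_id t).const_mul (-(κ * c / 2))
    have e2 := ((hWd t).const_mul δ).add ((N_deriv h t).div_const δ)
    have e3 := ((((hasDerivAt_id t).const_mul δ).add
      ((N_deriv h t).div_const δ)).const_mul (2 * π)).const_mul β
    refine ((e1.add e2).add e3).congr_deriv ?_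
    simp
  have key := sub_le_sub_of_deriv_le hM1d hgd h12 (fun t ht =>
    hM1b t (by linarith [ht.1, ht1.1]) (by linarith [ht.2, ht2.2]))
  have hWdiff : (∫ s in T..t2, wf s) - (∫ s in T..t1, wf s) ≤ C := by
    have hmonoW : Monotone (fun t => ∫ s in T..t, wf s) := monotone_of_deriv hWd hwf0
    have e1 : 0 ≤ ∫ s in T..t1, wf s := intervalIntegral.integral_nonneg ht1.1.le fun t _ => hwf0 t
    have e2 : (∫ s in T..t2, wf s) ≤ ∫ s in T..(T+3), wf s := hmonoW ht2.2.le
    linarith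
  have f1 := abs_le.1 (herr t1)
  have f2 := abs_le.1 (herr t2)
  have f3 := abs_le.1 (hmus ht1.1.le h12 ht2.2.le)
  have f4 := hosc ht1.1.le h12 ht2.2.le
  have f5 := hmu2 t2 (by linarith [ht1.1]) ht2.2.le
  have f6 := N_mono h h12
  have f7 := hβ t1
  have f8 := N_nonneg h t1
  have hπ := pi_pos
  have g1 : -(8 * π * δ * β) ≤ Nf a b t2 * mu a b x y w t2 - Nf a b t1 * mu a b x y w t1 := by
    have i1 : Nf a b t1 * mu a b x y w t2 ≤ Nf a b t2 * mu a b x y w t2 :=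
      mul_le_mul_of_nonneg_right f6 (by linarith)
    have i2 : -(8 * π * δ) * Nf a b t1 ≤ (mu a b x y w t2 - mu a b x y w t1) * Nf a b t1 :=
      mul_le_mul_of_nonneg_right f3.1 f8
    have i3 : (8 * π * δ) * Nf a b t1 ≤ (8 * π * δ) * β := by gcongr
    linarith
  have g2 : 2 * π * (δ + Nf' a b t1 / δ) ≤ 4 * π * δ := by
    have := mul_le_mul_of_nonneg_left hs1' (by positivity : 0 ≤ 2 * π)
    linarith
  have g3 : 2 * π * (δ + Nf' a b t2 / δ) ≤ 4 * π * δ := by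
    have := mul_le_mul_of_nonneg_left hs2' (by positivity : 0 ≤ 2 * π)
    linarith
  have g4 : δ * ((∫ s in T..t2, wf s) - (∫ s in T..t1, wf s)) ≤ δ * |C| := by
    gcongr; exact hWdiff.trans (le_abs_self _)
  have g5 : β * (2 * π * (δ * (t2 - t1) + (Nf a b t2 - Nf a b t1) / δ)) ≤ β * (2 * π * (4 * δ)) := by
    gcongr
    have : t2 - t1 ≤ 3 := by linarith [ht1.1, ht2.2]
    have := mul_le_mul_of_nonneg_left this hδ.le
    linarith
  have g6 : κ * c / 2 * 1 ≤ κ * c / 2 * (t2 - t1) := by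
    gcongr; linarith [ht1.2, ht2.1]
  have g7 : M1 t2 - M1 t1 = er a b x y w t2 - er a b x y w t1
    + (Nf a b t2 * mu a b x y w t2 - Nf a b t1 * mu a b x y w t1) := by simp only [hM1]; ring
  have g8 : A * δ = δ * |C| + δ + 20 * (π * β * δ) + 8 * (π * δ) := by rw [hA]; ring
  have g9 : 0 ≤ π * β * δ := by positivity
  have g10 : 0 < κ * c := by positivity
  have key' : M1 t2 - M1 t1 ≤ - (κ * c / 2 * (t2 - t1))
      + δ * ((∫ s in T..t2, wf s) - (∫ s in T..t1, wf s)) + (Nf a b t2 - Nf a b t1) / δ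
      + β * (2 * π * (δ * (t2 - t1) + (Nf a b t2 - Nf a b t1) / δ)) := by
    refine key.trans (le_of_eq ?_); ring
  linarith

end HM

namespace HM
open Real Set Filter Topology
variable {a b : Fn}

lemma amgm {δ : ℝ} (hδ : 0 < δ) (u v : ℝ) : |2 * (u * v)| ≤ δ * u ^ 2 + v ^ 2 / δ := by
  have e1 : δ * u ^ 2 + v ^ 2 / δ - 2 * (u * v) = (δ * u - v) ^ 2 / δ := by field_simp; ring
  have e2 : δ * u ^ 2 + v ^ 2 / δ + 2 * (u * v) = (δ * u + v) ^ 2 / δ := by field_simp; ring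
  have h1 : 0 ≤ (δ * u - v) ^ 2 / δ := by positivity
  have h2 : 0 ≤ (δ * u + v) ^ 2 / δ := by positivity
  rw [abs_le]; constructor <;> linarith

noncomputable section
/-- normalized weighted quadratic mass of the pair -/
def qm (a b : Fn) (x y : ℝ) (w : ℝ → ℝ) (t : ℝ) : ℝ :=
  (∫ p in x..y, ((a.f t p) ^ 2 + (b.f t p) ^ 2) * w p) / H a b t
def qm' (a b : Fn) (x y : ℝ) (w : ℝ → ℝ) (t : ℝ) : ℝ :=
  (∫ p in x..y, 2 * (a.f t p * (a.ft t p - Nf a b t * a.f t p)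
    + b.f t p * (b.ft t p - Nf a b t * b.f t p)) * w p) / H a b t
def ms' (a b : Fn) (x y : ℝ) (t : ℝ) : ℝ :=
  (∫ p in x..y, 2 * (a.f t p * (a.ft t p - Nf a b t * a.f t p))) / H a b t
end

lemma qm_deriv {w : ℝ → ℝ} (hw : Continuous w) (x y t : ℝ) :
    HasDerivAt (qm a b x y w) (qm' a b x y w t) t := by
  have h1 := hasDerivAt_param (F := fun t p => ((a.f t p) ^ 2 + (b.f t p) ^ 2) * w p)
    (F' := fun t p => (2 * a.f t p * a.ft t p + 2 * b.f t p * b.ft t p) * w p) x y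
    (by fun_prop) (by fun_prop) (fun t p =>
      ((((a.dt t p).pow 2).add ((b.dt t p).pow 2)).mul_const (w p)).congr_deriv (by simp)) t
  have hH := (H_pos (a := a) (b := b) t).ne'
  refine (h1.div (H_deriv (a := a) (b := b) t) hH).congr_deriv ?_
  have e : (∫ p in x..y, 2 * (a.f t p * (a.ft t p - Nf a b t * a.f t p)
    + b.f t p * (b.ft t p - Nf a b t * b.f t p)) * w p) =
    (∫ p in x..y, (2 * a.f t p * a.ft t p + 2 * b.f t p * b.ft t p) * w p)
    - 2 * Nf a b t * (∫ p in x..y, ((a.f t p) ^ 2 + (b.f t p) ^ 2) * w p) := by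
    rw [← ii_smul, ← ii_sub (by fun_prop) (by fun_prop)]
    congr 1; ext p; ring
  rw [qm', e, D_eq]
  field_simp

lemma ms_deriv (x y t : ℝ) :
    HasDerivAt (ms a b x y) (ms' a b x y t) t := by
  have h1 := hasDerivAt_param (F := fun t p => (a.f t p) ^ 2)
    (F' := fun t p => (2 * a.f t p * a.ft t p)) x y
    (by fun_prop) (by fun_prop) (fun t p =>
      (((a.dt t p).pow 2)).congr_deriv (by simp)) t
  have hH := (H_pos (a := a) (b := b) t).ne'
  refine (h1.div (H_deriv (a := a) (b := b) t) hH).congr_deriv ?_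
  have e : (∫ p in x..y, 2 * (a.f t p * (a.ft t p - Nf a b t * a.f t p))) =
    (∫ p in x..y, (2 * a.f t p * a.ft t p))
    - 2 * Nf a b t * (∫ p in x..y, (a.f t p) ^ 2) := by
    rw [← ii_smul, ← ii_sub (by fun_prop) (by fun_prop)]
    congr 1; ext p; ring
  rw [ms', e, D_eq]
  field_simp

/-- arcs integrals controlled by circle quantities -/
lemma arc_H {x y : ℝ} (hxy : x ≤ y) (hy : y - x ≤ 2 * π) (t : ℝ) :
    ∫ p in x..y, ((a.f t p) ^ 2 + (b.f t p) ^ 2) ≤ H a b t :=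
  arc_le (by fun_prop) (fun p => by rw [a.per, b.per]) (fun p => by positivity) hxy hy
lemma arc_Df (h : Sys a b) {x y : ℝ} (hxy : x ≤ y) (hy : y - x ≤ 2 * π) (t : ℝ) :
    ∫ p in x..y, ((a.ft t p - Nf a b t * a.f t p) ^ 2 + (b.ft t p - Nf a b t * b.f t p) ^ 2)
      ≤ Nf' a b t * H a b t := by
  refine (arc_le (by fun_prop) (fun p => by rw [a.per, b.per, a.pert, b.pert])
    (fun p => by positivity) hxy hy).trans ?_
  change Df a b t ≤ _
  have := G_nonneg (a := a) (b := b) t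
  linarith [Df_G_le h t]
lemma arc_G (h : Sys a b) {x y : ℝ} (hxy : x ≤ y) (hy : y - x ≤ 2 * π) (t : ℝ) :
    ∫ p in x..y, (exp (2 * t) * (a.f t p) ^ 2 * (b.f t p) ^ 2) ≤ Nf' a b t * H a b t := by
  refine (arc_le (by fun_prop) (fun p => by rw [a.per, b.per])
    (fun p => by positivity) hxy hy).trans ?_
  change G a b t ≤ _
  have := Df_nonneg (a := a) (b := b) t
  linarith [Df_G_le h t]
lemma arc_Th {x y : ℝ} (hxy : x ≤ y) (hy : y - x ≤ 2 * π) (t : ℝ) :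
    ∫ p in x..y, ((a.fp t p) ^ 2 + (b.fp t p) ^ 2) ≤ (Nf' a b t + Nf a b t ^ 2) * H a b t :=
  (arc_le (by fun_prop) (fun p => by rw [a.perp, b.perp]) (fun p => by positivity) hxy hy).trans
    (Th_le t)

lemma abs_int_le {x y : ℝ} (hxy : x ≤ y) {f g : ℝ → ℝ} (hf : Continuous f) (hg : Continuous g)
    (h : ∀ p ∈ Icc x y, |f p| ≤ g p) : |∫ p in x..y, f p| ≤ ∫ p in x..y, g p :=
  (intervalIntegral.abs_integral_le_integral_abs hxy).trans (ii_mono hxy (by fun_prop) hg h)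

lemma qm'_le (h : Sys a b) {w : ℝ → ℝ} (hw : Continuous w) {B : ℝ} {x y : ℝ}
    (hw1 : ∀ p ∈ Icc x y, |w p| ≤ B)
    (hxy : x ≤ y) (hy : y - x ≤ 2 * π) {δ : ℝ} (hδ : 0 < δ) (t : ℝ) :
    |qm' a b x y w t| ≤ B * (δ + Nf' a b t / δ) := by
  have hH := H_pos (a := a) (b := b) t
  have hB : 0 ≤ B := (abs_nonneg _).trans (hw1 x ⟨le_rfl, hxy⟩)
  rw [qm', abs_div, abs_of_pos hH, div_le_iff₀ hH]
  have h1 : |∫ p in x..y, 2 * (a.f t p * (a.ft t p - Nf a b t * a.f t p)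
    + b.f t p * (b.ft t p - Nf a b t * b.f t p)) * w p| ≤
    ∫ p in x..y, (B * δ * ((a.f t p) ^ 2 + (b.f t p) ^ 2) + B / δ * ((a.ft t p - Nf a b t * a.f t p) ^ 2 +
      (b.ft t p - Nf a b t * b.f t p) ^ 2)) := by
    apply abs_int_le hxy (by fun_prop) (by fun_prop)
    intro p hp
    have e1 := amgm hδ (a.f t p) (a.ft t p - Nf a b t * a.f t p)
    have e2 := amgm hδ (b.f t p) (b.ft t p - Nf a b t * b.f t p)
    rw [abs_mul, mul_comm]
    have e3 : |2 * (a.f t p * (a.ft t p - Nf a b t * a.f t p)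
      + b.f t p * (b.ft t p - Nf a b t * b.f t p))| ≤
        (δ * (a.f t p) ^ 2 + (a.ft t p - Nf a b t * a.f t p) ^ 2 / δ) +
        (δ * (b.f t p) ^ 2 + (b.ft t p - Nf a b t * b.f t p) ^ 2 / δ) := by
      rw [mul_add]; exact (abs_add_le _ _).trans (add_le_add e1 e2)
    refine (mul_le_mul (hw1 p hp) e3 (abs_nonneg _) hB).trans (le_of_eq ?_)
    ring
  rw [ii_add (by fun_prop) (by fun_prop), ii_smul (B * δ), ii_smul (B / δ)] at h1
  have h2 := mul_le_mul_of_nonneg_left (arc_H (a := a) (b := b) hxy hy t) (by positivity : 0 ≤ B * δ)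
  have h3 := mul_le_mul_of_nonneg_left (arc_Df h hxy hy t) (by positivity : 0 ≤ B / δ)
  refine h1.trans ((add_le_add h2 h3).trans (le_of_eq ?_))
  ring

lemma ms'_le (h : Sys a b) {x y : ℝ}
    (hxy : x ≤ y) (hy : y - x ≤ 2 * π) {δ : ℝ} (hδ : 0 < δ) (t : ℝ) :
    |ms' a b x y t| ≤ 1 * (δ + Nf' a b t / δ) := by
  have hH := H_pos (a := a) (b := b) t
  rw [ms', abs_div, abs_of_pos hH, div_le_iff₀ hH]
  have h1 : |∫ p in x..y, 2 * (a.f t p * (a.ft t p - Nf a b t * a.f t p))| ≤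
    ∫ p in x..y, (δ * ((a.f t p) ^ 2 + (b.f t p) ^ 2) + 1 / δ * ((a.ft t p - Nf a b t * a.f t p) ^ 2 +
      (b.ft t p - Nf a b t * b.f t p) ^ 2)) := by
    apply abs_int_le hxy (by fun_prop) (by fun_prop)
    intro p hp
    refine (amgm hδ (a.f t p) (a.ft t p - Nf a b t * a.f t p)).trans ?_
    rw [mul_add, mul_add, div_mul_eq_mul_div, one_mul]
    have : 0 ≤ δ * (b.f t p) ^ 2 := by positivity
    have : 0 ≤ 1 / δ * (b.ft t p - Nf a b t * b.f t p) ^ 2 := by positivity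
    linarith
  rw [ii_add (by fun_prop) (by fun_prop), ii_smul (δ), ii_smul (1 / δ)] at h1
  have h2 := mul_le_mul_of_nonneg_left (arc_H (a := a) (b := b) hxy hy t) hδ.le
  have h3 := mul_le_mul_of_nonneg_left (arc_Df h hxy hy t) (by positivity : 0 ≤ 1 / δ)
  refine h1.trans ((add_le_add h2 h3).trans (le_of_eq ?_))
  ring

lemma qm_slow (h : Sys a b) {w : ℝ → ℝ} (hw : Continuous w) {B : ℝ} {x y : ℝ}
    (hw1 : ∀ p ∈ Icc x y, |w p| ≤ B)
    (hxy : x ≤ y) (hy : y - x ≤ 2 * π) {δ : ℝ} (hδ : 0 < δ) {s t : ℝ} (hst : s ≤ t) :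
    |qm a b x y w t - qm a b x y w s| ≤ B * (δ * (t - s) + (Nf a b t - Nf a b s) / δ) :=
  slow (N_deriv h) (qm_deriv hw x y) (qm'_le h hw hw1 hxy hy hδ) hst

lemma ms_slow (h : Sys a b) {x y : ℝ}
    (hxy : x ≤ y) (hy : y - x ≤ 2 * π) {δ : ℝ} (hδ : 0 < δ) {s t : ℝ} (hst : s ≤ t) :
    |ms a b x y t - ms a b x y s| ≤ 1 * (δ * (t - s) + (Nf a b t - Nf a b s) / δ) :=
  slow (N_deriv h) (ms_deriv x y) (ms'_le h hxy hy hδ) hst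

lemma qm_le {w : ℝ → ℝ} (hw : Continuous w) {B : ℝ} {x y : ℝ}
    (hw1 : ∀ p ∈ Icc x y, |w p| ≤ B)
    (hxy : x ≤ y) (hy : y - x ≤ 2 * π) (t : ℝ) : |qm a b x y w t| ≤ B := by
  have hH := H_pos (a := a) (b := b) t
  have hB : 0 ≤ B := (abs_nonneg _).trans (hw1 x ⟨le_rfl, hxy⟩)
  rw [qm, abs_div, abs_of_pos hH, div_le_iff₀ hH]
  have h1 : |∫ p in x..y, ((a.f t p) ^ 2 + (b.f t p) ^ 2) * w p| ≤
    ∫ p in x..y, B * ((a.f t p) ^ 2 + (b.f t p) ^ 2) := by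
    apply abs_int_le hxy (by fun_prop) (by fun_prop)
    intro p hp
    have : 0 ≤ ((a.f t p) ^ 2 + (b.f t p) ^ 2) := by positivity
    rw [abs_mul, mul_comm, abs_of_nonneg this]
    exact mul_le_mul_of_nonneg_right (hw1 p hp) this
  rw [ii_smul] at h1
  exact h1.trans (mul_le_mul_of_nonneg_left (arc_H hxy hy t) hB)

/-- test function package for the no-gap lemma -/
structure Tst (l : ℝ) where
  s : ℝ → ℝ
  s1 : ℝ → ℝ
  s2 : ℝ → ℝ
  s3 : ℝ → ℝ
  d0 : ∀ p, HasDerivAt s (s1 p) p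
  d1 : ∀ p, HasDerivAt s1 (s2 p) p
  d2 : ∀ p, HasDerivAt s2 (s3 p) p
  c0 : Continuous s
  c1 : Continuous s1
  c2 : Continuous s2
  c3 : Continuous s3
  s_l : s l = 0
  s_u : s (l + 2 * π) = 0
  s1_e : s1 (l + 2 * π) = s1 l
  s2_l : s2 l = 0
  s2_u : s2 (l + 2 * π) = 0

noncomputable section
def X0 (a b : Fn) {l : ℝ} (τ : Tst l) (t : ℝ) : ℝ := ∫ p in l..(l + 2 * π),
  ((a.ft t p * a.fp t p + b.ft t p * b.fp t p) * τ.s p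
    - 1 / 2 * (a.f t p * a.ft t p + b.f t p * b.ft t p) * τ.s1 p)
def e0 (a b : Fn) {l : ℝ} (τ : Tst l) (t : ℝ) : ℝ := ∫ p in l..(l + 2 * π),
  (((a.ft t p - Nf a b t * a.f t p) * a.fp t p + (b.ft t p - Nf a b t * b.f t p) * b.fp t p) * τ.s p
    - 1 / 2 * (a.f t p * (a.ft t p - Nf a b t * a.f t p)
      + b.f t p * (b.ft t p - Nf a b t * b.f t p)) * τ.s1 p)
def e1 (a b : Fn) {l : ℝ} (τ : Tst l) (t : ℝ) : ℝ := ∫ p in l..(l + 2 * π),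
  (- (2 * Nf a b t * (a.f t p * (a.ft t p - Nf a b t * a.f t p)
      + b.f t p * (b.ft t p - Nf a b t * b.f t p)) + (a.ft t p - Nf a b t * a.f t p) ^ 2
      + (b.ft t p - Nf a b t * b.f t p) ^ 2) * τ.s1 p
    - 3 / 2 * (exp (2 * t) * (a.f t p) ^ 2 * (b.f t p) ^ 2) * τ.s1 p)
end

lemma X0_eq {l : ℝ} (τ : Tst l) (t : ℝ) : X0 a b τ t / H a b t =
    - Nf a b t * qm a b l (l + 2 * π) τ.s1 t + e0 a b τ t / H a b t := by
  have hc0 := τ.c0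
  have hc1 := τ.c1
  have h0 := intervalIntegral.integral_eq_sub_of_hasDerivAt (a := l) (b := l + 2 * π)
      (f := fun p => ((a.f t p) ^ 2 + (b.f t p) ^ 2) * τ.s p)
      (f' := fun p => (2 * a.f t p * a.fp t p + 2 * b.f t p * b.fp t p) * τ.s p
        + ((a.f t p) ^ 2 + (b.f t p) ^ 2) * τ.s1 p)
      (fun p _ => ((((a.dp t p).pow 2).add ((b.dp t p).pow 2)).mul (τ.d0 p)).congr_deriv
        (by simp))
      (Continuous.intervalIntegrable (by fun_prop) _ _)
  rw [τ.s_l, τ.s_u, mul_zero, mul_zero, sub_zero] at h0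
  have h1 : X0 a b τ t - e0 a b τ t + Nf a b t *
      (∫ p in l..(l + 2 * π), ((a.f t p) ^ 2 + (b.f t p) ^ 2) * τ.s1 p)
      = Nf a b t / 2 * 0 := by
    rw [← h0, X0, e0, ← ii_smul, ← ii_smul, ← ii_sub (by fun_prop) (by fun_prop),
      ← ii_add (by fun_prop) (by fun_prop)]
    congr 1; ext p; ring
  rw [qm]
  have hH := (H_pos (a := a) (b := b) t).ne'
  field_simp
  linear_combination h1

lemma X0_deriv (h : Sys a b) {l : ℝ} (τ : Tst l) (t : ℝ) : HasDerivAt (X0 a b τ)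
    ((1 / 4 * qm a b l (l + 2 * π) τ.s3 t - Nf a b t ^ 2 * qm a b l (l + 2 * π) τ.s1 t) * H a b t
      + e1 a b τ t) t := by
  have hc0 := τ.c0
  have hc1 := τ.c1
  have hc2 := τ.c2
  have hc3 := τ.c3
  have h1 := hasDerivAt_param (F := fun t p => (a.ft t p * a.fp t p + b.ft t p * b.fp t p) * τ.s p
    - 1 / 2 * (a.f t p * a.ft t p + b.f t p * b.ft t p) * τ.s1 p)
    (F' := fun t p => (a.ftt t p * a.fp t p + a.ft t p * a.ftp t p +
      (b.ftt t p * b.fp t p + b.ft t p * b.ftp t p)) * τ.s p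
      - 1 / 2 * (a.ft t p * a.ft t p + a.f t p * a.ftt t p
        + (b.ft t p * b.ft t p + b.f t p * b.ftt t p)) * τ.s1 p) l (l + 2 * π)
    (by fun_prop) (by fun_prop) (fun t p =>
      ((((a.dtt t p).mul (a.dpt t p)).add ((b.dtt t p).mul (b.dpt t p))).mul_const _).sub
        (((((a.dt t p).mul (a.dtt t p)).add ((b.dt t p).mul (b.dtt t p))).const_mul _).mul_const _)) t
  refine h1.congr_deriv ?_
  have hH := (H_pos (a := a) (b := b) t).ne'
  have h0 := intervalIntegral.integral_eq_sub_of_hasDerivAt (a := l) (b := l + 2 * π)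
      (f := fun p => 1 / 2 * ((a.fp t p) ^ 2 + (b.fp t p) ^ 2 - (a.ft t p) ^ 2 - (b.ft t p) ^ 2
          - exp (2 * t) * ((a.f t p) ^ 2 * (b.f t p) ^ 2)) * τ.s p
          - 1 / 2 * (a.f t p * a.fp t p + b.f t p * b.fp t p) * τ.s1 p
          + 1 / 4 * ((a.f t p) ^ 2 + (b.f t p) ^ 2) * τ.s2 p)
      (f' := fun p => (1 / 2 * (2 * a.fp t p * a.fpp t p + 2 * b.fp t p * b.fpp t p
          - 2 * a.ft t p * a.ftp t p - 2 * b.ft t p * b.ftp t p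
          - exp (2 * t) * (2 * a.f t p * a.fp t p * (b.f t p) ^ 2
            + (a.f t p) ^ 2 * (2 * b.f t p * b.fp t p))) * τ.s p
          + 1 / 2 * ((a.fp t p) ^ 2 + (b.fp t p) ^ 2 - (a.ft t p) ^ 2 - (b.ft t p) ^ 2
          - exp (2 * t) * ((a.f t p) ^ 2 * (b.f t p) ^ 2)) * τ.s1 p)
          - (1 / 2 * (a.fp t p * a.fp t p + a.f t p * a.fpp t p
              + (b.fp t p * b.fp t p + b.f t p * b.fpp t p)) * τ.s1 p
            + 1 / 2 * (a.f t p * a.fp t p + b.f t p * b.fp t p) * τ.s2 p)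
          + (1 / 4 * (2 * a.f t p * a.fp t p + 2 * b.f t p * b.fp t p) * τ.s2 p
            + 1 / 4 * ((a.f t p) ^ 2 + (b.f t p) ^ 2) * τ.s3 p))
      (fun p _ => by
        have k1 := ((((((a.dpp t p).pow 2).add ((b.dpp t p).pow 2)).sub ((a.dtp t p).pow 2)).sub
          ((b.dtp t p).pow 2)).sub ((((a.dp t p).pow 2).mul ((b.dp t p).pow 2)).const_mul
            (exp (2 * t)))).const_mul (1 / 2)
        have k2 := (((a.dp t p).mul (a.dpp t p)).add ((b.dp t p).mul (b.dpp t p))).const_mul (1 / 2)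
        have k3 := (((a.dp t p).pow 2).add ((b.dp t p).pow 2)).const_mul (1 / 4)
        exact (((k1.mul (τ.d0 p)).sub (k2.mul (τ.d1 p))).add (k3.mul (τ.d2 p))).congr_deriv
          (by simp))
      (Continuous.intervalIntegrable (by fun_prop) _ _)
  rw [τ.s_l, τ.s_u, τ.s2_l, τ.s2_u, τ.s1_e, a.per, b.per, a.perp, b.perp] at h0
  simp only [mul_zero, sub_self] at h0
  have e2 : (1 / 4 * qm a b l (l + 2 * π) τ.s3 t - Nf a b t ^ 2 * qm a b l (l + 2 * π) τ.s1 t)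
      * H a b t = 1 / 4 * (∫ p in l..(l + 2 * π), ((a.f t p) ^ 2 + (b.f t p) ^ 2) * τ.s3 p)
        - Nf a b t ^ 2 * (∫ p in l..(l + 2 * π), ((a.f t p) ^ 2 + (b.f t p) ^ 2) * τ.s1 p) := by
    rw [qm, qm]; field_simp
  rw [e2, e1, ← ii_smul, ← ii_smul, ← ii_sub (by fun_prop) (by fun_prop),
    ← ii_add (by fun_prop) (by fun_prop)]
  refine (add_zero _).symm.trans ?_
  rw [← h0, ← ii_add (by fun_prop) (by fun_prop)]
  congr 1; ext p
  linear_combination (a.fp t p * τ.s p - 1/2 * a.f t p * τ.s1 p) * h.eqa t p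
    + (b.fp t p * τ.s p - 1/2 * b.f t p * τ.s1 p) * h.eqb t p

end HM

namespace HM
open Real Set Filter Topology
variable {a b : Fn}

lemma e0_le (h : Sys a b) {l : ℝ} (τ : Tst l) {B β : ℝ} (hβ : ∀ t, Nf a b t ≤ β)
    (hB0 : ∀ p ∈ Icc l (l + 2 * π), |τ.s p| ≤ B) (hB1 : ∀ p ∈ Icc l (l + 2 * π), |τ.s1 p| ≤ B)
    {δ : ℝ} (hδ : 0 < δ) (hδ1 : δ ≤ 1) (t : ℝ) :
    |e0 a b τ t / H a b t| ≤ B * (3 + β ^ 2) * (δ + Nf' a b t / δ) := by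
  have hc0 := τ.c0
  have hc1 := τ.c1
  have hpi := pi_pos
  have hH := H_pos (a := a) (b := b) t
  have hl : l ≤ l + 2 * π := by linarith
  have hl2 : l + 2 * π - l ≤ 2 * π := by linarith
  have hB : 0 ≤ B := (abs_nonneg _).trans (hB0 l ⟨le_rfl, hl⟩)
  rw [abs_div, abs_of_pos hH, div_le_iff₀ hH]
  have h1 : |e0 a b τ t| ≤ ∫ p in l..(l + 2 * π), (B * δ * ((a.fp t p) ^ 2 + (b.fp t p) ^ 2)
      + 2 * B / δ * ((a.ft t p - Nf a b t * a.f t p) ^ 2 + (b.ft t p - Nf a b t * b.f t p) ^ 2)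
      + B * δ * ((a.f t p) ^ 2 + (b.f t p) ^ 2)) := by
    apply abs_int_le hl (by fun_prop) (by fun_prop)
    intro p hp
    set da := a.ft t p - Nf a b t * a.f t p
    set db := b.ft t p - Nf a b t * b.f t p
    have k1 := amgm hδ (a.fp t p) da
    have k2 := amgm hδ (b.fp t p) db
    have k3 := amgm hδ (a.f t p) da
    have k4 := amgm hδ (b.f t p) db
    have m1 : |(2 * (a.fp t p * da) + 2 * (b.fp t p * db)) * τ.s p| ≤
       ((δ * (a.fp t p) ^ 2 + da ^ 2 / δ) + (δ * (b.fp t p) ^ 2 + db ^ 2 / δ)) * B := by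
      rw [abs_mul]
      exact mul_le_mul ((abs_add_le _ _).trans (add_le_add k1 k2)) (hB0 p hp) (abs_nonneg _)
        (by positivity)
    have m2 : |(2 * (a.f t p * da) + 2 * (b.f t p * db)) * τ.s1 p| ≤
       ((δ * (a.f t p) ^ 2 + da ^ 2 / δ) + (δ * (b.f t p) ^ 2 + db ^ 2 / δ)) * B := by
      rw [abs_mul]
      exact mul_le_mul ((abs_add_le _ _).trans (add_le_add k3 k4)) (hB1 p hp) (abs_nonneg _)
        (by positivity)
    have e : (da * a.fp t p + db * b.fp t p) * τ.s p - 1 / 2 * (a.f t p * da + b.f t p * db) * τ.s1 p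
      = 1 / 2 * ((2 * (a.fp t p * da) + 2 * (b.fp t p * db)) * τ.s p)
        - 1 / 4 * ((2 * (a.f t p * da) + 2 * (b.f t p * db)) * τ.s1 p) := by ring
    rw [e]
    refine (abs_sub _ _).trans ?_
    rw [abs_mul (1 / 2), abs_mul (1 / 4), abs_of_pos (by norm_num : (0 : ℝ) < 1 / 2),
      abs_of_pos (by norm_num : (0 : ℝ) < 1 / 4)]
    have q1 : 0 ≤ B * δ * ((a.fp t p) ^ 2 + (b.fp t p) ^ 2) := by positivity
    have q2 : 0 ≤ B * (da ^ 2 / δ + db ^ 2 / δ) := by positivity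
    have q3 : 0 ≤ B * δ * ((a.f t p) ^ 2 + (b.f t p) ^ 2) := by positivity
    have q4 : 2 * B / δ * (da ^ 2 + db ^ 2) = 2 * (B * (da ^ 2 / δ + db ^ 2 / δ)) := by ring
    rw [q4]
    linarith
  rw [ii_add (by fun_prop) (by fun_prop), ii_add (by fun_prop) (by fun_prop), ii_smul, ii_smul,
    ii_smul] at h1
  refine h1.trans ?_
  have a1 := mul_le_mul_of_nonneg_left (arc_Th (a := a) (b := b) hl hl2 t) (by positivity : 0 ≤ B * δ)
  have a2 := mul_le_mul_of_nonneg_left (arc_Df h hl hl2 t) (by positivity : 0 ≤ 2 * B / δ)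
  have a3 := mul_le_mul_of_nonneg_left (arc_H (a := a) (b := b) hl hl2 t) (by positivity : 0 ≤ B * δ)
  refine (add_le_add (add_le_add a1 a2) a3).trans ?_
  have hN' := N'_nonneg h t
  have c1 : δ * Nf' a b t ≤ Nf' a b t / δ := by
    rw [le_div_iff₀ hδ]
    calc δ * Nf' a b t * δ = (δ * δ) * Nf' a b t := by ring
      _ ≤ 1 * Nf' a b t := by gcongr; exact mul_le_one₀ hδ1 hδ.le hδ1
      _ = _ := one_mul _
  have c2 : Nf a b t ^ 2 ≤ β ^ 2 := pow_le_pow_left₀ (N_nonneg h t) (hβ t) 2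
  have c3 : δ * Nf a b t ^ 2 ≤ δ * β ^ 2 := by gcongr
  have c4 : 0 ≤ β ^ 2 * (Nf' a b t / δ) := by positivity
  have c5 : δ * (Nf' a b t + Nf a b t ^ 2) + 2 * (Nf' a b t / δ) + δ
      ≤ (3 + β ^ 2) * (δ + Nf' a b t / δ) := by
    linarith
  have c6 := mul_le_mul_of_nonneg_left c5 (mul_nonneg hB hH.le)
  calc _ = B * H a b t * (δ * (Nf' a b t + Nf a b t ^ 2) + 2 * (Nf' a b t / δ) + δ) := by ring
    _ ≤ _ := c6
    _ = _ := by ring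

lemma e1_le (h : Sys a b) {l : ℝ} (τ : Tst l) {B β : ℝ} (hβ : ∀ t, Nf a b t ≤ β)
    (hB1 : ∀ p ∈ Icc l (l + 2 * π), |τ.s1 p| ≤ B)
    {δ : ℝ} (hδ : 0 < δ) (hδ1 : δ ≤ 1) (t : ℝ) :
    |e1 a b τ t / H a b t| ≤ B * (3 + β) * (δ + Nf' a b t / δ) := by
  have hc1 := τ.c1
  have hpi := pi_pos
  have hH := H_pos (a := a) (b := b) t
  have hl : l ≤ l + 2 * π := by linarith
  have hl2 : l + 2 * π - l ≤ 2 * π := by linarith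
  have hB : 0 ≤ B := (abs_nonneg _).trans (hB1 l ⟨le_rfl, hl⟩)
  have hN0 := N_nonneg h t
  have hβ0 : 0 ≤ β := hN0.trans (hβ t)
  rw [abs_div, abs_of_pos hH, div_le_iff₀ hH]
  have h1 : |e1 a b τ t| ≤ ∫ p in l..(l + 2 * π), (B * β * δ * ((a.f t p) ^ 2 + (b.f t p) ^ 2)
      + (B * β / δ + B) * ((a.ft t p - Nf a b t * a.f t p) ^ 2
        + (b.ft t p - Nf a b t * b.f t p) ^ 2)
      + 2 * B * (exp (2 * t) * (a.f t p) ^ 2 * (b.f t p) ^ 2)) := by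
    apply abs_int_le hl (by fun_prop) (by fun_prop)
    intro p hp
    set da := a.ft t p - Nf a b t * a.f t p
    set db := b.ft t p - Nf a b t * b.f t p
    have k3 := amgm hδ (a.f t p) da
    have k4 := amgm hδ (b.f t p) db
    set g := exp (2 * t) * (a.f t p) ^ 2 * (b.f t p) ^ 2 with hg
    have hg0 : 0 ≤ g := by positivity
    have e : -(2 * Nf a b t * (a.f t p * da + b.f t p * db) + da ^ 2 + db ^ 2) * τ.s1 p
      - 3 / 2 * g * τ.s1 p = -((Nf a b t * (2 * (a.f t p * da) + 2 * (b.f t p * db))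
        + (da ^ 2 + db ^ 2 + 3 / 2 * g)) * τ.s1 p) := by ring
    have m1 : |Nf a b t * (2 * (a.f t p * da) + 2 * (b.f t p * db))| ≤
        β * ((δ * (a.f t p) ^ 2 + da ^ 2 / δ) + (δ * (b.f t p) ^ 2 + db ^ 2 / δ)) := by
      rw [abs_mul, abs_of_nonneg hN0]
      exact mul_le_mul (hβ t) ((abs_add_le _ _).trans (add_le_add k3 k4)) (abs_nonneg _) hβ0
    have m2 : |da ^ 2 + db ^ 2 + 3 / 2 * g| = da ^ 2 + db ^ 2 + 3 / 2 * g :=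
      abs_of_nonneg (by positivity)
    rw [e, abs_neg, abs_mul]
    refine (mul_le_mul ((abs_add_le _ _).trans (add_le_add m1 m2.le)) (hB1 p hp) (abs_nonneg _)
        (by positivity)).trans ?_
    have : 0 ≤ B * g := by positivity
    have q : (B * β / δ + B) * (da ^ 2 + db ^ 2) = B * β * (da ^ 2 / δ + db ^ 2 / δ)
      + B * (da ^ 2 + db ^ 2) := by ring
    rw [q]
    linarith
  rw [ii_add (by fun_prop) (by fun_prop), ii_add (by fun_prop) (by fun_prop), ii_smul, ii_smul,
    ii_smul] at h1
  refine h1.trans ?_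
  have a2 := mul_le_mul_of_nonneg_left (arc_Df h hl hl2 t) (by positivity : 0 ≤ B * β / δ + B)
  have a3 := mul_le_mul_of_nonneg_left (arc_H (a := a) (b := b) hl hl2 t)
    (by positivity : 0 ≤ B * β * δ)
  have a4 := mul_le_mul_of_nonneg_left (arc_G h hl hl2 t) (by positivity : 0 ≤ 2 * B)
  refine (add_le_add (add_le_add a3 a2) a4).trans ?_
  have hN' := N'_nonneg h t
  have c1 : Nf' a b t ≤ Nf' a b t / δ := by
    rw [le_div_iff₀ hδ]; exact mul_le_of_le_one_right hN' hδ1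
  have c5 : β * δ + β * (Nf' a b t / δ) + 3 * Nf' a b t ≤ (3 + β) * (δ + Nf' a b t / δ) := by
    linarith
  have c6 := mul_le_mul_of_nonneg_left c5 (mul_nonneg hB hH.le)
  calc _ = B * H a b t * (β * δ + β * (Nf' a b t / δ) + 3 * Nf' a b t) := by ring
    _ ≤ _ := c6
    _ = _ := by ring

lemma X_deriv (h : Sys a b) {l : ℝ} (τ : Tst l) (t : ℝ) :
    HasDerivAt (fun t => X0 a b τ t / H a b t)
      (1 / 4 * qm a b l (l + 2 * π) τ.s3 t + Nf a b t ^ 2 * qm a b l (l + 2 * π) τ.s1 t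
        + e1 a b τ t / H a b t - 2 * Nf a b t * (e0 a b τ t / H a b t)) t := by
  have hH := (H_pos (a := a) (b := b) t).ne'
  refine ((X0_deriv h τ t).div (H_deriv (a := a) (b := b) t) hH).congr_deriv ?_
  have e := X0_eq (a := a) (b := b) τ t
  have e' : X0 a b τ t = (- Nf a b t * qm a b l (l + 2 * π) τ.s1 t) * H a b t + e0 a b τ t := by
    field_simp at e
    linear_combination e
  rw [D_eq, e']
  field_simp
  ring

set_option maxHeartbeats 1000000 in
lemma gap_core (h : Sys a b) {d : ℝ} (hd : Tendsto (Nf a b) atTop (𝓝 d)) {l : ℝ} (τ : Tst l)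
    {ε : ℝ} (hε : 0 < ε) : ∀ᶠ T in atTop, 1 / 4 * qm a b l (l + 2 * π) τ.s3 T
      + Nf a b T ^ 2 * qm a b l (l + 2 * π) τ.s1 T ≤ ε := by
  have hpi := pi_pos
  have hl : l ≤ l + 2 * π := by linarith
  have hl2 : l + 2 * π - l ≤ 2 * π := by linarith
  obtain ⟨β, hβ⟩ := N_bdd h
  have hβ0 : 0 ≤ β := (N_nonneg h 0).trans (hβ 0)
  obtain ⟨B0, hB0⟩ := isCompact_Icc.exists_bound_of_continuousOn (s := Icc l (l + 2 * π))
    τ.c0.continuousOn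
  obtain ⟨B1, hB1⟩ := isCompact_Icc.exists_bound_of_continuousOn (s := Icc l (l + 2 * π))
    τ.c1.continuousOn
  obtain ⟨B3, hB3⟩ := isCompact_Icc.exists_bound_of_continuousOn (s := Icc l (l + 2 * π))
    τ.c3.continuousOn
  set B := max B0 (max B1 B3) with hBdef
  have b0 : ∀ p ∈ Icc l (l + 2 * π), |τ.s p| ≤ B := fun p hp => (hB0 p hp).trans (le_max_left _ _)
  have b1 : ∀ p ∈ Icc l (l + 2 * π), |τ.s1 p| ≤ B := fun p hp =>
    (hB1 p hp).trans ((le_max_left _ _).trans (le_max_right _ _))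
  have b3 : ∀ p ∈ Icc l (l + 2 * π), |τ.s3 p| ≤ B := fun p hp =>
    (hB3 p hp).trans ((le_max_right _ _).trans (le_max_right _ _))
  have hB : 0 ≤ B := (abs_nonneg _).trans (b0 l ⟨le_rfl, hl⟩)
  set E0 := B * (3 + β ^ 2) with hE0
  set E1 := B * (3 + β) with hE1
  have hE00 : 0 ≤ E0 := by positivity
  have hE10 : 0 ≤ E1 := by positivity
  set K := E1 + 2 * β * E0 with hK
  have hK0 : 0 ≤ K := by positivity
  set K2 := B + 4 * β ^ 2 * B + 2 * β * B with hK2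
  have hK20 : 0 ≤ K2 := by positivity
  set K3 := 4 * β * B + B + 4 * E0 with hK3
  have hK30 : 0 ≤ K3 := by positivity
  set K4 := 3 * K2 + 4 * K + K3 + 1 with hK4
  have hK40 : 0 < K4 := by positivity
  set δ := min 1 (ε / K4) with hδdef
  have hδ : 0 < δ := by rw [hδdef]; positivity
  have hδ1 : δ ≤ 1 := min_le_left _ _
  have hδ2 : K4 * δ ≤ ε := by
    have : δ ≤ ε / K4 := min_le_right _ _
    rw [le_div_iff₀ hK40] at this
    linarith
  filter_upwards [osc_small hd 3 0 (pow_pos hδ 2)] with T hT2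
  rw [sub_zero] at hT2
  by_contra! hcon
  have hosc0 : ∀ {s t}, T ≤ s → s ≤ t → t ≤ T + 3 → (Nf a b t - Nf a b s) ≤ δ := by
    intro s t h1 h2 h3
    have := N_mono h h1
    have := N_mono h h3
    have : δ ^ 2 ≤ δ := by rw [pow_two]; exact mul_le_of_le_one_right hδ.le hδ1
    linarith
  have hosc : ∀ {s t}, T ≤ s → s ≤ t → t ≤ T + 3 → (Nf a b t - Nf a b s) / δ ≤ δ := by
    intro s t h1 h2 h3
    rw [div_le_iff₀ hδ, ← pow_two]
    have := N_mono h h1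
    have := N_mono h h3
    linarith
  have hys : ∀ {w : ℝ → ℝ}, Continuous w → (∀ p ∈ Icc l (l + 2 * π), |w p| ≤ B) →
      ∀ {s t}, T ≤ s → s ≤ t → t ≤ T + 3 →
      |qm a b l (l + 2 * π) w t - qm a b l (l + 2 * π) w s| ≤ 4 * B * δ := by
    intro w hw hwB s t h1 h2 h3
    refine (qm_slow h hw hwB hl hl2 hδ h2).trans ?_
    have h5 := hosc h1 h2 h3
    have : δ * (t - s) ≤ δ * 3 := by gcongr; linarith
    have := mul_le_mul_of_nonneg_left (add_le_add this h5) hB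
    linarith
  set y := qm a b l (l + 2 * π) τ.s1 with hy
  set z := qm a b l (l + 2 * π) τ.s3 with hz
  have hyb : ∀ t, |y t| ≤ B := qm_le τ.c1 b1 hl hl2
  set v0 := 1 / 4 * z T + Nf a b T ^ 2 * y T with hv0
  -- derivative lower bound
  have hder : ∀ t ∈ Icc T (T + 3), v0 - K2 * δ - K * (δ + Nf' a b t / δ) ≤
      1 / 4 * z t + Nf a b t ^ 2 * y t
        + e1 a b τ t / H a b t - 2 * Nf a b t * (e0 a b τ t / H a b t) := by
    intro t ht
    have p1 := abs_le.1 (hys τ.c3 b3 le_rfl ht.1 ht.2)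
    have p2 := abs_le.1 (hys τ.c1 b1 le_rfl ht.1 ht.2)
    have p3 := abs_le.1 (e1_le h τ hβ b1 hδ hδ1 t)
    have p4 := e0_le h τ hβ b0 b1 hδ hδ1 t
    have hN0 := N_nonneg h t
    have p5 : 2 * Nf a b t * (e0 a b τ t / H a b t) ≤ 2 * β * (E0 * (δ + Nf' a b t / δ)) := by
      refine (mul_le_mul_of_nonneg_left (le_abs_self _) (by positivity)).trans ?_
      exact mul_le_mul (by linarith [hβ t]) p4 (abs_nonneg _) (by positivity)
    have p6 : Nf a b T ^ 2 * y T - Nf a b t ^ 2 * y t ≤ 4 * β ^ 2 * B * δ + 2 * β * B * δ := by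
      have q1 : Nf a b T ^ 2 * y T - Nf a b t ^ 2 * y t = Nf a b t ^ 2 * (y T - y t)
        - (Nf a b t - Nf a b T) * (Nf a b t + Nf a b T) * y T := by ring
      have q2 : Nf a b t ^ 2 * (y T - y t) ≤ β ^ 2 * (4 * B * δ) := by
        refine (mul_le_mul_of_nonneg_left (by linarith [p2.1] : y T - y t ≤ 4 * B * δ)
          (by positivity)).trans ?_
        gcongr; exact hβ t
      have q3 : - ((Nf a b t - Nf a b T) * (Nf a b t + Nf a b T) * y T) ≤ δ * (2 * β) * B := by
        refine (neg_le_abs _).trans ?_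
        rw [abs_mul]
        have r1 := N_mono h ht.1
        have r2 := N_nonneg h T
        refine mul_le_mul ?_ (hyb T) (abs_nonneg _) (by positivity)
        rw [abs_of_nonneg (mul_nonneg (by linarith) (by linarith))]
        exact mul_le_mul (hosc0 le_rfl ht.1 ht.2) (by linarith [hβ t, hβ T]) (by linarith) hδ.le
      rw [q1]; linarith
    have p7 : K * (δ + Nf' a b t / δ) = E1 * (δ + Nf' a b t / δ)
      + 2 * β * (E0 * (δ + Nf' a b t / δ)) := by rw [hK]; ring
    have p8 : K2 * δ = B * δ + 4 * β ^ 2 * B * δ + 2 * β * B * δ := by rw [hK2]; ring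
    rw [p7, p8, hv0]
    linarith [p1.1, p1.2, p3.1]
  obtain ⟨t1, ht1, hs1⟩ := exists_slice h (by linarith : T < T + 1)
  obtain ⟨t2, ht2, hs2⟩ := exists_slice h (by linarith : T + 2 < T + 3)
  have hs1' : Nf' a b t1 / δ ≤ δ := by
    rw [hs1]
    have := hosc (s := T) (t := T + 1) le_rfl (by linarith) (by linarith)
    simpa using this
  have hs2' : Nf' a b t2 / δ ≤ δ := by
    rw [hs2]
    have := hosc (s := T + 2) (t := T + 3) (by linarith) (by linarith) (by linarith)
    have e : T + 3 - (T + 2) = 1 := by ring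
    rw [e]; simpa using this
  have ht12 : t1 ≤ t2 := by linarith [ht1.2, ht2.1]
  have hg : ∀ t, HasDerivAt (fun t => (v0 - K2 * δ) * t - K * (δ * t + Nf a b t / δ))
      (v0 - K2 * δ - K * (δ + Nf' a b t / δ)) t := fun t => by
    exact (((hasDerivAt_id t).const_mul (v0 - K2 * δ)).sub
      ((((hasDerivAt_id t).const_mul δ).add ((N_deriv h t).div_const δ)).const_mul K)).congr_deriv
      (by simp)
  have hmain := sub_le_sub_of_deriv_le hg (X_deriv h τ) ht12
    (fun t ht => hder t ⟨by linarith [ht.1, ht1.1], by linarith [ht.2, ht2.2]⟩)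
  simp only [X0_eq] at hmain
  have f1 := abs_le.1 (e0_le h τ hβ b0 b1 hδ hδ1 t1)
  have f2 := abs_le.1 (e0_le h τ hβ b0 b1 hδ hδ1 t2)
  have f3 := abs_le.1 (hys τ.c1 b1 ht1.1.le ht12 ht2.2.le)
  have f4 := mul_le_mul_of_nonneg_left (add_le_add_right hs1' δ) hE00
  have f5 := mul_le_mul_of_nonneg_left (add_le_add_right hs2' δ) hE00
  have f6 : Nf a b t1 * y t1 - Nf a b t2 * y t2 ≤ 4 * β * B * δ + B * δ := by
    have q1 : Nf a b t1 * y t1 - Nf a b t2 * y t2 = Nf a b t1 * (y t1 - y t2)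
      - (Nf a b t2 - Nf a b t1) * y t2 := by ring
    have q2 : Nf a b t1 * (y t1 - y t2) ≤ β * (4 * B * δ) := by
      refine (mul_le_mul_of_nonneg_left (by linarith [f3.1] : y t1 - y t2 ≤ 4 * B * δ)
        (N_nonneg h _)).trans ?_
      gcongr; exact hβ _
    have q3 : - ((Nf a b t2 - Nf a b t1) * y t2) ≤ δ * B := by
      refine (neg_le_abs _).trans ?_
      rw [abs_mul]
      refine mul_le_mul ?_ (hyb t2) (abs_nonneg _) hδ.le
      rw [abs_of_nonneg (by linarith [N_mono h ht12])]
      exact hosc0 ht1.1.le ht12 ht2.2.le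
    rw [q1]; linarith
  have f7 := mul_le_mul_of_nonneg_left (hosc ht1.1.le ht12 ht2.2.le) hK0
  have f8 : δ * (t2 - t1) ≤ δ * 3 := by gcongr; linarith [ht1.1, ht2.2]
  have f9 := mul_le_mul_of_nonneg_left f8 hK0
  have f10 := mul_le_mul_of_nonneg_left f8 hK20
  have hv0p : 0 < v0 := hε.trans hcon
  have f11 : v0 * 1 ≤ v0 * (t2 - t1) := by gcongr; linarith [ht1.2, ht2.1]
  have f12 : K * ((Nf a b t2 - Nf a b t1) / δ) = K * (Nf a b t2 / δ) - K * (Nf a b t1 / δ) := by ring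
  rw [f12] at f7
  have f13 : K4 * δ = 3 * (K2 * δ) + 4 * (K * δ) + (4 * β * B * δ + B * δ + 4 * (E0 * δ)) + δ := by
    rw [hK4, hK3]; ring
  rw [f13] at hδ2
  have g1 : v0 * (t2 - t1) - K2 * (δ * (t2 - t1)) - (K * (δ * (t2 - t1)) + (K * (Nf a b t2 / δ)
    - K * (Nf a b t1 / δ))) ≤ (Nf a b t1 * y t1 - Nf a b t2 * y t2)
      + (e0 a b τ t2 / H a b t2 - e0 a b τ t1 / H a b t1) := by
    linarith [hmain]
  linarith [f1.1, f2.2]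

end HM

namespace HM
open Real Set Filter Topology
variable {a b : Fn}

lemma qm_supp {w : ℝ → ℝ} (hw : Continuous w) {B : ℝ} (hB : ∀ p, |w p| ≤ B) {x y l : ℝ}
    (hxy : x ≤ y) (hl : l ≤ x) (hl' : y ≤ l + 2 * π)
    (hs : Function.support w ⊆ Ioc x y) (t : ℝ) :
    |qm a b l (l + 2 * π) w t| ≤ B * (ms a b x y t + ms b a x y t) := by
  have hH := H_pos (a := a) (b := b) t
  have e1 : (∫ p in l..(l + 2 * π), ((a.f t p) ^ 2 + (b.f t p) ^ 2) * w p) =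
      ∫ p in x..y, ((a.f t p) ^ 2 + (b.f t p) ^ 2) * w p := by
    have hs2 : Function.support (fun p => ((a.f t p) ^ 2 + (b.f t p) ^ 2) * w p) ⊆ Ioc x y :=
      (Function.support_mul_subset_right _ _).trans hs
    rw [intervalIntegral.integral_eq_integral_of_support_subset hs2,
      intervalIntegral.integral_eq_integral_of_support_subset
        (hs2.trans (Ioc_subset_Ioc hl hl'))]
  rw [qm, e1, abs_div, abs_of_pos hH, ms, ms, H_comm (a := b), ← add_div, ← mul_div_assoc]
  gcongr
  rw [← ii_add (by fun_prop) (by fun_prop), ← ii_smul]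
  apply abs_int_le hxy (by fun_prop) (by fun_prop)
  intro p hp
  have : 0 ≤ ((a.f t p) ^ 2 + (b.f t p) ^ 2) := by positivity
  rw [abs_mul, mul_comm, abs_of_nonneg this]
  exact mul_le_mul_of_nonneg_right (hB p) this

/-- No-gap lemma. -/
lemma no_gap (h : Sys a b) {d : ℝ} (hd : Tendsto (Nf a b) atTop (𝓝 d)) (hd0 : 0 < d) {x y : ℝ}
    (hxy : x < y) (hy : y - x ≤ 2 * π) :
    ∃ c > 0, ∀ᶠ T in atTop, c ≤ ms a b x y T + ms b a x y T := by
  have hpi := pi_pos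
  obtain ⟨β, hβ⟩ := N_bdd h
  have hβ0 : 0 ≤ β := (N_nonneg h 0).trans (hβ 0)
  set c0 := (x + y) / 2 with hc0
  set r := (y - x) / 2 with hr
  have hr0 : 0 < r := by rw [hr]; linarith
  set l := c0 - π with hl
  have hlx : l ≤ x := by rw [hl, hc0]; linarith
  have hly : y ≤ l + 2 * π := by rw [hl, hc0]; linarith
  let ρ : ContDiffBump c0 := ⟨r / 4, r / 2, by positivity, by linarith⟩
  have hρs : ContDiff ℝ 3 ρ := ρ.contDiff
  have hρ1 : ContDiff ℝ 2 (deriv ρ) := by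
    have := (contDiff_succ_iff_deriv (n := 2) (f := (ρ : ℝ → ℝ)) (𝕜 := ℝ)).1 hρs
    exact this.2.2
  have hρ2 : ContDiff ℝ 1 (deriv (deriv ρ)) := by
    have := (contDiff_succ_iff_deriv (n := 1) (f := deriv (ρ : ℝ → ℝ)) (𝕜 := ℝ)).1 hρ1
    exact this.2.2
  have hcρ : Continuous ρ := hρs.continuous
  have hcρ1 : Continuous (deriv ρ) := hρ1.continuous
  have hcρ2 : Continuous (deriv (deriv ρ)) := hρ2.continuous
  have dρ : ∀ p, HasDerivAt ρ (deriv ρ p) p := fun p =>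
    (hρs.differentiable (by norm_num) p).hasDerivAt
  have dρ1 : ∀ p, HasDerivAt (deriv ρ) (deriv (deriv ρ) p) p := fun p =>
    (hρ1.differentiable (by norm_num) p).hasDerivAt
  have ts : tsupport (ρ : ℝ → ℝ) ⊆ Icc (c0 - r / 2) (c0 + r / 2) := by
    rw [ρ.tsupport_eq, Real.closedBall_eq_Icc]
  have supp0 : ∀ p, p ∉ Icc (c0 - r / 2) (c0 + r / 2) → ρ p = 0 := fun p hp => by
    by_contra hne
    exact hp (ts (subset_tsupport _ hne))
  have supp1 : ∀ p, p ∉ Icc (c0 - r / 2) (c0 + r / 2) → deriv ρ p = 0 := fun p hp => by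
    by_contra hne
    exact hp (ts (support_deriv_subset hne))
  have supp2 : ∀ p, p ∉ Icc (c0 - r / 2) (c0 + r / 2) → deriv (deriv ρ) p = 0 := fun p hp => by
    by_contra hne
    have h1 : tsupport (deriv ρ) ⊆ tsupport (ρ : ℝ → ℝ) :=
      closure_minimal support_deriv_subset (isClosed_tsupport _)
    exact hp (ts (h1 (support_deriv_subset hne)))
  have hsub : Icc (c0 - r / 2) (c0 + r / 2) ⊆ Ioc x y := fun p hp => by
    constructor
    · have := hp.1; rw [hc0, hr] at this; linarith
    · have := hp.2; rw [hc0, hr] at this; linarith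
  have hlout : l ∉ Icc (c0 - r / 2) (c0 + r / 2) := fun hp => by
    have := hsub hp; linarith [this.1]
  have hlout2 : l + 2 * π ∉ Icc (c0 - r / 2) (c0 + r / 2) := fun hp => by
    have := hp.2; rw [hl, hr] at this; linarith
  set κ := (∫ p in l..(l + 2 * π), ρ p) / (2 * π) with hκ
  have hκ0 : 0 < κ := by
    apply div_pos _ (by positivity)
    have : (∫ p in l..(l + 2 * π), ρ p) = ∫ p, ρ p := by
      apply intervalIntegral.integral_eq_integral_of_support_subset
      refine Function.support_subset_iff'.2 fun p hp => supp0 p fun hp2 => hp ?_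
      exact Ioc_subset_Ioc hlx hly (hsub hp2)
    rw [this]; exact ρ.integral_pos
  let τ : Tst l :=
    { s := fun p => ∫ q in l..p, (κ - ρ q)
      s1 := fun p => κ - ρ p
      s2 := fun p => - deriv ρ p
      s3 := fun p => - deriv (deriv ρ) p
      d0 := fun p => (Continuous.integral_hasStrictDerivAt (by fun_prop) l p).hasDerivAt
      d1 := fun p => by simpa using (dρ p).const_sub κ
      d2 := fun p => (dρ1 p).neg
      c0 := continuous_iff_continuousAt.2 fun p =>
        (Continuous.integral_hasStrictDerivAt (f := fun q => κ - ρ q)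
          (by fun_prop) l p).hasDerivAt.continuousAt
      c1 := by fun_prop
      c2 := by fun_prop
      c3 := by fun_prop
      s_l := intervalIntegral.integral_same
      s_u := by
        rw [ii_sub (by fun_prop) (by fun_prop), intervalIntegral.integral_const, hκ]
        simp only [smul_eq_mul]; field_simp; ring
      s1_e := by simp only [supp0 _ hlout, supp0 _ hlout2]
      s2_l := by simp only [supp1 _ hlout, neg_zero]
      s2_u := by simp only [supp1 _ hlout2, neg_zero] }
  obtain ⟨B, hB⟩ : ∃ B, ∀ p, |-deriv (deriv ρ) p| ≤ B := by
    obtain ⟨B, hB⟩ := isCompact_Icc.exists_bound_of_continuousOn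
      (s := Icc (c0 - r / 2) (c0 + r / 2)) hcρ2.continuousOn
    refine ⟨max B 0, fun p => ?_⟩
    rw [abs_neg]
    by_cases hp : p ∈ Icc (c0 - r / 2) (c0 + r / 2)
    · exact (hB p hp).trans (le_max_left _ _)
    · rw [supp2 p hp, abs_zero]; exact le_max_right _ _
  have hB0 : 0 ≤ B := (abs_nonneg _).trans (hB 0)
  set A := β ^ 2 + B + 1 with hA
  have hA0 : 0 < A := by positivity
  have hε : 0 < d ^ 2 * κ / 8 := by positivity
  refine ⟨d ^ 2 * κ / 8 / A, by positivity, ?_⟩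
  filter_upwards [gap_core h hd τ hε, hd.eventually_const_lt (by linarith : d / 2 < d)] with T h1 h2
  rw [div_le_iff₀ hA0]
  have hz := abs_le.1 (qm_supp (a := a) (b := b) (w := τ.s3) τ.c3 hB hxy.le hlx hly
    (Function.support_subset_iff'.2 fun p hp => by
      simp only [τ]; rw [supp2 p fun hp2 => hp (hsub hp2), neg_zero]) T)
  have hq := abs_le.1 (qm_supp (a := a) (b := b) (w := ρ) (B := 1) hcρ
    (fun p => by rw [abs_of_nonneg ρ.nonneg]; exact ρ.le_one) hxy.le hlx hly
    (Function.support_subset_iff'.2 fun p hp => supp0 p fun hp2 => hp (hsub hp2)) T)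
  have hs1 : qm a b l (l + 2 * π) τ.s1 T = κ - qm a b l (l + 2 * π) ρ T := by
    have hH := (H_pos (a := a) (b := b) T).ne'
    have hHe : H a b T = ∫ p in l..(l + 2 * π), ((a.f T p) ^ 2 + (b.f T p) ^ 2) := by
      have h2 := Function.Periodic.intervalIntegral_add_eq
        (f := fun p => (a.f T p) ^ 2 + (b.f T p) ^ 2) (T := 2 * π)
        (fun p => by simp only [a.per, b.per]) l (-π)
      rw [h2, H]; congr 1; ring
    rw [qm, qm, eq_sub_iff_add_eq, ← add_div, ← ii_add (by simp only [τ]; fun_prop) (by fun_prop),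
      div_eq_iff hH, hHe, ← ii_smul]
    congr 1; ext p; simp only [τ]; ring
  set m := ms a b x y T + ms b a x y T with hm
  have hm0 : 0 ≤ m := add_nonneg (ms_nonneg hxy.le T) (ms_nonneg hxy.le T)
  have n1 : (d / 2) ^ 2 ≤ Nf a b T ^ 2 := pow_le_pow_left₀ (by linarith) h2.le 2
  have n2 : Nf a b T ^ 2 ≤ β ^ 2 := pow_le_pow_left₀ (N_nonneg h T) (hβ T) 2
  rw [hs1] at h1
  have n3 : (d / 2) ^ 2 * κ ≤ Nf a b T ^ 2 * κ := by gcongr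
  have n4 : Nf a b T ^ 2 * qm a b l (l + 2 * π) ρ T ≤ β ^ 2 * m := by
    refine (mul_le_mul_of_nonneg_left (by linarith [hq.2] : _ ≤ m) (by positivity)).trans ?_
    gcongr
  have n5 : 0 ≤ B * m := by positivity
  rw [hA]
  linarith [hz.1]

end HM

namespace HM
open Real Set Filter Topology
variable {a b : Fn}

lemma N_cont (h : Sys a b) : Continuous (Nf a b) :=
  continuous_iff_continuousAt.2 fun t => (N_deriv h t).continuousAt
lemma H_cont : Continuous (H a b) :=
  continuous_iff_continuousAt.2 fun t => (H_deriv (a := a) (b := b) t).continuousAt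

/-- sup bound on a slice -/
lemma slice_sup {x y β : ℝ} (hβ : ∀ t, Nf a b t ≤ β) (h : Sys a b) (hxy : x < y)
    (hy : y - x ≤ 2 * π) {t : ℝ} (ht : Nf' a b t ≤ 1) {p : ℝ} (hp : p ∈ Icc x y) :
    (a.f t p) ^ 2 ≤ (1 / (y - x) + 2 + β ^ 2) * H a b t := by
  have hH := H_pos (a := a) (b := b) t
  have hlen : 0 < y - x := by linarith
  have hN2 : Nf a b t ^ 2 ≤ β ^ 2 := pow_le_pow_left₀ (N_nonneg h t) (hβ t) 2
  have hE : ∫ p in x..y, ((a.f t p) ^ 2 + (a.fp t p) ^ 2) ≤ (2 + β ^ 2) * H a b t := by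
    have h1 : ∫ p in x..y, ((a.f t p) ^ 2 + (a.fp t p) ^ 2) ≤
      (∫ p in x..y, ((a.f t p) ^ 2 + (b.f t p) ^ 2)) + ∫ p in x..y, ((a.fp t p) ^ 2 + (b.fp t p) ^ 2) := by
      rw [← ii_add (by fun_prop) (by fun_prop)]
      apply ii_mono hxy.le (by fun_prop) (by fun_prop)
      intro q _
      have := sq_nonneg (b.f t q)
      have := sq_nonneg (b.fp t q)
      linarith
    have h2 := arc_H (a := a) (b := b) hxy.le hy t
    have h3 := arc_Th (a := a) (b := b) hxy.le hy t
    have h4 : (Nf' a b t + Nf a b t ^ 2) * H a b t ≤ (1 + β ^ 2) * H a b t := by gcongr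
    linarith
  have hdiff : ∀ q ∈ Icc x y, (a.f t p) ^ 2 - (2 + β ^ 2) * H a b t ≤ (a.f t q) ^ 2 := by
    intro q hq
    have h0 := intervalIntegral.integral_eq_sub_of_hasDerivAt (a := q) (b := p)
      (f := fun p => (a.f t p) ^ 2) (f' := fun p => 2 * a.f t p * a.fp t p)
      (fun p _ => ((a.dp t p).pow 2).congr_deriv (by simp))
      (Continuous.intervalIntegrable (by fun_prop) _ _)
    have h1 : |∫ p in q..p, 2 * a.f t p * a.fp t p| ≤
        |∫ p in q..p, ((a.f t p) ^ 2 + (a.fp t p) ^ 2)| := by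
      refine intervalIntegral.norm_integral_le_abs_of_norm_le (f := fun p => 2 * a.f t p * a.fp t p)
        (g := fun p => (a.f t p) ^ 2 + (a.fp t p) ^ 2) (Eventually.of_forall fun s => ?_)
        (Continuous.intervalIntegrable (by fun_prop) _ _)
      rw [Real.norm_eq_abs, abs_le]
      constructor <;> nlinarith [sq_nonneg (a.f t s + a.fp t s), sq_nonneg (a.f t s - a.fp t s)]
    have h2 : |∫ p in q..p, ((a.f t p) ^ 2 + (a.fp t p) ^ 2)| ≤
        ∫ p in x..y, ((a.f t p) ^ 2 + (a.fp t p) ^ 2) := by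
      have := intervalIntegral.abs_integral_mono_interval (μ := volume)
        (f := fun p => (a.f t p) ^ 2 + (a.fp t p) ^ 2) (a := q) (b := p) (c := x) (d := y)
        (by
          rw [uIoc_of_le hxy.le]
          intro s hs
          rw [mem_uIoc] at hs
          rcases hs with hs | hs
          · exact ⟨by linarith [hs.1, hq.1], by linarith [hs.2, hp.2]⟩
          · exact ⟨by linarith [hs.1, hp.1], by linarith [hs.2, hq.2]⟩)
        (Eventually.of_forall fun s => by positivity)
        (Continuous.intervalIntegrable (by fun_prop) _ _)
      rwa [abs_of_nonneg (a := ∫ p in x..y, _) (intervalIntegral.integral_nonneg hxy.le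
        fun s _ => by positivity)] at this
    have := le_abs_self (∫ p in q..p, 2 * a.f t p * a.fp t p)
    linarith
  have h5 := ii_mono hxy.le (by fun_prop) (by fun_prop) hdiff
  rw [intervalIntegral.integral_const, smul_eq_mul] at h5
  have h6 : ∫ p in x..y, (a.f t p) ^ 2 ≤ H a b t := by
    refine (ii_mono hxy.le (by fun_prop) (by fun_prop) fun q _ => ?_).trans
      (arc_H (a := a) (b := b) hxy.le hy t)
    linarith [sq_nonneg (b.f t q)]
  have h7 := h5.trans h6
  rw [← le_div_iff₀' hlen] at h7
  have : (1 / (y - x) + 2 + β ^ 2) * H a b t = H a b t / (y - x) + (2 + β ^ 2) * H a b t := by ring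
  linarith

lemma mu_of_ms (h : Sys a b) {d : ℝ} (hd : Tendsto (Nf a b) atTop (𝓝 d)) {x y x' y' : ℝ}
    (hx : x < x') (hx' : x' < y') (hy' : y' < y) (hy : y - x ≤ 2 * π) {c : ℝ} (hc : 0 < c) :
    ∃ c' > 0, ∀ᶠ T in atTop, c ≤ ms a b x' y' T →
      c' ≤ mu a b x y (fun p => sin (π / (y - x) * (p - x))) T := by
  have hpi := pi_pos
  obtain ⟨β, hβ⟩ := N_bdd h
  set l := π / (y - x) with hl
  have hl0 : 0 < l := div_pos pi_pos (by linarith)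
  have hly : l * (y - x) = π := by rw [hl]; field_simp [(by linarith : y - x ≠ 0)]
  set w : ℝ → ℝ := fun p => sin (l * (p - x)) with hw
  have hwc : Continuous w := by fun_prop
  have hw1 : ∀ p, |w p| ≤ 1 := fun p => abs_sin_le_one _
  have hwnn : ∀ p ∈ Icc x y, 0 ≤ w p := by
    intro p hp
    apply sin_nonneg_of_nonneg_of_le_pi
    · exact mul_nonneg hl0.le (by linarith [hp.1])
    · rw [← hly]; gcongr; exact hp.2
  obtain ⟨q, hq, hqm⟩ := isCompact_Icc.exists_isMinOn (s := Icc x' y') (f := w)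
    ⟨x', le_rfl, hx'.le⟩ hwc.continuousOn
  have hw0 : 0 < w q := by
    apply sin_pos_of_pos_of_lt_pi
    · exact mul_pos hl0 (by linarith [hq.1])
    · rw [← hly]; gcongr; linarith [hq.2]
  set C1 := 1 / (y' - x') + 2 + β ^ 2 with hC1
  have hC10 : 0 < C1 := by have : 0 < y' - x' := by linarith
                           positivity
  have hsC : 0 < √C1 := Real.sqrt_pos.2 hC10
  set c2 := w q * (c / 2) / √C1 with hc2
  have hc20 : 0 < c2 := by positivity
  set δ := min (c / 4) (c2 / (8 * π)) with hδ
  have hδ0 : 0 < δ := by rw [hδ]; positivity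
  have hδ1 : 2 * δ ≤ c / 2 := by have : δ ≤ c / 4 := min_le_left _ _
                                 linarith
  have hδ2 : 2 * π * (2 * δ) ≤ c2 / 2 := by
    have : δ ≤ c2 / (8 * π) := min_le_right _ _
    rw [le_div_iff₀ (by positivity)] at this
    linarith
  refine ⟨c2 / 2, by positivity, ?_⟩
  filter_upwards [osc_small hd 1 0 (pow_pos hδ0 2), osc_small hd 1 0 one_pos] with T h1 h2 h3
  rw [sub_zero] at h1 h2
  obtain ⟨t, ht, hs⟩ := exists_slice h (by linarith : T < T + 1)
  have hs1 : Nf' a b t ≤ 1 := by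
    rw [hs]; simpa using h2
  have hosc : (Nf a b t - Nf a b T) / δ ≤ δ := by
    rw [div_le_iff₀ hδ0, ← pow_two]; linarith [N_mono h ht.2.le]
  have hoscs : δ * (t - T) + (Nf a b t - Nf a b T) / δ ≤ 2 * δ := by
    have : δ * (t - T) ≤ δ * 1 := by gcongr; linarith [ht.2]
    linarith
  have m1 := (abs_le.1 (ms_slow h (x := x') (y := y') hx'.le (by linarith) hδ0 ht.1.le)).1
  have m2 := (abs_le.1 (mu_slow h hwc hw1 (x := x) (y := y) (by linarith) hy hδ0 ht.1.le)).2
  have m3 : c / 2 ≤ ms a b x' y' t := by linarith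
  have hH := H_pos (a := a) (b := b) t
  have hsH := Real.sqrt_pos.2 hH
  have m4 : c2 ≤ mu a b x y w t := by
    rw [ms, le_div_iff₀ hH] at m3
    rw [mu, le_div_iff₀ hsH]
    have k1 : ∫ p in x'..y', w q * (a.f t p) ^ 2 ≤ ∫ p in x'..y', √C1 * √(H a b t) * (a.f t p * w p) := by
      apply ii_mono hx'.le (by fun_prop) (by fun_prop)
      intro p hp
      have s1 : a.f t p ≤ √C1 * √(H a b t) := by
        rw [← Real.sqrt_mul hC10.le]
        apply Real.le_sqrt_of_sq_le
        exact slice_sup hβ h hx' (by linarith) hs1 hp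
      have s2 : w q ≤ w p := hqm hp
      have := a.pos t p
      calc w q * (a.f t p) ^ 2 = a.f t p * (a.f t p * w q) := by ring
        _ ≤ √C1 * √(H a b t) * (a.f t p * w p) := by gcongr
    rw [ii_smul, ii_smul] at k1
    have k2 : ∫ p in x'..y', a.f t p * w p ≤ ∫ p in x..y, a.f t p * w p := by
      apply intervalIntegral.integral_mono_interval hx.le hx'.le hy'.le
      · exact (ae_restrict_iff' measurableSet_Ioc).2 (Eventually.of_forall fun p hp =>
          mul_nonneg (a.pos t p).le (hwnn p ⟨hp.1.le, hp.2⟩))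
      · exact Continuous.intervalIntegrable (by fun_prop) _ _
    refine le_trans ?_ k2
    have k3 : w q * (c / 2 * H a b t) ≤ √C1 * √(H a b t) * ∫ p in x'..y', a.f t p * w p :=
      (mul_le_mul_of_nonneg_left m3 hw0.le).trans k1
    have k4 : w q * (c / 2 * H a b t) = √C1 * √(H a b t) * (c2 * √(H a b t)) := by
      have : H a b t = √(H a b t) * √(H a b t) := (Real.mul_self_sqrt hH.le).symm
      rw [hc2]; nth_rewrite 1 [this]; field_simp
    rw [k4] at k3
    exact le_of_mul_le_mul_left k3 (by positivity)
  have := mul_le_mul_of_nonneg_left hoscs (by positivity : 0 ≤ 2 * π)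
  linarith

set_option maxHeartbeats 1000000 in
/-- Good rays. -/
lemma good_ray (h : Sys a b) {d : ℝ} (hd : Tendsto (Nf a b) atTop (𝓝 d)) {x y : ℝ}
    (hxy : x < y) (hy : y - x ≤ 2 * π) {c : ℝ} (hc : 0 < c) {L : ℝ} (hL : 0 < L) :
    ∃ c1 > 0, ∀ᶠ T in atTop, c ≤ ms a b x y T → ∃ θ ∈ Icc x y,
      (∀ t ∈ Icc (T - L) (T + L), c1 * √(H a b t) ≤ a.f t θ) ∧
      ∫ t in (T - L)..(T + L), exp (2 * t) * (b.f t θ) ^ 2 ≤ 1 / L := by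
  have hlen : 0 < y - x := by linarith
  set c2 := c / (4 * (y - x)) with hc2
  have hc20 : 0 < c2 := by positivity
  set K := 4 * L with hK
  have hK0 : 0 < K := by positivity
  refine ⟨√c2 / 2, by positivity, ?_⟩
  filter_upwards [osc_small hd L L (by positivity : 0 < c / (2 * K))] with T hT hms
  have hNc := N_cont h
  have hHc := H_cont (a := a) (b := b)
  have hHi : Continuous fun t => (H a b t)⁻¹ := hHc.inv₀ fun t => (H_pos t).ne'
  set q : ℝ → ℝ → ℝ := fun t p => ((a.ft t p - Nf a b t * a.f t p) ^ 2
    + exp (2 * t) * (a.f t p) ^ 2 * (b.f t p) ^ 2) * (H a b t)⁻¹ with hq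
  have hqc : Continuous fun z : ℝ × ℝ => q z.1 z.2 := by simp only [hq]; fun_prop (disch := exact fun x => (H_pos _).ne')
  have hq0 : ∀ t p, 0 ≤ q t p := fun t p => by
    have := H_pos (a := a) (b := b) t
    simp only [hq]; positivity
  have hqc1 : ∀ p, Continuous fun t => q t p := fun p => by simp only [hq]; fun_prop (disch := exact fun x => (H_pos _).ne')
  have hqc2 : ∀ t, Continuous fun p => q t p := fun p => by simp only [hq]; fun_prop (disch := exact fun x => (H_pos _).ne')
  set bad : ℝ → ℝ := fun p => ∫ t in (T - L)..(T + L), q t p with hbad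
  have hbc : Continuous bad := by
    have := continuous_param (F := fun p t => q t p) (T - L) (T + L)
      (by simp only [hq]; fun_prop (disch := exact fun x => (H_pos _).ne'))
    exact this
  have hTL : T - L ≤ T + L := by linarith
  have hIntg : ∫ p in x..y, bad p ≤ c / (2 * K) := by
    simp only [hbad]
    rw [swap_param (F := fun p t => q t p) x y (T - L) (T + L) (by simp only [hq]; fun_prop (disch := exact fun x => (H_pos _).ne'))]
    have k1 : ∀ t, ∫ p in x..y, q t p ≤ Nf' a b t := by
      intro t
      have hH := H_pos (a := a) (b := b) t
      have e : (∫ p in x..y, q t p) = (∫ p in x..y, ((a.ft t p - Nf a b t * a.f t p) ^ 2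
          + exp (2 * t) * (a.f t p) ^ 2 * (b.f t p) ^ 2)) * (H a b t)⁻¹ := by
        rw [← intervalIntegral.integral_mul_const]
      rw [e, ← div_eq_mul_inv, div_le_iff₀ hH]
      refine le_trans ?_ (Df_G_le h t)
      have e2 : Df a b t + G a b t = ∫ p in (-π)..π, (((a.ft t p - Nf a b t * a.f t p) ^ 2
        + (b.ft t p - Nf a b t * b.f t p) ^ 2) + exp (2 * t) * (a.f t p) ^ 2 * (b.f t p) ^ 2) := by
        rw [ii_add (by fun_prop) (by fun_prop)]; rfl
      rw [e2]
      refine le_trans (ii_mono hxy.le (by fun_prop) (by fun_prop) fun p _ => ?_)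
        (arc_le (by fun_prop) (fun p => ?_) (fun p => ?_) hxy.le hy)
      · linarith [sq_nonneg (b.ft t p - Nf a b t * b.f t p)]
      · rw [a.per, b.per, a.pert, b.pert]
      · positivity
    have k2 : ∀ t, HasDerivAt (fun t => ∫ s in (T - L)..t, ∫ p in x..y, q s p)
        (∫ p in x..y, q t p) t := fun t =>
      (Continuous.integral_hasStrictDerivAt (continuous_param (F := q) x y hqc) _ t).hasDerivAt
    have k3 := sub_le_sub_of_deriv_le k2 (N_deriv h) hTL fun t _ => k1 t
    rw [intervalIntegral.integral_same] at k3
    linarith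
  -- choose the ray
  have hex : ∃ θ ∈ Icc x y, c2 ≤ (a.f T θ) ^ 2 * (H a b T)⁻¹ - K * bad θ := by
    by_contra! hcon
    have k1 := ii_mono hxy.le (f := fun θ => (a.f T θ) ^ 2 * (H a b T)⁻¹ - K * bad θ)
      (g := fun _ => c2) (by fun_prop) (by fun_prop) fun θ hθ => (hcon θ hθ).le
    rw [ii_sub (by fun_prop) (by fun_prop), ii_smul, intervalIntegral.integral_const, smul_eq_mul,
      intervalIntegral.integral_mul_const, ← div_eq_mul_inv] at k1
    change ms a b x y T - _ ≤ _ at k1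
    have k2 := mul_le_mul_of_nonneg_left hIntg hK0.le
    have k3 : K * (c / (2 * K)) = c / 2 := by field_simp
    have k4 : (y - x) * c2 = c / 4 := by rw [hc2]; field_simp
    linarith
  obtain ⟨θ, hθ, hθ2⟩ := hex
  have hbad0 : 0 ≤ bad θ := intervalIntegral.integral_nonneg hTL fun t _ => hq0 t θ
  set F : ℝ → ℝ := fun t => a.f t θ / √(H a b t) with hF
  have hF2 : ∀ t, (F t) ^ 2 = (a.f t θ) ^ 2 * (H a b t)⁻¹ := fun t => by
    simp only [hF]; rw [div_pow, Real.sq_sqrt (H_pos t).le, div_eq_mul_inv]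
  have hFpos : ∀ t, 0 < F t := fun t => div_pos (a.pos t θ) (Real.sqrt_pos.2 (H_pos t))
  rw [← hF2] at hθ2
  have hFT : √c2 ≤ F T := by
    apply Real.sqrt_le_iff.2 ⟨(hFpos T).le, ?_⟩
    have := mul_nonneg hK0.le hbad0
    linarith
  have hbadF : bad θ ≤ F T ^ 2 / K := by
    rw [le_div_iff₀ hK0]; linarith
  have hFd : ∀ t, HasDerivAt F ((a.ft t θ - Nf a b t * a.f t θ) / √(H a b t)) t := by
    intro t
    have hs := Real.sqrt_pos.2 (H_pos (a := a) (b := b) t)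
    refine ((a.dt t θ).div (sqrtH_deriv (a := a) (b := b) t) hs.ne').congr_deriv ?_
    field_simp
  set δ := F T / (2 * L) with hδ
  have hδ0 : 0 < δ := div_pos (hFpos T) (by positivity)
  have hFd' : ∀ t, |(a.ft t θ - Nf a b t * a.f t θ) / √(H a b t)| ≤ 1 / 2 * (δ + q t θ / δ) := by
    intro t
    have hH := H_pos (a := a) (b := b) t
    have k := amgm hδ0 1 ((a.ft t θ - Nf a b t * a.f t θ) / √(H a b t))
    rw [one_mul, abs_mul, abs_of_pos (by norm_num : (0 : ℝ) < 2), one_pow, mul_one] at k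
    have k2 : ((a.ft t θ - Nf a b t * a.f t θ) / √(H a b t)) ^ 2 ≤ q t θ := by
      rw [div_pow, Real.sq_sqrt hH.le, div_eq_mul_inv]
      simp only [hq]
      gcongr
      have : 0 ≤ exp (2 * t) * (a.f t θ) ^ 2 * (b.f t θ) ^ 2 := by positivity
      linarith
    have k3 := div_le_div_of_nonneg_right k2 hδ0.le
    linarith
  set Q : ℝ → ℝ := fun t => ∫ s in (T - L)..t, q s θ with hQ
  have hQd : ∀ t, HasDerivAt Q (q t θ) t := fun t =>
    (Continuous.integral_hasStrictDerivAt (hqc1 θ) _ t).hasDerivAt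
  have hQm : Monotone Q := monotone_of_deriv hQd fun t => hq0 t θ
  have hQ0 : Q (T - L) = 0 := intervalIntegral.integral_same
  have hslow : ∀ {s t}, T - L ≤ s → s ≤ t → t ≤ T + L → t - s ≤ L → |F t - F s| ≤ F T / 2 := by
    intro s t h1 h2 h3 h4
    refine (slow hQd hFd (C := 1 / 2) (δ := δ) hFd' h2).trans ?_
    have e1 : δ * (t - s) ≤ δ * L := by gcongr
    have e2 : δ * L = F T / 2 := by rw [hδ]; field_simp
    have e3 : Q t - Q s ≤ bad θ := by
      have := hQm h3
      have := hQm h1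
      rw [hQ0] at this
      change Q t ≤ bad θ at *
      linarith
    have e4 : (Q t - Q s) / δ ≤ F T / 2 := by
      rw [div_le_iff₀ hδ0]
      refine (e3.trans hbadF).trans (le_of_eq ?_)
      rw [hδ, hK]; field_simp; norm_num
    linarith
  have hwin : ∀ t ∈ Icc (T - L) (T + L), F T / 2 ≤ F t := by
    intro t ht
    rcases le_total t T with hle | hle
    · have := (abs_le.1 (hslow ht.1 hle (by linarith) (by linarith [ht.1]))).2
      linarith
    · have := (abs_le.1 (hslow (by linarith) hle ht.2 (by linarith [ht.2]))).1
      linarith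
  refine ⟨θ, hθ, fun t ht => ?_, ?_⟩
  · have k := hwin t ht
    simp only [hF] at k
    have hs := Real.sqrt_pos.2 (H_pos (a := a) (b := b) t)
    rw [le_div_iff₀ hs] at k
    refine le_trans ?_ k
    gcongr
  · have k1 : ∫ t in (T - L)..(T + L), (F T ^ 2 / 4) * (exp (2 * t) * (b.f t θ) ^ 2) ≤ bad θ := by
      apply ii_mono hTL (by fun_prop) (hqc1 θ)
      intro t ht
      have e1 : F T ^ 2 / 4 ≤ F t ^ 2 := by
        have := pow_le_pow_left₀ (by linarith [hFpos T]) (hwin t ht) 2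
        linarith
      have hH := H_pos (a := a) (b := b) t
      calc _ ≤ F t ^ 2 * (exp (2 * t) * (b.f t θ) ^ 2) := by gcongr
        _ = 0 + exp (2 * t) * (a.f t θ) ^ 2 * (b.f t θ) ^ 2 * (H a b t)⁻¹ := by rw [hF2]; ring
        _ ≤ q t θ := by
          simp only [hq]; rw [add_mul]; gcongr; positivity
    rw [ii_smul] at k1
    have hFT0 := hFpos T
    have k2 := k1.trans hbadF
    have k3 : F T ^ 2 / K = F T ^ 2 / 4 * (1 / L) := by rw [hK]; field_simp
    rw [k3] at k2
    exact le_of_mul_le_mul_left k2 (by positivity)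

end HM

namespace HM
open Real Set Filter Topology
variable {a b : Fn}

/-- monotonicity in the vertical direction on the right half plane, in log-polar coordinates -/
def Mono (a : Fn) : Prop := ∀ t t' φ φ', 0 < φ → φ ≤ φ' → φ' < π →
  exp t * sin φ = exp t' * sin φ' → a.f t φ ≤ a.f t' φ'

lemma logsin_bdd {x z : ℝ} (hx : 0 < x) (hxz : x ≤ z) (hz : z < π) : ∃ M > 0, ∀ φ ∈ Icc x z,
    ∀ θ ∈ Icc x z, |log (sin φ) - log (sin θ)| ≤ M := by
  have hpos : ∀ φ ∈ Icc x z, 0 < sin φ := fun φ hφ =>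
    sin_pos_of_pos_of_lt_pi (by linarith [hφ.1]) (by linarith [hφ.2])
  obtain ⟨B, hB⟩ := isCompact_Icc.exists_bound_of_continuousOn (s := Icc x z)
    (f := fun φ => log (sin φ))
    (ContinuousOn.log (by fun_prop) fun φ hφ => (hpos φ hφ).ne')
  have hB0 : 0 ≤ B := (norm_nonneg _).trans (hB x ⟨le_rfl, hxz⟩)
  refine ⟨2 * B + 1, by positivity, fun φ hφ θ hθ => ?_⟩
  have h1 := hB φ hφ
  have h2 := hB θ hθ
  rw [Real.norm_eq_abs] at h1 h2
  have := abs_sub (log (sin φ)) (log (sin θ))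
  linarith

lemma exp_shift {t φ θ : ℝ} (hφ : 0 < sin φ) (hθ : 0 < sin θ) :
    exp (t + (log (sin φ) - log (sin θ))) * sin θ = exp t * sin φ := by
  rw [exp_add, exp_sub, exp_log hφ, exp_log hθ]; field_simp

lemma H_shift (h : Sys a b) {β : ℝ} (hβ : ∀ t, Nf a b t ≤ β) (hβ0 : 0 ≤ β) {M : ℝ} {s t : ℝ}
    (hM : |s - t| ≤ M) : exp (- (2 * β * M)) * H a b t ≤ H a b s := by
  have hM0 : 0 ≤ M := (abs_nonneg _).trans hM
  have hH := H_pos (a := a) (b := b) t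
  rcases le_total t s with hle | hle
  · have h1 := H_mono h hle
    have h2 : exp (- (2 * β * M)) ≤ 1 := exp_le_one_iff.2 (by
      have : 0 ≤ 2 * β * M := by positivity
      linarith)
    have := mul_le_mul_of_nonneg_right h2 hH.le
    linarith
  · have h1 := H_le h hle (hβ t)
    have h2 : H a b t ≤ exp (2 * β * M) * H a b s := by
      refine h1.trans ?_
      have h3 : t - s ≤ M := by linarith [(abs_le.1 hM).1]
      have hs := H_pos (a := a) (b := b) s
      have h4 : exp (2 * β * (t - s)) ≤ exp (2 * β * M) := exp_le_exp.2 (by gcongr)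
      have := mul_le_mul_of_nonneg_right h4 hs.le
      linarith
    rw [exp_neg, inv_mul_le_iff₀ (exp_pos _)]; exact h2

lemma up (h : Sys a b) (hm : Mono a) {d : ℝ} (hd : Tendsto (Nf a b) atTop (𝓝 d)) {x y z : ℝ}
    (hx : 0 < x) (hxy : x < y) (hyz : y ≤ z) (hz : z < π) {c : ℝ} (hc : 0 < c) :
    ∃ c' > 0, ∃ C, ∀ᶠ T in atTop, c ≤ ms a b x y T →
      (∀ φ ∈ Icc y z, c' * √(H a b T) ≤ a.f T φ) ∧
      (∫ t in T..(T + 3), ∫ p in y..z, exp (2 * t) * (b.f t p) ^ 2) ≤ C := by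
  obtain ⟨β, hβ⟩ := N_bdd h
  have hβ0 : 0 ≤ β := (N_nonneg h 0).trans (hβ 0)
  obtain ⟨M, hM0, hM⟩ := logsin_bdd hx (hxy.le.trans hyz) hz
  have hpi := pi_pos
  obtain ⟨c1, hc1, hev⟩ := good_ray h hd hxy (by linarith) hc (by positivity : 0 < M + 3)
  set c3 := c1 * √(exp (- (2 * β * M))) with hc3
  have hc30 : 0 < c3 := by have := exp_pos (- (2 * β * M)); positivity
  refine ⟨c3, hc30, 1 / c3 ^ 2, ?_⟩
  filter_upwards [hev, osc_small hd 3 0 one_pos] with T h1 h2 hms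
  obtain ⟨θ, hθ, h3, -⟩ := h1 hms
  have hpos : ∀ φ ∈ Icc x z, 0 < sin φ := fun φ hφ =>
    sin_pos_of_pos_of_lt_pi (by linarith [hφ.1]) (by linarith [hφ.2])
  have key : ∀ t ∈ Icc T (T + 3), ∀ φ ∈ Icc y z, c3 * √(H a b t) ≤ a.f t φ := by
    intro t ht φ hφ
    have hφ' : φ ∈ Icc x z := ⟨by linarith [hφ.1], hφ.2⟩
    have hθ' : θ ∈ Icc x z := ⟨hθ.1, by linarith [hθ.2]⟩
    set s := t + (log (sin φ) - log (sin θ)) with hs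
    have hsM : |s - t| ≤ M := by rw [hs, add_sub_cancel_left]; exact hM φ hφ' θ hθ'
    have k1 := hm s t θ φ (by linarith [hθ.1]) (by linarith [hθ.2, hφ.1]) (by linarith [hφ.2])
      (exp_shift (hpos φ hφ') (hpos θ hθ'))
    have k2 := abs_le.1 hsM
    have k3 := h3 s ⟨by linarith [ht.1], by linarith [ht.2]⟩
    have k4 := Real.sqrt_le_sqrt (H_shift h hβ hβ0 hsM)
    rw [Real.sqrt_mul (exp_pos _).le] at k4
    have k5 := mul_le_mul_of_nonneg_left k4 hc1.le
    rw [hc3]; linarith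
  refine ⟨key T ⟨le_rfl, by linarith⟩, ?_⟩
  have hNc := N_cont h
  have k1 : ∀ t ∈ Icc T (T + 3), c3 ^ 2 * ∫ p in y..z, exp (2 * t) * (b.f t p) ^ 2 ≤ Nf' a b t := by
    intro t ht
    have hH := H_pos (a := a) (b := b) t
    have e := arc_G h hyz (by linarith) t
    rw [← div_le_iff₀ hH] at e
    refine le_trans ?_ e
    rw [le_div_iff₀ hH, mul_comm, ← mul_assoc, ← ii_smul]
    apply ii_mono hyz (by fun_prop) (by fun_prop)
    intro p hp
    have := pow_le_pow_left₀ (by positivity) (key t ht p hp) 2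
    rw [mul_pow, Real.sq_sqrt hH.le] at this
    calc _ = (c3 ^ 2 * H a b t) * (exp (2 * t) * (b.f t p) ^ 2) := by ring
      _ ≤ (a.f t p) ^ 2 * (exp (2 * t) * (b.f t p) ^ 2) := by gcongr
      _ = _ := by ring
  have hcont : Continuous fun t => ∫ p in y..z, exp (2 * t) * (b.f t p) ^ 2 :=
    continuous_param (F := fun t p => exp (2 * t) * (b.f t p) ^ 2) y z (by fun_prop)
  have k2 : ∀ t, HasDerivAt (fun t => c3 ^ 2 * ∫ s in T..t, ∫ p in y..z, exp (2 * s) * (b.f s p) ^ 2)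
      (c3 ^ 2 * ∫ p in y..z, exp (2 * t) * (b.f t p) ^ 2) t := fun t =>
    (Continuous.integral_hasStrictDerivAt hcont _ t).hasDerivAt.const_mul _
  have k3 := sub_le_sub_of_deriv_le k2 (N_deriv h) (by linarith : T ≤ T + 3) fun t ht => k1 t
    ⟨ht.1.le, ht.2.le⟩
  simp only [intervalIntegral.integral_same, mul_zero, sub_zero] at k3
  rw [sub_zero] at h2
  rw [le_div_iff₀ (by positivity)]
  linarith

lemma dn (h : Sys a b) (hm : Mono a) {d : ℝ} (hd : Tendsto (Nf a b) atTop (𝓝 d)) {w x y : ℝ}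
    (hw : 0 < w) (hwx : w ≤ x) (hxy : x < y) (hy : y < π) {c : ℝ} (hc : 0 < c) :
    ∃ C, ∀ᶠ T in atTop, c ≤ ms b a x y T →
      (∫ t in T..(T + 3), ∫ p in w..x, exp (2 * t) * (a.f t p) ^ 2) ≤ C := by
  obtain ⟨M, hM0, hM⟩ := logsin_bdd hw (hwx.trans hxy.le) hy
  have hpi := pi_pos
  rw [Nf_comm] at hd
  obtain ⟨c1, hc1, hev⟩ := good_ray h.symm hd hxy (by linarith) hc (by positivity : 0 < M + 3)
  refine ⟨(x - w) * (exp (2 * M) * (1 / (M + 3))), ?_⟩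
  filter_upwards [hev] with T h1 hms
  obtain ⟨θ, hθ, -, h3⟩ := h1 hms
  have hpos : ∀ φ ∈ Icc w y, 0 < sin φ := fun φ hφ =>
    sin_pos_of_pos_of_lt_pi (by linarith [hφ.1]) (by linarith [hφ.2])
  rw [swap_param (F := fun t p => exp (2 * t) * (a.f t p) ^ 2) _ _ _ _ (by fun_prop)]
  have key : ∀ φ ∈ Icc w x, ∫ t in T..(T + 3), exp (2 * t) * (a.f t φ) ^ 2 ≤
      exp (2 * M) * (1 / (M + 3)) := by
    intro φ hφ
    have hφ' : φ ∈ Icc w y := ⟨hφ.1, by linarith [hφ.2]⟩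
    have hθ' : θ ∈ Icc w y := ⟨by linarith [hθ.1], hθ.2⟩
    set σ := log (sin φ) - log (sin θ) with hσ
    have hsM : |σ| ≤ M := hM φ hφ' θ hθ'
    have k2 := abs_le.1 hsM
    have e1 : ∫ t in T..(T + 3), exp (2 * t) * (a.f t φ) ^ 2 ≤
        ∫ t in T..(T + 3), exp (2 * M) * (exp (2 * (t + σ)) * (a.f (t + σ) θ) ^ 2) := by
      apply ii_mono (by linarith) (by fun_prop) (by fun_prop)
      intro t ht
      have k1 := hm t (t + σ) φ θ (by linarith [hφ.1]) (by linarith [hφ.2, hθ.1])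
        (by linarith [hθ.2]) (exp_shift (hpos φ hφ') (hpos θ hθ')).symm
      have := a.pos t φ
      rw [← mul_assoc, ← exp_add]
      gcongr
      linarith
    refine e1.trans ?_
    rw [ii_smul, intervalIntegral.integral_comp_add_right
      (f := fun t => exp (2 * t) * (a.f t θ) ^ 2)]
    gcongr
    refine le_trans ?_ h3
    apply intervalIntegral.integral_mono_interval (by linarith) (by linarith) (by linarith)
    · exact Eventually.of_forall fun t => by positivity
    · exact Continuous.intervalIntegrable (by fun_prop) _ _
  have := ii_mono hwx (f := fun p => ∫ t in T..(T + 3), exp (2 * t) * (a.f t p) ^ 2)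
    (g := fun _ => exp (2 * M) * (1 / (M + 3)))
    (continuous_param (F := fun p t => exp (2 * t) * (a.f t p) ^ 2) _ _ (by fun_prop))
    (by fun_prop) key
  rw [intervalIntegral.integral_const, smul_eq_mul] at this
  exact this

end HM

namespace HM
open Real Set Filter Topology
variable {a b : Fn}

lemma ode_decay {Z Z1 Z2 : ℝ → ℝ} (hZ : ∀ t, HasDerivAt Z (Z1 t) t)
    (hZ1 : ∀ t, HasDerivAt Z1 (Z2 t) t) {T0 k γ C : ℝ} (hk : 0 < k) (hγ : γ < k)
    (h1 : ∀ t, T0 ≤ t → k ^ 2 * Z t ≤ Z2 t) (h2 : ∀ t, T0 ≤ t → Z t ≤ C * exp (γ * t)) :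
    ∀ t, T0 ≤ t → Z t ≤ Z T0 * exp (- k * (t - T0)) := by
  have hE : ∀ s t : ℝ, HasDerivAt (fun t => exp (s * t)) (s * exp (s * t)) t := fun s t => by
    have := ((hasDerivAt_id t).const_mul s).exp
    refine this.congr_deriv ?_
    simp [mul_comm]
  set Y : ℝ → ℝ := fun t => Z1 t + k * Z t with hY
  have hYd : ∀ t, HasDerivAt (fun t => Y t * exp (- k * t))
      ((Z2 t + k * Z1 t) * exp (- k * t) + Y t * (- k * exp (- k * t))) t := fun t =>
    (((hZ1 t).add ((hZ t).const_mul k)).mul (hE (-k) t))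
  have hW : ∀ t, HasDerivAt (fun t => Z t * exp (k * t))
      (Z1 t * exp (k * t) + Z t * (k * exp (k * t))) t := fun t => (hZ t).mul (hE k t)
  have hY0 : ∀ t, T0 ≤ t → Y t ≤ 0 := by
    intro t1 ht1
    by_contra! hpos
    set κ := Y t1 * exp (- k * t1) with hκ
    have hκ0 : 0 < κ := mul_pos hpos (exp_pos _)
    have hYb : ∀ t, t1 ≤ t → κ * exp (k * t) ≤ Y t := by
      intro t ht
      have := sub_le_sub_of_deriv_le (f := fun _ => 0) (f' := fun _ => 0)
        (fun t => hasDerivAt_const t 0) hYd ht (fun s hs => by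
          have e := h1 s (by linarith [hs.1])
          have : (Z2 s + k * Z1 s) * exp (- k * s) + Y s * (- k * exp (- k * s))
            = (Z2 s - k ^ 2 * Z s) * exp (- k * s) := by simp only [hY]; ring
          rw [this]; exact mul_nonneg (by linarith) (exp_pos _).le)
      have h3 : κ ≤ Y t * exp (- k * t) := by rw [hκ]; linarith
      have h4 := mul_le_mul_of_nonneg_right h3 (exp_pos (k * t)).le
      have h5 : Y t * exp (- k * t) * exp (k * t) = Y t := by
        rw [mul_assoc, ← exp_add]; simp
      rw [h5] at h4
      exact h4
    have hlow : ∀ t, t1 ≤ t → κ / (2 * k) * (exp (2 * k * t) - exp (2 * k * t1))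
        + Z t1 * exp (k * t1) ≤ Z t * exp (k * t) := by
      intro t ht
      have := sub_le_sub_of_deriv_le (f := fun t => κ / (2 * k) * exp (2 * k * t))
        (fun t => (hE (2 * k) t).const_mul (κ / (2 * k))) hW ht (fun s hs => by
          have e := mul_le_mul_of_nonneg_right (hYb s hs.1.le) (exp_pos (k * s)).le
          have e2 : κ / (2 * k) * (2 * k * exp (2 * k * s)) = κ * exp (k * s) * exp (k * s) := by
            have e3 : exp (2 * k * s) = exp (k * s) * exp (k * s) := by
              rw [← exp_add]; congr 1; ring
            rw [e3]; field_simp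
          rw [e2]; refine e.trans (le_of_eq ?_); simp only [hY]; ring)
      linarith
    set K1 := κ / (2 * k) * exp (2 * k * t1) - Z t1 * exp (k * t1) with hK1
    have hlim : Tendsto (fun t => C * exp ((γ - k) * t) + K1 * exp (- (2 * k) * t)) atTop
        (𝓝 (C * 0 + K1 * 0)) := by
      apply Tendsto.add <;> apply Tendsto.const_mul
      · exact tendsto_exp_atBot.comp (tendsto_id.const_mul_atTop_of_neg (by linarith))
      · exact tendsto_exp_atBot.comp (tendsto_id.const_mul_atTop_of_neg (by linarith))
    rw [mul_zero, mul_zero, add_zero] at hlim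
    obtain ⟨t, ht, ht2⟩ := ((hlim.eventually_lt_const (by positivity : 0 < κ / (2 * k))).and
      (eventually_ge_atTop t1)).exists
    have e1 := hlow t ht2
    have e2 := mul_le_mul_of_nonneg_right (h2 t (by linarith)) (exp_pos (k * t)).le
    have e3 := mul_lt_mul_of_pos_right ht (exp_pos (2 * k * t))
    have e4 : (C * exp ((γ - k) * t) + K1 * exp (- (2 * k) * t)) * exp (2 * k * t)
      = C * exp (γ * t) * exp (k * t) + K1 := by
      have q1 : exp ((γ - k) * t) * exp (2 * k * t) = exp (γ * t) * exp (k * t) := by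
        rw [← exp_add, ← exp_add]; congr 1; ring
      have q2 : exp (- (2 * k) * t) * exp (2 * k * t) = 1 := by
        rw [← exp_add, ← exp_zero]; congr 1; ring
      linear_combination C * q1 + K1 * q2
    rw [e4] at e3
    linarith
  intro t ht
  have := sub_le_sub_of_deriv_le hW (g := fun _ => 0) (g' := fun _ => 0)
    (fun t => hasDerivAt_const t 0) ht (fun s hs => by
      have e := mul_nonpos_of_nonpos_of_nonneg (hY0 s hs.1.le) (exp_pos (k * s)).le
      refine le_trans (le_of_eq ?_) e
      simp only [hY]; ring)
  have h3 : Z t * exp (k * t) ≤ Z T0 * exp (k * T0) := by linarith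
  have h4 := mul_le_mul_of_nonneg_right h3 (exp_pos (- k * t)).le
  rw [mul_assoc, mul_assoc, ← exp_add, ← exp_add] at h4
  have e1 : k * t + - k * t = 0 := by ring
  have e2 : k * T0 + - k * t = - k * (t - T0) := by ring
  rw [e1, e2] at h4
  simpa using h4

set_option maxHeartbeats 1000000 in
/-- Channel lemma. -/
lemma channel (h : Sys a b) {q η β C : ℝ} (hη : 0 < η) (hη1 : 6 * η ≤ 2 * π)
    (hβ : ∀ t, Nf a b t ≤ β) (hβ0 : 0 ≤ β)
    (hη2 : 2 * β + 2 < π / (6 * η))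
    (hL : ∀ᶠ T in atTop, (∫ t in T..(T + 3), ∫ p in (q - 3 * η)..(q - η),
      exp (2 * t) * (a.f t p) ^ 2) ≤ C)
    (hR : ∀ᶠ T in atTop, (∫ t in T..(T + 3), ∫ p in (q + η)..(q + 3 * η),
      exp (2 * t) * (a.f t p) ^ 2) ≤ C) :
    ∃ C', ∀ᶠ T in atTop, (∫ t in T..(T + 3), ∫ p in (q - η)..(q + η),
      exp (2 * t) * (a.f t p) ^ 2) ≤ C' := by
  have hpi := pi_pos
  set k := π / (6 * η) with hk
  have hk0 : 0 < k := by positivity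
  have hkη : 2 * k * (3 * η) = π := by rw [hk]; field_simp; norm_num
  set x := q - 3 * η with hx
  set y := q + 3 * η with hy
  set W : ℝ → ℝ := fun p => 1 + cos (2 * k * (p - q)) with hW
  have hWc : Continuous W := by fun_prop
  have hW0 : ∀ p, 0 ≤ W p := fun p => by
    have := neg_one_le_cos (2 * k * (p - q)); simp only [hW]; linarith
  have hW1 : ∀ p, HasDerivAt W (- (2 * k) * sin (2 * k * (p - q))) p := fun p => by
    have := ((((hasDerivAt_id p).sub_const q).const_mul (2 * k)).cos).const_add 1
    refine this.congr_deriv ?_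
    simp; ring
  have hW2 : ∀ p, HasDerivAt (fun p => - (2 * k) * sin (2 * k * (p - q)))
      (- (2 * k) ^ 2 * cos (2 * k * (p - q))) p := fun p => by
    have := ((((hasDerivAt_id p).sub_const q).const_mul (2 * k)).sin).const_mul (- (2 * k))
    refine this.congr_deriv ?_
    simp; ring
  have ex : 2 * k * (x - q) = - π := by rw [hx, ← hkη]; ring
  have ey : 2 * k * (y - q) = π := by rw [hy, ← hkη]; ring
  set m : ℝ → ℝ := fun t => ∫ p in x..y, (a.f t p) ^ 2 * W p with hm
  set m1 : ℝ → ℝ := fun t => ∫ p in x..y, (2 * a.f t p * a.ft t p) * W p with hm1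
  set m2 : ℝ → ℝ := fun t => ∫ p in x..y,
    (2 * (a.ft t p * a.ft t p + a.f t p * a.ftt t p)) * W p with hm2
  have dm : ∀ t, HasDerivAt m (m1 t) t := fun t =>
    hasDerivAt_param (F := fun t p => (a.f t p) ^ 2 * W p)
    (F' := fun t p => (2 * a.f t p * a.ft t p) * W p) x y
    (by fun_prop) (by fun_prop) (fun t p =>
      (((a.dt t p).pow 2).mul_const (W p)).congr_deriv (by simp)) t
  have dm1 : ∀ t, HasDerivAt m1 (m2 t) t := fun t =>
    hasDerivAt_param (F := fun t p => (2 * a.f t p * a.ft t p) * W p)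
    (F' := fun t p => (2 * (a.ft t p * a.ft t p + a.f t p * a.ftt t p)) * W p) x y
    (by fun_prop) (by fun_prop) (fun t p =>
      ((((a.dt t p).const_mul 2).mul (a.dtt t p)).mul_const (W p)).congr_deriv (by ring)) t
  have cm : Continuous m := continuous_iff_continuousAt.2 fun t => (dm t).continuousAt
  have cm1 : Continuous m1 := continuous_iff_continuousAt.2 fun t => (dm1 t).continuousAt
  have cm2 : Continuous m2 :=
    continuous_param (F := fun t p => (2 * (a.ft t p * a.ft t p + a.f t p * a.ftt t p)) * W p)
    x y (by fun_prop)
  have hxy : x ≤ y := by rw [hx, hy]; linarith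
  have hxy2 : y - x ≤ 2 * π := by rw [hx, hy]; linarith
  have hm0 : ∀ t, 0 ≤ m t := fun t => intervalIntegral.integral_nonneg hxy fun p _ =>
    mul_nonneg (sq_nonneg _) (hW0 p)
  set P : ℝ → ℝ := fun t => (∫ p in (q - 3 * η)..(q - η), exp (2 * t) * (a.f t p) ^ 2)
    + ∫ p in (q + η)..(q + 3 * η), exp (2 * t) * (a.f t p) ^ 2 with hP
  have cPl : Continuous fun t => ∫ p in (q - 3 * η)..(q - η), exp (2 * t) * (a.f t p) ^ 2 :=
    continuous_param (F := fun t p => exp (2 * t) * (a.f t p) ^ 2) _ _ (by fun_prop)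
  have cPr : Continuous fun t => ∫ p in (q + η)..(q + 3 * η), exp (2 * t) * (a.f t p) ^ 2 :=
    continuous_param (F := fun t p => exp (2 * t) * (a.f t p) ^ 2) _ _ (by fun_prop)
  have cP : Continuous P := cPl.add cPr
  have hP0 : ∀ t, 0 ≤ P t := fun t => add_nonneg
    (intervalIntegral.integral_nonneg (by linarith) fun p _ => by positivity)
    (intervalIntegral.integral_nonneg (by linarith) fun p _ => by positivity)
  -- convexity inequality
  have hconv : ∀ t, k ^ 2 * m t - 8 * k ^ 2 * (exp (- 2 * t) * P t) ≤ m2 t := by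
    intro t
    have h0 := intervalIntegral.integral_eq_sub_of_hasDerivAt (a := x) (b := y)
      (f := fun p => 2 * a.f t p * a.fp t p * W p - (a.f t p) ^ 2 * (- (2 * k) * sin (2 * k * (p - q))))
      (f' := fun p => 2 * (a.fp t p * a.fp t p + a.f t p * a.fpp t p) * W p
        - (a.f t p) ^ 2 * (- (2 * k) ^ 2 * cos (2 * k * (p - q))))
      (fun p _ => (((((a.dp t p).const_mul 2).mul (a.dpp t p)).mul (hW1 p)).sub
        (((a.dp t p).pow 2).mul (hW2 p))).congr_deriv (by simp; ring))
      (Continuous.intervalIntegrable (by fun_prop) _ _)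
    have wx : W x = 0 := by simp only [hW, ex, cos_neg, cos_pi]; norm_num
    have wy : W y = 0 := by simp only [hW, ey, cos_pi]; norm_num
    simp only [wx, wy, ex, ey, sin_neg, sin_pi, neg_zero, mul_zero, sub_self] at h0
    have h1 : (2 * k) ^ 2 * ∫ p in x..y, (a.f t p) ^ 2 * cos (2 * k * (p - q)) ≤ m2 t := by
      have : (2 * k) ^ 2 * (∫ p in x..y, (a.f t p) ^ 2 * cos (2 * k * (p - q))) - 0 ≤ m2 t := by
        rw [← h0, ← ii_smul, ← ii_sub (by fun_prop) (by fun_prop)]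
        apply ii_mono hxy (by fun_prop) (by fun_prop)
        intro p _
        have e := h.eqa t p
        have e2 : 0 ≤ 2 * (a.ft t p ^ 2 + a.fp t p ^ 2 + a.f t p * (exp (2 * t) * a.f t p * (b.f t p) ^ 2)) * W p := by
          have := a.pos t p
          have := hW0 p
          positivity
        rw [← e] at e2
        linarith
      linarith
    refine le_trans ?_ h1
    -- split
    have e1 : (2 * k) ^ 2 * (∫ p in x..y, (a.f t p) ^ 2 * cos (2 * k * (p - q))) - k ^ 2 * m t
      = (2 * k) ^ 2 * ∫ p in x..y, (a.f t p) ^ 2 * (cos (2 * k * (p - q)) - W p / 4) := by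
      simp only [hm]
      rw [← ii_smul, ← ii_smul, ← ii_smul, ← ii_sub (by fun_prop) (by fun_prop)]
      congr 1; ext p; ring
    have ci : ∀ u v, IntervalIntegrable
      (fun p => (a.f t p) ^ 2 * (cos (2 * k * (p - q)) - W p / 4)) volume u v := fun u v =>
      Continuous.intervalIntegrable (by fun_prop) _ _
    have e2 := intervalIntegral.integral_add_adjacent_intervals (ci x (q - η)) (ci (q - η) (q + η))
    have e3 := intervalIntegral.integral_add_adjacent_intervals (ci x (q + η)) (ci (q + η) y)
    have elat : ∀ p, -2 * (exp (-2 * t) * (exp (2 * t) * (a.f t p) ^ 2)) ≤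
        (a.f t p) ^ 2 * (cos (2 * k * (p - q)) - W p / 4) := fun p => by
      have e : exp (-2 * t) * (exp (2 * t) * (a.f t p) ^ 2) = (a.f t p) ^ 2 := by
        rw [← mul_assoc, ← exp_add]; simp
      rw [e]
      have k1 := neg_one_le_cos (2 * k * (p - q))
      have k2 := cos_le_one (2 * k * (p - q))
      have : -2 ≤ cos (2 * k * (p - q)) - W p / 4 := by simp only [hW]; linarith
      have := mul_le_mul_of_nonneg_left this (sq_nonneg (a.f t p))
      linarith
    have l1 := ii_mono (by rw [hx]; linarith : x ≤ q - η) (by fun_prop) (by fun_prop)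
      (fun p _ => elat p)
    have l2 := ii_mono (by rw [hy]; linarith : q + η ≤ y) (by fun_prop) (by fun_prop)
      (fun p _ => elat p)
    have l3 : 0 ≤ ∫ p in (q - η)..(q + η), (a.f t p) ^ 2 * (cos (2 * k * (p - q)) - W p / 4) := by
      apply intervalIntegral.integral_nonneg (by linarith)
      intro p hp
      apply mul_nonneg (sq_nonneg _)
      have : cos (π / 3) ≤ cos (2 * k * (p - q)) := by
        rw [← cos_abs (2 * k * (p - q))]
        apply cos_le_cos_of_nonneg_of_le_pi (abs_nonneg _) (by linarith)
        rw [abs_mul, abs_of_pos (by positivity)]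
        have : |p - q| ≤ η := abs_le.2 ⟨by linarith [hp.1], by linarith [hp.2]⟩
        calc 2 * k * |p - q| ≤ 2 * k * η := by gcongr
          _ = π / 3 := by rw [← hkη]; ring
      rw [cos_pi_div_three] at this
      have := cos_le_one (2 * k * (p - q))
      simp only [hW]; linarith
    rw [ii_smul, ii_smul] at l1 l2
    have e4 : - 2 * (exp (-2 * t) * P t) ≤
        ∫ p in x..y, (a.f t p) ^ 2 * (cos (2 * k * (p - q)) - W p / 4) := by
      simp only [hP]
      rw [← e3, ← e2]
      linarith
    have := mul_le_mul_of_nonneg_left e4 (by positivity : 0 ≤ (2 * k) ^ 2)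
    linarith
  -- time averages
  set I : (ℝ → ℝ) → ℝ → ℝ := fun f t => (∫ s in (0:ℝ)..(t + 1), f s) - ∫ s in (0:ℝ)..t, f s with hI
  have hIe : ∀ {f : ℝ → ℝ}, Continuous f → ∀ t, I f t = ∫ s in t..(t + 1), f s := fun hf t =>
    intervalIntegral.integral_interval_sub_left (hf.intervalIntegrable _ _)
      (hf.intervalIntegrable _ _)
  have hId : ∀ {f : ℝ → ℝ}, Continuous f → ∀ t, HasDerivAt (I f) (f (t + 1) - f t) t := fun hf t =>
    ((Continuous.integral_hasStrictDerivAt hf _ (t + 1)).hasDerivAt.comp_add_const t 1).sub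
      (Continuous.integral_hasStrictDerivAt hf _ t).hasDerivAt
  set M := I m with hM
  have hMd : ∀ t, HasDerivAt M (m (t + 1) - m t) t := hId cm
  have hMdd : ∀ t, HasDerivAt (fun t => m (t + 1) - m t) (m1 (t + 1) - m1 t) t := fun t =>
    ((dm (t + 1)).comp_add_const t 1).sub (dm t)
  have hm1I : ∀ t, m1 (t + 1) - m1 t = ∫ s in t..(t + 1), m2 s := fun t =>
    (intervalIntegral.integral_eq_sub_of_hasDerivAt (fun s _ => dm1 s)
      (cm2.intervalIntegrable _ _)).symm
  set A := 16 * k ^ 2 * C / (k ^ 2 - 4) with hA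
  have hk2 : 2 < k := by linarith
  have hk4 : 0 < k ^ 2 - 4 := by nlinarith
  have hPint : ∀ᶠ T in atTop, ∫ t in T..(T + 1), P t ≤ 2 * C := by
    filter_upwards [hL, hR] with T h1 h2
    have e1 : ∫ t in T..(T + 1), P t ≤ ∫ t in T..(T + 3), P t := by
      apply intervalIntegral.integral_mono_interval le_rfl (by linarith) (by linarith)
      · exact Eventually.of_forall hP0
      · exact cP.intervalIntegrable _ _
    have e2 : ∫ t in T..(T + 3), P t = _ := ii_add cPl cPr
    linarith
  obtain ⟨T0, hT0⟩ := eventually_atTop.1 hPint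
  have hC0 : 0 ≤ C := by
    have := hT0 T0 le_rfl
    have : 0 ≤ ∫ t in T0..(T0 + 1), P t := intervalIntegral.integral_nonneg (by linarith)
      fun t _ => hP0 t
    linarith
  have hA0 : 0 ≤ A := by positivity
  have hMconv : ∀ t, T0 ≤ t → k ^ 2 * M t - 16 * k ^ 2 * C * exp (- 2 * t) ≤ m1 (t + 1) - m1 t := by
    intro t ht
    rw [hm1I, hM, hIe cm]
    have e1 : ∫ s in t..(t + 1), (k ^ 2 * m s - 8 * k ^ 2 * exp (- 2 * t) * P s) ≤
        ∫ s in t..(t + 1), m2 s := by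
      apply ii_mono (by linarith) (by fun_prop) cm2
      intro s hs
      refine le_trans ?_ (hconv s)
      have : exp (-2 * s) * P s ≤ exp (-2 * t) * P s :=
        mul_le_mul_of_nonneg_right (exp_le_exp.2 (by linarith [hs.1])) (hP0 s)
      have := mul_le_mul_of_nonneg_left this (by positivity : 0 ≤ 8 * k ^ 2)
      linarith
    rw [ii_sub (by fun_prop) (by fun_prop), ii_smul, ii_smul] at e1
    have e2 := mul_le_mul_of_nonneg_left (hT0 t ht)
      (by positivity : 0 ≤ 8 * k ^ 2 * exp (- 2 * t))
    linarith
  -- growth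
  have hmH : ∀ t, 0 ≤ t → m t ≤ 2 * H a b 0 * exp (2 * β * t) := by
    intro t ht
    have e1 : m t ≤ 2 * H a b t := by
      have : m t ≤ ∫ p in x..y, 2 * ((a.f t p) ^ 2 + (b.f t p) ^ 2) := by
        apply ii_mono hxy (by fun_prop) (by fun_prop)
        intro p _
        have : W p ≤ 2 := by have := cos_le_one (2 * k * (p - q)); simp only [hW]; linarith
        have := mul_le_mul_of_nonneg_left this (sq_nonneg (a.f t p))
        linarith [sq_nonneg (b.f t p)]
      rw [ii_smul] at this
      have := arc_H (a := a) (b := b) hxy hxy2 t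
      linarith
    have e2 := H_le h ht (hβ t)
    rw [sub_zero] at e2
    linarith
  have hMg : ∀ t, 0 ≤ t → M t ≤ 2 * H a b 0 * exp (2 * β) * exp (2 * β * t) := by
    intro t ht
    rw [hM, hIe cm]
    have e1 : ∫ s in t..(t + 1), m s ≤ ∫ s in t..(t + 1), 2 * H a b 0 * exp (2 * β) * exp (2 * β * t) := by
      apply ii_mono (by linarith) cm (by fun_prop)
      intro s hs
      refine (hmH s (by linarith [hs.1])).trans ?_
      rw [mul_assoc (2 * H a b 0), ← exp_add]
      have := H_pos (a := a) (b := b) 0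
      gcongr
      have := mul_le_mul_of_nonneg_left hs.2 hβ0
      linarith
    simpa using e1
  have hdE : ∀ t, HasDerivAt (fun t => A * exp (- 2 * t)) (- 2 * (A * exp (- 2 * t))) t := fun t => by
    have := (((hasDerivAt_id t).const_mul (-2)).exp).const_mul A
    refine this.congr_deriv ?_
    simp; ring
  set T1 := max T0 0 with hT1
  have hdec := ode_decay (Z := fun t => M t - A * exp (- 2 * t))
    (Z1 := fun t => (m (t + 1) - m t) - (- 2 * (A * exp (- 2 * t))))
    (Z2 := fun t => (m1 (t + 1) - m1 t) - (- 2 * (- 2 * (A * exp (- 2 * t)))))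
    (fun t => (hMd t).sub (hdE t)) (fun t => (hMdd t).sub ((hdE t).const_mul (-2)))
    (T0 := T1) (γ := 2 * β) (C := 2 * H a b 0 * exp (2 * β)) hk0 (by linarith)
    (fun t ht => by
      have e1 := hMconv t ((le_max_left _ _).trans ht)
      have e2 : 16 * k ^ 2 * C * exp (- 2 * t) = (k ^ 2 - 4) * (A * exp (- 2 * t)) := by
        rw [hA]; field_simp
      rw [e2] at e1
      linarith)
    (fun t ht => by
      have e1 := hMg t ((le_max_right _ _).trans ht)
      have : 0 ≤ A * exp (- 2 * t) := by positivity
      linarith)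
  set B := |M T1 - A * exp (- 2 * T1)| * exp (2 * T1) + A with hB
  have hB0 : 0 ≤ B := by positivity
  have hMb : ∀ t, T1 ≤ t → M t ≤ B * exp (- 2 * t) := by
    intro t ht
    have e1 := hdec t ht
    have e2 : (M T1 - A * exp (- 2 * T1)) * exp (- k * (t - T1)) ≤
        |M T1 - A * exp (- 2 * T1)| * exp (- 2 * (t - T1)) := by
      refine (mul_le_mul_of_nonneg_right (le_abs_self _) (exp_pos _).le).trans ?_
      gcongr
    have e3 : exp (- 2 * (t - T1)) = exp (2 * T1) * exp (- 2 * t) := by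
      rw [← exp_add]; congr 1; ring
    rw [e3] at e2
    rw [hB]
    linarith
  refine ⟨3 * (exp 2 * B), ?_⟩
  set R : ℝ → ℝ := fun t => ∫ p in (q - η)..(q + η), exp (2 * t) * (a.f t p) ^ 2 with hR
  have cR : Continuous R :=
    continuous_param (F := fun t p => exp (2 * t) * (a.f t p) ^ 2) _ _ (by fun_prop)
  have hRm : ∀ t, R t ≤ exp (2 * t) * m t := by
    intro t
    simp only [hR, hm]
    rw [ii_smul]
    gcongr
    have e1 : ∫ p in (q - η)..(q + η), (a.f t p) ^ 2 ≤ ∫ p in (q - η)..(q + η), (a.f t p) ^ 2 * W p := by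
      apply ii_mono (by linarith) (by fun_prop) (by fun_prop)
      intro p hp
      have : cos (π / 3) ≤ cos (2 * k * (p - q)) := by
        rw [← cos_abs (2 * k * (p - q))]
        apply cos_le_cos_of_nonneg_of_le_pi (abs_nonneg _) (by linarith)
        rw [abs_mul, abs_of_pos (by positivity)]
        have : |p - q| ≤ η := abs_le.2 ⟨by linarith [hp.1], by linarith [hp.2]⟩
        calc 2 * k * |p - q| ≤ 2 * k * η := by gcongr
          _ = π / 3 := by rw [← hkη]; ring
      rw [cos_pi_div_three] at this
      have : 1 ≤ W p := by simp only [hW]; linarith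
      have := mul_le_mul_of_nonneg_left this (sq_nonneg (a.f t p))
      linarith
    refine e1.trans ?_
    apply intervalIntegral.integral_mono_interval (by rw [hx]; linarith) (by linarith)
      (by rw [hy]; linarith)
    · exact Eventually.of_forall fun p => mul_nonneg (sq_nonneg _) (hW0 p)
    · exact Continuous.intervalIntegrable (by fun_prop) _ _
  have hR1 : ∀ t, T1 ≤ t → ∫ s in t..(t + 1), R s ≤ exp 2 * B := by
    intro t ht
    have e1 : ∫ s in t..(t + 1), R s ≤ ∫ s in t..(t + 1), exp (2 * (t + 1)) * m s := by
      apply ii_mono (by linarith) cR (by fun_prop)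
      intro s hs
      refine (hRm s).trans (mul_le_mul_of_nonneg_right (exp_le_exp.2 (by linarith [hs.2])) (hm0 s))
    rw [ii_smul, ← hIe cm, ← hM] at e1
    refine e1.trans ((mul_le_mul_of_nonneg_left (hMb t ht) (exp_pos _).le).trans (le_of_eq ?_))
    have : exp (2 * (t + 1)) * exp (- 2 * t) = exp 2 := by rw [← exp_add]; congr 1; ring
    rw [← this]; ring
  filter_upwards [eventually_ge_atTop T1] with T hT
  have i1 := intervalIntegral.integral_add_adjacent_intervals (μ := volume)
    (cR.intervalIntegrable T (T + 1)) (cR.intervalIntegrable (T + 1) (T + 1 + 1))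
  have i2 := intervalIntegral.integral_add_adjacent_intervals (μ := volume)
    (cR.intervalIntegrable T (T + 1 + 1)) (cR.intervalIntegrable (T + 1 + 1) (T + 1 + 1 + 1))
  have j1 := hR1 T hT
  have j2 := hR1 (T + 1) (by linarith)
  have j3 := hR1 (T + 1 + 1) (by linarith)
  have e : T + 1 + 1 + 1 = T + 3 := by ring
  rw [e] at i2 j3
  change ∫ t in T..(T + 3), R t ≤ _
  linarith

end HM

namespace HM
open Real Set Filter Topology
variable {a b : Fn}

/-- Angular reflection. -/
def Fn.refl (a : Fn) : Fn where
  f t p := a.f t (-p)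
  ft t p := a.ft t (-p)
  fp t p := - a.fp t (-p)
  ftt t p := a.ftt t (-p)
  ftp t p := - a.ftp t (-p)
  fpp t p := a.fpp t (-p)
  cf := by fun_prop
  cft := by fun_prop
  cfp := by fun_prop
  cftt := by fun_prop
  cftp := by fun_prop
  cfpp := by fun_prop
  dt t p := a.dt t (-p)
  dp t p := by
    have := HasDerivAt.comp p (a.dp t (-p)) (hasDerivAt_neg p)
    exact this.congr_deriv (by ring)
  dtt t p := a.dtt t (-p)
  dpt t p := (a.dpt t (-p)).neg
  dtp t p := by
    have := HasDerivAt.comp p (a.dtp t (-p)) (hasDerivAt_neg p)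
    exact this.congr_deriv (by ring)
  dpp t p := by
    have := (HasDerivAt.comp p (a.dpp t (-p)) (hasDerivAt_neg p)).neg
    exact this.congr_deriv (by ring)
  per t p := by rw [← a.per t (-(p + 2 * π))]; congr 1; ring
  pert t p := by rw [← a.pert t (-(p + 2 * π))]; congr 1; ring
  perp t p := by rw [← a.perp t (-(p + 2 * π))]; congr 2; ring
  pos t p := a.pos t (-p)

lemma Sys.refl (h : Sys a b) : Sys a.refl b.refl := by
  obtain ⟨C, hC⟩ := h.bdd
  obtain ⟨C', β, hC'⟩ := h.growth
  refine ⟨fun t p => h.eqa t (-p), fun t p => h.eqb t (-p), ⟨C, fun t ht p => ?_⟩,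
    ⟨C', β, fun t ht p => hC' t ht (-p)⟩⟩
  obtain ⟨h1, h2, h3, h4, h5, h6⟩ := hC t ht (-p)
  refine ⟨h1, h2, h3, h4, ?_, ?_⟩
  · change |- a.fp t (-p)| ≤ _; rwa [abs_neg]
  · change |- b.fp t (-p)| ≤ _; rwa [abs_neg]

lemma H_refl (t : ℝ) : H a.refl b.refl t = H a b t := by
  have := intervalIntegral.integral_comp_neg (a := -π) (b := π)
    (f := fun p => (a.f t p) ^ 2 + (b.f t p) ^ 2)
  rw [neg_neg] at this
  exact this
lemma D_refl (t : ℝ) : D a.refl b.refl t = D a b t := by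
  have := intervalIntegral.integral_comp_neg (a := -π) (b := π)
    (f := fun p => a.f t p * a.ft t p + b.f t p * b.ft t p)
  rw [neg_neg] at this
  exact this
lemma Nf_refl : Nf a.refl b.refl = Nf a b := by
  ext t; unfold Nf; rw [H_refl, D_refl]

noncomputable section
/-- weighted mass in a window -/
def E (a : Fn) (x y T : ℝ) : ℝ := ∫ t in T..(T + 3), ∫ p in x..y, exp (2 * t) * (a.f t p) ^ 2
end

lemma E_add (x y z T : ℝ) : E a x y T + E a y z T = E a x z T := by
  unfold E
  rw [← ii_add (continuous_param (F := fun t p => exp (2 * t) * (a.f t p) ^ 2) x y (by fun_prop))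
    (continuous_param (F := fun t p => exp (2 * t) * (a.f t p) ^ 2) y z (by fun_prop))]
  congr 1; ext t
  exact intervalIntegral.integral_add_adjacent_intervals
    (Continuous.intervalIntegrable (by fun_prop) _ _) (Continuous.intervalIntegrable (by fun_prop) _ _)
lemma E_refl (x y T : ℝ) : E a.refl x y T = E a (-y) (-x) T := by
  unfold E
  congr 1; ext t
  exact intervalIntegral.integral_comp_neg (a := x) (b := y)
    (f := fun p => exp (2 * t) * (a.f t p) ^ 2)
lemma E_shift (x y T : ℝ) : E a (x + 2 * π) (y + 2 * π) T = E a x y T := by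
  unfold E
  congr 1; ext t
  have := intervalIntegral.integral_comp_add_right (a := x) (b := y)
    (fun p => exp (2 * t) * (a.f t p) ^ 2) (2 * π)
  rw [← this]
  congr 1; ext p; rw [a.per]

lemma sin_arc_pos {x y p : ℝ} (h1 : x < p) (h2 : p < y) : 0 < sin (π / (y - x) * (p - x)) := by
  have hpi := pi_pos
  have hl : 0 < y - x := by linarith
  apply sin_pos_of_pos_of_lt_pi (by have := sub_pos.2 h1; positivity)
  rw [div_mul_eq_mul_div, div_lt_iff₀ hl]
  exact mul_lt_mul_of_pos_left (by linarith) hpi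
lemma sin_arc_nonneg {x y p : ℝ} (hxy : x < y) (h1 : x ≤ p) (h2 : p ≤ y) :
    0 ≤ sin (π / (y - x) * (p - x)) := by
  have hpi := pi_pos
  have hl : 0 < y - x := by linarith
  apply sin_nonneg_of_nonneg_of_le_pi (by have := sub_nonneg.2 h1; positivity)
  rw [div_mul_eq_mul_div, div_le_iff₀ hl]
  exact mul_le_mul_of_nonneg_left (by linarith) hpi.le

lemma mu_of_pt {x y x' y' c : ℝ} (h1 : x ≤ x') (h2 : x' < y') (h3 : y' ≤ y) (hc : 0 < c) :
    ∃ c' > 0, ∀ T, (∀ φ ∈ Icc x' y', c * √(H a b T) ≤ a.f T φ) →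
      c' ≤ mu a b x y (fun p => sin (π / (y - x) * (p - x))) T := by
  have hxy : x < y := by linarith
  have hpos : 0 < ∫ p in x'..y', sin (π / (y - x) * (p - x)) := by
    apply intervalIntegral.intervalIntegral_pos_of_pos_on
      (Continuous.intervalIntegrable (by fun_prop) _ _) _ h2
    intro p hp
    exact sin_arc_pos (by linarith [hp.1]) (by linarith [hp.2])
  refine ⟨c * ∫ p in x'..y', sin (π / (y - x) * (p - x)), by positivity, fun T hT => ?_⟩
  have hs := Real.sqrt_pos.2 (H_pos (a := a) (b := b) T)
  unfold mu
  rw [le_div_iff₀ hs]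
  have e1 : ∫ p in x'..y', (c * √(H a b T)) * sin (π / (y - x) * (p - x)) ≤
      ∫ p in x'..y', a.f T p * sin (π / (y - x) * (p - x)) := by
    apply ii_mono h2.le (by fun_prop) (by fun_prop)
    intro p hp
    exact mul_le_mul_of_nonneg_right (hT p hp)
      (sin_arc_nonneg hxy (by linarith [hp.1]) (by linarith [hp.2]))
  rw [ii_smul] at e1
  have e2 : ∫ p in x'..y', a.f T p * sin (π / (y - x) * (p - x)) ≤
      ∫ p in x..y, a.f T p * sin (π / (y - x) * (p - x)) := by
    apply intervalIntegral.integral_mono_interval h1 h2.le h3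
    · refine (ae_restrict_mem measurableSet_Ioc).mono fun p hp => ?_
      exact mul_nonneg (a.pos T p).le (sin_arc_nonneg hxy hp.1.le hp.2)
    · exact Continuous.intervalIntegrable (by fun_prop) _ _
  linarith

lemma step1 {d x y z c : ℝ} (h : Sys a b) (hm : Mono a) (hd : Tendsto (Nf a b) atTop (𝓝 d))
    (hx : 0 < x) (hxy : x < y) (hyz : y < z) (hz : z < π) (hl : π / (z - y) < d) (hc : 0 < c) :
    ∀ᶠ T in atTop, ms a b x y T < c := by
  obtain ⟨c', hc', C, hup⟩ := up h hm hd hx hxy hyz.le hz hc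
  obtain ⟨c2, hc2, hmu⟩ := mu_of_pt (a := a) (b := b) le_rfl hyz le_rfl hc'
  have := pi_pos
  filter_upwards [hup, eigen h hd hyz (by linarith) hl hc2 C] with T h1 h2
  by_contra! h3
  obtain ⟨h4, h5⟩ := h1 h3
  exact h2 h5 (hmu T h4)

/-- The bottom channel. -/
lemma bottom {d η c c' : ℝ} (h : Sys a b) (hm : Mono a) (hm' : Mono a.refl)
    (hd : Tendsto (Nf a b) atTop (𝓝 d)) {β : ℝ}
    (hβ : ∀ t, Nf a b t ≤ β) (hβ0 : 0 ≤ β) (hη2 : 2 * β + 2 < π / (6 * η))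
    (hη : 0 < η) (hη1 : 4 * η < π) (hc : 0 < c) (hc' : 0 < c')
    (h3 : ∀ᶠ T in atTop, c ≤ ms b a (3 * η) (4 * η) T)
    (h3' : ∀ᶠ T in atTop, c' ≤ ms b.refl a.refl (3 * η) (4 * η) T) :
    ∃ C, ∀ᶠ T in atTop, E a (-η) η T ≤ C := by
  have hd' : Tendsto (Nf a.refl b.refl) atTop (𝓝 d) := by rwa [Nf_refl]
  have hpi := pi_pos
  obtain ⟨C1, h1⟩ := dn h hm hd hη (by linarith : η ≤ 3 * η) (by linarith : 3 * η < 4 * η) hη1 hc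
  obtain ⟨C2, h2⟩ := dn h.refl hm' hd' hη (by linarith : η ≤ 3 * η) (by linarith : 3 * η < 4 * η)
    hη1 hc'
  obtain ⟨C3, hC3⟩ := channel h (q := 0) (C := max C1 C2) hη (by linarith) hβ hβ0 hη2
    (by
      filter_upwards [h2, h3'] with T k1 k2
      have k3 := k1 k2
      change E a.refl η (3 * η) T ≤ C2 at k3
      rw [E_refl] at k3
      change E a (0 - 3 * η) (0 - η) T ≤ _
      rw [zero_sub, zero_sub]
      exact k3.trans (le_max_right _ _))
    (by
      filter_upwards [h1, h3] with T k1 k2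
      have k3 := k1 k2
      change E a η (3 * η) T ≤ C1 at k3
      change E a (0 + η) (0 + 3 * η) T ≤ _
      rw [zero_add, zero_add]
      exact k3.trans (le_max_left _ _))
  refine ⟨C3, hC3.mono fun T hT => ?_⟩
  change E a (0 - η) (0 + η) T ≤ C3 at hT
  rwa [zero_sub, zero_add] at hT

/-- Two `b` cells cannot be too far apart. -/
lemma sepB {d η c c' c1 x y x' y' C : ℝ} (h : Sys a b) (hm : Mono a) (hm' : Mono a.refl)
    (hd : Tendsto (Nf a b) atTop (𝓝 d)) (hη : 0 < η)
    (hc : 0 < c) (hc' : 0 < c') (hc1 : 0 < c1)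
    (hC : ∀ᶠ T in atTop, E a (-η) η T ≤ C) (hx : 2 * η < x) (hxy : x < y) (hy : y < π)
    (hx' : η ≤ x') (hxy' : x' < y') (hy' : y' < π) (hl : π / (x + x') < d)
    (h1 : ∀ᶠ T in atTop, c1 ≤ ms b a η (2 * η) T) :
    ∀ᶠ T in atTop, ¬ (c ≤ ms b a x y T ∧ c' ≤ ms b.refl a.refl x' y' T) := by
  have hd' : Tendsto (Nf a.refl b.refl) atTop (𝓝 d) := by rwa [Nf_refl]
  have hds : Tendsto (Nf b a) atTop (𝓝 d) := by rwa [Nf_comm]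
  have hpi := pi_pos
  obtain ⟨C1, k1⟩ := dn h hm hd hη (by linarith : η ≤ x) hxy hy hc
  obtain ⟨C2, k2⟩ := dn h.refl hm' hd' hη hx' hxy' hy' hc'
  obtain ⟨c2, hc2, k3⟩ := mu_of_ms h.symm hds (by linarith : -x' < η) (by linarith : η < 2 * η) hx
    (by linarith) hc1
  have k4 := eigen h.symm hds (by linarith : -x' < x) (by linarith)
    (by rwa [sub_neg_eq_add]) hc2 (C2 + C + C1)
  filter_upwards [k1, k2, k3, k4, hC, h1] with T e1 e2 e3 e4 e5 e6
  rintro ⟨e7, e8⟩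
  have f1 := e1 e7
  have f2 := e2 e8
  change E a η x T ≤ C1 at f1
  change E a.refl η x' T ≤ C2 at f2
  rw [E_refl] at f2
  refine e4 ?_ (e3 e6)
  change E a (-x') x T ≤ _
  rw [← E_add (-x') η x, ← E_add (-x') (-η) η]
  linarith

/-- The top channel. -/
lemma top {d η c c' : ℝ} (h : Sys a b) (hm : Mono a) (hm' : Mono a.refl)
    (hd : Tendsto (Nf a b) atTop (𝓝 d)) {β : ℝ}
    (hβ : ∀ t, Nf a b t ≤ β) (hβ0 : 0 ≤ β) (hη2 : 2 * β + 2 < π / (6 * η))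
    (hη : 0 < η) (hη1 : 4 * η < π) (hc : 0 < c) (hc' : 0 < c')
    (h3 : ∀ᶠ T in atTop, c ≤ ms a b (π - 4 * η) (π - 3 * η) T)
    (h3' : ∀ᶠ T in atTop, c' ≤ ms a.refl b.refl (π - 4 * η) (π - 3 * η) T) :
    ∃ C, ∀ᶠ T in atTop, E b (π - η) (π + η) T ≤ C := by
  have hd' : Tendsto (Nf a.refl b.refl) atTop (𝓝 d) := by rwa [Nf_refl]
  have hpi := pi_pos
  obtain ⟨_, _, C1, h1⟩ := up h hm hd (by linarith : 0 < π - 4 * η)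
    (by linarith : π - 4 * η < π - 3 * η) (by linarith : π - 3 * η ≤ π - η) (by linarith) hc
  obtain ⟨_, _, C2, h2⟩ := up h.refl hm' hd' (by linarith : 0 < π - 4 * η)
    (by linarith : π - 4 * η < π - 3 * η) (by linarith : π - 3 * η ≤ π - η) (by linarith) hc'
  obtain ⟨C3, hC3⟩ := channel h.symm (q := π) (C := max C1 C2) hη (by linarith)
    (by rwa [Nf_comm]) hβ0 hη2
    (by
      filter_upwards [h1, h3] with T k1 k2
      exact (k1 k2).2.trans (le_max_left _ _))
    (by
      filter_upwards [h2, h3'] with T k1 k2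
      have k3 := (k1 k2).2
      change E b.refl (π - 3 * η) (π - η) T ≤ C2 at k3
      rw [E_refl, ← E_shift] at k3
      change E b (π + η) (π + 3 * η) T ≤ _
      have i1 : -(π - η) + 2 * π = π + η := by ring
      have i2 : -(π - 3 * η) + 2 * π = π + 3 * η := by ring
      rw [i1, i2] at k3
      exact k3.trans (le_max_right _ _))
  exact ⟨C3, hC3⟩

/-- Two `a` cells cannot be too far apart through the top. -/
lemma sepA {d η c c' x y x' y' C : ℝ} (h : Sys a b) (hm : Mono a) (hm' : Mono a.refl)
    (hd : Tendsto (Nf a b) atTop (𝓝 d)) (hη : 0 < η)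
    (hc : 0 < c) (hc' : 0 < c')
    (hC : ∀ᶠ T in atTop, E b (π - η) (π + η) T ≤ C) (hx : 0 < x) (hxy : x < y) (hy : y < π - η)
    (hx' : 0 < x') (hxy' : x' < y') (hy' : y' < π - η) (hl : π / (2 * π - y - y') < d) :
    ∀ᶠ T in atTop, ¬ (c ≤ ms a b x y T ∧ c' ≤ ms a.refl b.refl x' y' T) := by
  have hd' : Tendsto (Nf a.refl b.refl) atTop (𝓝 d) := by rwa [Nf_refl]
  have hpi := pi_pos
  obtain ⟨c3, hc3, C1, k1⟩ := up h hm hd hx hxy hy.le (by linarith) hc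
  obtain ⟨_, _, C2, k2⟩ := up h.refl hm' hd' hx' hxy' hy'.le (by linarith) hc'
  obtain ⟨c2, hc2, k3⟩ := mu_of_pt (a := a) (b := b) (le_refl y) hy
    (by linarith : π - η ≤ 2 * π - y') hc3
  have k4 := eigen h hd (by linarith : y < 2 * π - y') (by linarith)
    (by rwa [show 2 * π - y' - y = 2 * π - y - y' by ring]) hc2 (C1 + C + C2)
  filter_upwards [k1, k2, k4, hC] with T e1 e2 e4 e5
  rintro ⟨e7, e8⟩
  obtain ⟨f0, f1⟩ := e1 e7
  have f2 := (e2 e8).2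
  change E b y (π - η) T ≤ C1 at f1
  change E b.refl y' (π - η) T ≤ C2 at f2
  rw [E_refl, ← E_shift] at f2
  have i1 : -(π - η) + 2 * π = π + η := by ring
  have i2 : -y' + 2 * π = 2 * π - y' := by ring
  rw [i1, i2] at f2
  refine e4 ?_ (k3 T f0)
  change E b y (2 * π - y') T ≤ _
  rw [← E_add y (π + η) _, ← E_add y (π - η) (π + η)]
  linarith

end HM

namespace HM
open Real Set Filter Topology
variable {a b : Fn}

lemma refl_refl (a : Fn) : a.refl.refl = a := by
  cases a; simp [Fn.refl]

lemma cells {d η : ℝ} (h : Sys a b) (hd : Tendsto (Nf a b) atTop (𝓝 d)) (hd0 : 0 < d)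
    (hη : 0 < η) (hη1 : η ≤ 2 * π) : ∃ c : ℕ → ℝ, (∀ j, 0 < c j) ∧ ∀ j : ℕ, ∀ᶠ T in atTop,
      c j ≤ ms a b (j * η) ((j + 1) * η) T ∨ c j ≤ ms b a (j * η) ((j + 1) * η) T := by
  have : ∀ j : ℕ, ∃ c > 0, ∀ᶠ T in atTop,
      c ≤ ms a b (j * η) ((j + 1) * η) T + ms b a (j * η) ((j + 1) * η) T := fun j =>
    no_gap h hd hd0 (by linarith) (by linarith)
  choose c hc hc2 using this
  refine ⟨fun j => c j / 2, fun j => half_pos (hc j), fun j => (hc2 j).mono fun T hT => ?_⟩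
  by_contra! hcon
  linarith [hcon.1, hcon.2]

set_option maxHeartbeats 1000000 in
theorem d_le_one {d : ℝ} (h : Sys a b) (hm : Mono a) (hm' : Mono a.refl)
    (hd : Tendsto (Nf a b) atTop (𝓝 d)) (hN : ∀ t, Nf a b t ≤ d) : d ≤ 1 := by
  by_contra! hd1
  have hd0 : 0 < d := by linarith
  have hpi := pi_pos
  have hd' : Tendsto (Nf a.refl b.refl) atTop (𝓝 d) := by rwa [Nf_refl]
  have hdi : 0 < 1 - 1 / d := by rw [sub_pos, div_lt_one hd0]; exact hd1
  obtain ⟨m, hmn⟩ := exists_nat_gt (max (max 9 (5 / (1 - 1 / d))) (12 * d + 12))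
  have hm1 : (9:ℝ) < m := (le_max_left _ _).trans_lt ((le_max_left _ _).trans_lt hmn)
  have hm2 : 5 / (1 - 1 / d) < m := (le_max_right _ _).trans_lt ((le_max_left _ _).trans_lt hmn)
  have hm3 : 12 * d + 12 < m := (le_max_right _ _).trans_lt hmn
  have hm9 : 9 < m := by exact_mod_cast hm1
  rw [div_lt_iff₀ hdi] at hm2
  obtain ⟨η, hη, hnη⟩ : ∃ η : ℝ, 0 < η ∧ (m + 4) * η = π :=
    ⟨π / (m + 4), by positivity, by field_simp⟩
  obtain ⟨δ, hδ⟩ : ∃ δ : ℝ, δ = π / d := ⟨_, rfl⟩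
  have hlt : ∀ L, δ < L → π / L < d := by
    intro L hL
    have hδ0 : 0 < δ := by rw [hδ]; positivity
    rw [hδ, div_lt_iff₀ hd0] at hL
    rw [div_lt_iff₀ (by rw [hδ] at hδ0; by_contra! hh; nlinarith)]
    linarith
  have h5 : 5 * η < π - δ := by
    have e1 : π - δ = (m + 4) * η * (1 - 1 / d) := by rw [hδ, hnη]; ring
    rw [e1]
    have e2 := mul_lt_mul_of_pos_right hm2 hη
    have e3 := mul_pos (mul_pos (by norm_num : (0:ℝ) < 4) hη) hdi
    linarith
  have hη2 : 2 * d + 2 < π / (6 * η) := by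
    rw [lt_div_iff₀ (by positivity), ← hnη]
    have e2 := mul_lt_mul_of_pos_right hm3 hη
    linarith
  have hmη : 9 * η < m * η := mul_lt_mul_of_pos_right hm1 hη
  have hη4 : 4 * η < π := by linarith
  obtain ⟨c, hc, hcc⟩ := cells h hd hd0 hη (by linarith)
  obtain ⟨c', hc', hcc'⟩ := cells h.refl hd' hd0 hη (by linarith)
  have s1 : ∀ j : ℕ, 1 ≤ j → j ≤ 3 → ∀ᶠ T in atTop, ms a b (j * η) ((j + 1) * η) T < c j := by
    intro j j1 j3
    have j1' : (1:ℝ) ≤ j := by exact_mod_cast j1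
    have j3' : (j:ℝ) ≤ 3 := by exact_mod_cast j3
    have e1 := mul_le_mul_of_nonneg_right j1' hη.le
    have e2 := mul_le_mul_of_nonneg_right j3' hη.le
    exact step1 h hm hd (by linarith) (by linarith) (by linarith : (j + 1) * η < π - η)
      (by linarith) (hlt _ (by linarith)) (hc j)
  have s1' : ∀ j : ℕ, 1 ≤ j → j ≤ 3 → ∀ᶠ T in atTop,
      ms a.refl b.refl (j * η) ((j + 1) * η) T < c' j := by
    intro j j1 j3
    have j1' : (1:ℝ) ≤ j := by exact_mod_cast j1
    have j3' : (j:ℝ) ≤ 3 := by exact_mod_cast j3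
    have e1 := mul_le_mul_of_nonneg_right j1' hη.le
    have e2 := mul_le_mul_of_nonneg_right j3' hη.le
    exact step1 h.refl hm' hd' (by linarith) (by linarith) (by linarith : (j + 1) * η < π - η)
      (by linarith) (hlt _ (by linarith)) (hc' j)
  have bB : ∀ j : ℕ, 1 ≤ j → j ≤ 3 → ∀ᶠ T in atTop, c j ≤ ms b a (j * η) ((j + 1) * η) T := by
    intro j j1 j3
    filter_upwards [s1 j j1 j3, hcc j] with T e1 e2
    exact e2.resolve_left (not_le.2 e1)
  have bB' : ∀ j : ℕ, 1 ≤ j → j ≤ 3 → ∀ᶠ T in atTop,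
      c' j ≤ ms b.refl a.refl (j * η) ((j + 1) * η) T := by
    intro j j1 j3
    filter_upwards [s1' j j1 j3, hcc' j] with T e1 e2
    exact e2.resolve_left (not_le.2 e1)
  have B1 := bB 1 le_rfl (by norm_num)
  have B3 := bB 3 (by norm_num) le_rfl
  have B1' := bB' 1 le_rfl (by norm_num)
  have B3' := bB' 3 (by norm_num) le_rfl
  norm_num [-eventually_atTop] at B1 B3 B1' B3'
  obtain ⟨C, hC⟩ := bottom h hm hm' hd hN hd0.le hη2 hη hη4 (hc 3) (hc' 3) B3 B3'
  have hC' : ∀ᶠ T in atTop, E a.refl (-η) η T ≤ C := by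
    filter_upwards [hC] with T hT
    rwa [E_refl, neg_neg]
  have sB : ∀ j j' : ℕ, 3 ≤ j → 1 ≤ j' → j ≤ m → j' ≤ m → δ < (j + j') * η → ∀ᶠ T in atTop,
      ¬ (c j ≤ ms b a (j * η) ((j + 1) * η) T ∧
        c' j' ≤ ms b.refl a.refl (j' * η) ((j' + 1) * η) T) := by
    intro j j' h1 h2 h3 h4 h5
    have k1 : (3:ℝ) ≤ j := by exact_mod_cast h1
    have k2 : (1:ℝ) ≤ j' := by exact_mod_cast h2
    have k3 : (j:ℝ) ≤ m := by exact_mod_cast h3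
    have k4 : (j':ℝ) ≤ m := by exact_mod_cast h4
    have e1 := mul_le_mul_of_nonneg_right k1 hη.le
    have e2 := mul_le_mul_of_nonneg_right k2 hη.le
    have e3 := mul_le_mul_of_nonneg_right k3 hη.le
    have e4 := mul_le_mul_of_nonneg_right k4 hη.le
    exact sepB h hm hm' hd hη (hc j) (hc' j') (hc 1) hC (by linarith) (by linarith) (by linarith)
      (by linarith) (by linarith) (by linarith) (hlt _ (by linarith)) B1
  have sB' : ∀ᶠ T in atTop,
      ¬ (c' m ≤ ms b.refl a.refl (m * η) ((m + 1) * η) T ∧ c 1 ≤ ms b a η (2 * η) T) := by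
    have := sepB h.refl hm' (by rwa [refl_refl]) hd' hη (hc' m) (hc 1) (hc' 1) hC'
      (by linarith : 2 * η < m * η) (by linarith : m * η < (m + 1) * η) (by linarith)
      le_rfl (by linarith : η < 2 * η) (by linarith) (hlt _ (by linarith)) B1'
    rwa [refl_refl, refl_refl] at this
  have Am : ∀ᶠ T in atTop, c m ≤ ms a b (m * η) ((m + 1) * η) T := by
    have := sB m 1 (by omega) le_rfl le_rfl (by omega) (by push_cast; linarith)
    norm_num [-eventually_atTop] at this
    filter_upwards [this, B1', hcc m] with T e1 e2 e3
    refine e3.resolve_right fun e4 => ?_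
    exact absurd (e1 e4) (not_lt.2 e2)
  have Am' : ∀ᶠ T in atTop, c' m ≤ ms a.refl b.refl (m * η) ((m + 1) * η) T := by
    filter_upwards [sB', B1, hcc' m] with T e1 e2 e3
    exact e3.resolve_right fun e4 => e1 ⟨e4, e2⟩
  have i4 : π - 4 * η = m * η := by rw [← hnη]; ring
  have i3 : π - 3 * η = (m + 1) * η := by rw [← hnη]; ring
  obtain ⟨C2, hC2⟩ := top h hm hm' hd hN hd0.le hη2 hη hη4 (hc m) (hc' m)
    (by rwa [i4, i3]) (by rwa [i4, i3])
  have sA : ∀ j j' : ℕ, 1 ≤ j → 1 ≤ j' → j ≤ m → j' ≤ m → δ < 2 * π - (j + 1) * η - (j' + 1) * η →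
      ∀ᶠ T in atTop,
      ¬ (c j ≤ ms a b (j * η) ((j + 1) * η) T ∧
        c' j' ≤ ms a.refl b.refl (j' * η) ((j' + 1) * η) T) := by
    intro j j' h1 h2 h3 h4 h5
    have k1 : (1:ℝ) ≤ j := by exact_mod_cast h1
    have k2 : (1:ℝ) ≤ j' := by exact_mod_cast h2
    have k3 : (j:ℝ) ≤ m := by exact_mod_cast h3
    have k4 : (j':ℝ) ≤ m := by exact_mod_cast h4
    have e1 := mul_le_mul_of_nonneg_right k1 hη.le
    have e2 := mul_le_mul_of_nonneg_right k2 hη.le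
    have e3 := mul_le_mul_of_nonneg_right k3 hη.le
    have e4 := mul_le_mul_of_nonneg_right k4 hη.le
    exact sepA h hm hm' hd hη (hc j) (hc' j') hC2 (by linarith) (by linarith) (by linarith)
      (by linarith) (by linarith) (by linarith) (hlt _ h5)
  -- finite intersections
  have fin2 : ∀ {P : ℕ → ℕ → Prop} {Q : ℕ → ℕ → ℝ → Prop},
      (∀ j j', j ≤ m → j' ≤ m → P j j' → ∀ᶠ T in atTop, Q j j' T) →
      ∀ᶠ T in atTop, ∀ j ∈ Finset.range (m + 1), ∀ j' ∈ Finset.range (m + 1), P j j' → Q j j' T := by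
    intro P Q hPQ
    refine (Filter.eventually_all_finset _).2 fun j hj => (Filter.eventually_all_finset _).2
      fun j' hj' => ?_
    by_cases hp : P j j'
    · filter_upwards [hPQ j j' (by simpa [Nat.lt_succ_iff] using hj)
        (by simpa [Nat.lt_succ_iff] using hj') hp] with T hT _ using hT
    · exact Eventually.of_forall fun T hp' => absurd hp' hp
  have fB := fin2 (P := fun j j' => 3 ≤ j ∧ 1 ≤ j' ∧ δ < (j + j') * η)
    fun j j' h3 h4 ⟨h1, h2, h5⟩ => sB j j' h1 h2 h3 h4 h5
  have fA := fin2 (P := fun j j' => 1 ≤ j ∧ 1 ≤ j' ∧ δ < 2 * π - (j + 1) * η - (j' + 1) * η)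
    fun j j' h3 h4 ⟨h1, h2, h5⟩ => sA j j' h1 h2 h3 h4 h5
  have fc := fin2 (P := fun _ _ => True) fun j _ _ _ _ => (hcc j).and (hcc' j)
  have f1 := fin2 (P := fun j _ => 1 ≤ j ∧ j ≤ 3) fun j _ _ _ hj =>
    (s1 j hj.1 hj.2).and (s1' j hj.1 hj.2)
  obtain ⟨T, gB, gA, gc, g1, gm, gm'⟩ := (fB.and (fA.and (fc.and (f1.and (Am.and Am'))))).exists
  classical
  have key : ∀ {A : ℕ → Prop}, A m → (∀ j, 1 ≤ j → j ≤ 3 → ¬ A j) →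
      ∃ j, 4 ≤ j ∧ j ≤ m ∧ A j ∧ ¬ A (j - 1) := by
    intro A hA hn
    have hex : ∃ j, 1 ≤ j ∧ A j := ⟨m, by omega, hA⟩
    obtain ⟨p1, p2⟩ := Nat.find_spec hex
    have p3 : Nat.find hex ≤ m := Nat.find_min' hex ⟨by omega, hA⟩
    have p4 : 4 ≤ Nat.find hex := by
      by_contra! hh
      exact hn _ p1 (by omega) p2
    refine ⟨Nat.find hex, p4, p3, p2, fun p5 => ?_⟩
    exact Nat.find_min hex (by omega : Nat.find hex - 1 < Nat.find hex) ⟨by omega, p5⟩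
  have mr : ∀ {j}, j ≤ m → j ∈ Finset.range (m + 1) := fun hj => Finset.mem_range.2 (by omega)
  obtain ⟨j, j4, jm, jA, jB⟩ := key (A := fun j => c j ≤ ms a b (j * η) ((j + 1) * η) T) gm
    fun j h1 h3 => not_le.2 (g1 j (mr (by omega)) 0 (mr (by omega)) ⟨h1, h3⟩).1
  obtain ⟨l, l4, lm, lA, lB⟩ := key
    (A := fun j => c' j ≤ ms a.refl b.refl (j * η) ((j + 1) * η) T) gm'
    fun j h1 h3 => not_le.2 (g1 j (mr (by omega)) 0 (mr (by omega)) ⟨h1, h3⟩).2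
  have jB' := (gc (j - 1) (mr (by omega)) 0 (mr (by omega)) trivial).1.resolve_left jB
  have lB' := (gc (l - 1) (mr (by omega)) 0 (mr (by omega)) trivial).2.resolve_left lB
  have q1 : ¬ (δ < ((j - 1 : ℕ) + (l - 1 : ℕ)) * η) := fun hh =>
    gB (j - 1) (mr (by omega)) (l - 1) (mr (by omega)) ⟨by omega, by omega, hh⟩ ⟨jB', lB'⟩
  have q2 : ¬ (δ < 2 * π - (j + 1) * η - (l + 1) * η) := fun hh =>
    gA j (mr jm) l (mr lm) ⟨by omega, by omega, hh⟩ ⟨jA, lA⟩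
  rw [Nat.cast_sub (by omega), Nat.cast_sub (by omega)] at q1
  push_cast at q1
  rw [not_lt] at q1 q2
  linarith

end HM

namespace HM
open Real Set Filter Topology

/-- the linear form with given coordinates -/
noncomputable def lf (x y : ℝ) : ℝ × ℝ →L[ℝ] ℝ :=
  x • ContinuousLinearMap.fst ℝ ℝ ℝ + y • ContinuousLinearMap.snd ℝ ℝ ℝ

lemma lf_apply (x y : ℝ) (q : ℝ × ℝ) : lf x y q = x * q.1 + y * q.2 := by simp [lf]

/-- `C²` function on the plane together with its derivatives. -/
structure Sm where
  f : ℝ × ℝ → ℝ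
  f1 : ℝ × ℝ → ℝ
  f2 : ℝ × ℝ → ℝ
  f11 : ℝ × ℝ → ℝ
  f12 : ℝ × ℝ → ℝ
  f22 : ℝ × ℝ → ℝ
  cf : Continuous f
  cf1 : Continuous f1
  cf2 : Continuous f2
  cf11 : Continuous f11
  cf12 : Continuous f12
  cf22 : Continuous f22
  df : ∀ q, HasFDerivAt f (lf (f1 q) (f2 q)) q
  df1 : ∀ q, HasFDerivAt f1 (lf (f11 q) (f12 q)) q
  df2 : ∀ q, HasFDerivAt f2 (lf (f12 q) (f22 q)) q

attribute [fun_prop] Sm.cf Sm.cf1 Sm.cf2 Sm.cf11 Sm.cf12 Sm.cf22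

structure Sol (u v : Sm) : Prop where
  equ : ∀ q, u.f11 q + u.f22 q = u.f q * (v.f q) ^ 2
  eqv : ∀ q, v.f11 q + v.f22 q = v.f q * (u.f q) ^ 2
  posu : ∀ q, 0 < u.f q
  posv : ∀ q, 0 < v.f q
  mon : ∀ q, 0 < u.f2 q
  growth : ∃ C α : ℝ, 0 ≤ C ∧ 0 ≤ α ∧ ∀ q : ℝ × ℝ,
    u.f q + v.f q ≤ C * (1 + √(q.1 ^ 2 + q.2 ^ 2)) ^ α

/-- log-polar point -/
noncomputable def lp (t p : ℝ) : ℝ × ℝ := (exp t * sin p, - (exp t * cos p))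

@[fun_prop] lemma lp_cont {X : Type*} [TopologicalSpace X] {g h : X → ℝ} (hg : Continuous g)
    (hh : Continuous h) : Continuous fun x => lp (g x) (h x) := by
  unfold lp; fun_prop

lemma lp_sq (t p : ℝ) : (lp t p).1 ^ 2 + (lp t p).2 ^ 2 = exp (2 * t) := by
  have : exp (2 * t) = exp t * exp t := by rw [← exp_add]; congr 1; ring
  simp only [lp]
  rw [this]
  linear_combination exp t ^ 2 * sin_sq_add_cos_sq p

lemma lp_per (t p : ℝ) : lp t (p + 2 * π) = lp t p := by simp [lp]

lemma comp_t {f : ℝ × ℝ → ℝ} {x y t p : ℝ} (hf : HasFDerivAt f (lf x y) (lp t p)) :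
    HasDerivAt (fun t => f (lp t p)) (x * (lp t p).1 + y * (lp t p).2) t := by
  have h1 : HasDerivAt (fun t => lp t p) (exp t * sin p, - (exp t * cos p)) t :=
    ((hasDerivAt_exp t).mul_const _).prodMk (((hasDerivAt_exp t).mul_const _).neg)
  exact (hf.comp_hasDerivAt t h1).congr_deriv (by rw [lf_apply]; rfl)

lemma comp_p {f : ℝ × ℝ → ℝ} {x y t p : ℝ} (hf : HasFDerivAt f (lf x y) (lp t p)) :
    HasDerivAt (fun p => f (lp t p)) (x * (- (lp t p).2) + y * (lp t p).1) p := by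
  have h1 : HasDerivAt (fun p => lp t p) (exp t * cos p, - (exp t * (- sin p))) p :=
    ((hasDerivAt_sin p).const_mul _).prodMk (((hasDerivAt_cos p).const_mul _).neg)
  exact (hf.comp_hasDerivAt p h1).congr_deriv (by rw [lf_apply]; simp [lp])

lemma lp1_t (t p : ℝ) : HasDerivAt (fun t => (lp t p).1) (lp t p).1 t :=
  ((hasDerivAt_exp t).mul_const _)
lemma lp2_t (t p : ℝ) : HasDerivAt (fun t => (lp t p).2) (lp t p).2 t :=
  ((hasDerivAt_exp t).mul_const _).neg
lemma lp1_p (t p : ℝ) : HasDerivAt (fun p => (lp t p).1) (- (lp t p).2) p :=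
  ((hasDerivAt_sin p).const_mul _).congr_deriv (by simp [lp])
lemma lp2_p (t p : ℝ) : HasDerivAt (fun p => (lp t p).2) ((lp t p).1) p :=
  (((hasDerivAt_cos p).const_mul _).neg).congr_deriv (by simp [lp])

/-- Log-polar form of a positive function. -/
noncomputable def Sm.toFn (u : Sm) (hu : ∀ q, 0 < u.f q) : Fn where
  f t p := u.f (lp t p)
  ft t p := u.f1 (lp t p) * (lp t p).1 + u.f2 (lp t p) * (lp t p).2
  fp t p := u.f1 (lp t p) * (- (lp t p).2) + u.f2 (lp t p) * (lp t p).1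
  ftt t p := (u.f11 (lp t p) * (lp t p).1 + u.f12 (lp t p) * (lp t p).2) * (lp t p).1
    + u.f1 (lp t p) * (lp t p).1
    + ((u.f12 (lp t p) * (lp t p).1 + u.f22 (lp t p) * (lp t p).2) * (lp t p).2
    + u.f2 (lp t p) * (lp t p).2)
  ftp t p := (u.f11 (lp t p) * (- (lp t p).2) + u.f12 (lp t p) * (lp t p).1) * (lp t p).1
    + u.f1 (lp t p) * (- (lp t p).2)
    + ((u.f12 (lp t p) * (- (lp t p).2) + u.f22 (lp t p) * (lp t p).1) * (lp t p).2
    + u.f2 (lp t p) * (lp t p).1)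
  fpp t p := (u.f11 (lp t p) * (- (lp t p).2) + u.f12 (lp t p) * (lp t p).1) * (- (lp t p).2)
    + u.f1 (lp t p) * (- (lp t p).1)
    + ((u.f12 (lp t p) * (- (lp t p).2) + u.f22 (lp t p) * (lp t p).1) * (lp t p).1
    + u.f2 (lp t p) * (- (lp t p).2))
  cf := by fun_prop
  cft := by fun_prop
  cfp := by fun_prop
  cftt := by fun_prop
  cftp := by fun_prop
  cfpp := by fun_prop
  dt t p := comp_t (u.df _)
  dp t p := comp_p (u.df _)
  dtt t p := ((comp_t (u.df1 _)).mul (lp1_t t p)).add ((comp_t (u.df2 _)).mul (lp2_t t p))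
  dpt t p := (((comp_t (u.df1 _)).mul (lp2_t t p).neg).add
    ((comp_t (u.df2 _)).mul (lp1_t t p))).congr_deriv (by simp only [Pi.neg_apply]; ring)
  dtp t p := ((comp_p (u.df1 _)).mul (lp1_p t p)).add ((comp_p (u.df2 _)).mul (lp2_p t p))
  dpp t p := ((comp_p (u.df1 _)).mul (lp2_p t p).neg).add ((comp_p (u.df2 _)).mul (lp1_p t p))
  per t p := by rw [lp_per]
  pert t p := by rw [lp_per]
  perp t p := by rw [lp_per]
  pos t p := hu _

lemma lp_abs (t p : ℝ) : |(lp t p).1| ≤ exp t ∧ |(lp t p).2| ≤ exp t := by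
  have h1 : |sin p| ≤ 1 := abs_sin_le_one p
  have h2 : |cos p| ≤ 1 := abs_cos_le_one p
  simp only [lp, abs_neg, abs_mul, abs_of_pos (exp_pos t)]
  exact ⟨mul_le_of_le_one_right (exp_pos t).le h1, mul_le_of_le_one_right (exp_pos t).le h2⟩

lemma lin_le {M x y e p q : ℝ} (h1 : |p| ≤ M) (h2 : |q| ≤ M) (hx : |x| ≤ e) (hy : |y| ≤ e)
    (hM : 0 ≤ M) : |p * x + q * y| ≤ 2 * M * e := by
  have e1 : |p * x| ≤ M * e := by rw [abs_mul]; gcongr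
  have e2 : |q * y| ≤ M * e := by rw [abs_mul]; gcongr
  have := abs_add_le (p * x) (q * y)
  linarith

theorem Sol.sys {u v : Sm} (h : Sol u v) : Sys (u.toFn h.posu) (v.toFn h.posv) := by
  refine ⟨fun t p => ?_, fun t p => ?_, ?_, ?_⟩
  · have e := h.equ (lp t p)
    have e2 := lp_sq t p
    simp only [Sm.toFn]
    linear_combination ((lp t p).1 ^ 2 + (lp t p).2 ^ 2) * e + (u.f (lp t p)) * (v.f (lp t p)) ^ 2 * e2
  · have e := h.eqv (lp t p)
    have e2 := lp_sq t p
    simp only [Sm.toFn]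
    linear_combination ((lp t p).1 ^ 2 + (lp t p).2 ^ 2) * e + (v.f (lp t p)) * (u.f (lp t p)) ^ 2 * e2
  · have hK : IsCompact (Icc (-1:ℝ) 1 ×ˢ Icc (-1:ℝ) 1) := isCompact_Icc.prod isCompact_Icc
    have hb : ∀ g : ℝ × ℝ → ℝ, Continuous g → ∃ M, 0 ≤ M ∧ ∀ t ≤ 0, ∀ p, |g (lp t p)| ≤ M := by
      intro g hg
      obtain ⟨M, hM⟩ := hK.exists_bound_of_continuousOn hg.continuousOn
      refine ⟨max M 0, le_max_right _ _, fun t ht p => (hM _ ?_).trans (le_max_left _ _)⟩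
      have h1 := lp_abs t p
      have h2 : exp t ≤ 1 := by rw [← exp_zero]; exact exp_le_exp.2 ht
      exact ⟨abs_le.1 (h1.1.trans h2), abs_le.1 (h1.2.trans h2)⟩
    obtain ⟨M1, p1, h1⟩ := hb _ u.cf
    obtain ⟨M2, p2, h2⟩ := hb _ v.cf
    obtain ⟨M3, p3, h3⟩ := hb _ u.cf1
    obtain ⟨M4, p4, h4⟩ := hb _ u.cf2
    obtain ⟨M5, p5, h5⟩ := hb _ v.cf1
    obtain ⟨M6, p6, h6⟩ := hb _ v.cf2
    set M := M1 + M2 + M3 + M4 + M5 + M6 with hM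
    have hM0 : 0 ≤ M := by positivity
    refine ⟨2 * M, fun t ht p => ?_⟩
    obtain ⟨q1, q2⟩ := lp_abs t p
    have q3 : |-(lp t p).2| ≤ exp t := by rwa [abs_neg]
    refine ⟨(h1 t ht p).trans (by linarith), (h2 t ht p).trans (by linarith), ?_, ?_, ?_, ?_⟩
    · exact lin_le ((h3 t ht p).trans (by linarith)) ((h4 t ht p).trans (by linarith)) q1 q2 hM0
    · exact lin_le ((h5 t ht p).trans (by linarith)) ((h6 t ht p).trans (by linarith)) q1 q2 hM0
    · exact lin_le ((h3 t ht p).trans (by linarith)) ((h4 t ht p).trans (by linarith)) q3 q1 hM0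
    · exact lin_le ((h5 t ht p).trans (by linarith)) ((h6 t ht p).trans (by linarith)) q3 q1 hM0
  · obtain ⟨C, α, hC, hα, hg⟩ := h.growth
    refine ⟨C * 2 ^ α, α, fun t ht p => ?_⟩
    have e1 := hg (lp t p)
    rw [lp_sq] at e1
    have e2 : √(exp (2 * t)) = exp t := by
      rw [show exp (2 * t) = exp t ^ 2 by rw [sq, ← exp_add]; congr 1; ring]
      exact Real.sqrt_sq (exp_pos t).le
    rw [e2] at e1
    have e3 : (1 + exp t) ^ α ≤ 2 ^ α * exp (α * t) := by
      have : exp (α * t) = (exp t) ^ α := by rw [← exp_mul]; congr 1; ring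
      rw [this, ← mul_rpow (by norm_num) (exp_pos t).le]
      apply rpow_le_rpow (by positivity) _ hα
      have : 1 ≤ exp t := one_le_exp ht
      linarith
    have e4 := mul_le_mul_of_nonneg_left e3 hC
    have p1 := h.posu (lp t p)
    have p2 := h.posv (lp t p)
    change u.f (lp t p) ≤ _ ∧ v.f (lp t p) ≤ _
    constructor <;> linarith

lemma Sol.mono2 {u v : Sm} (h : Sol u v) (x : ℝ) : StrictMono fun y => u.f (x, y) := by
  have hd : ∀ y, HasDerivAt (fun y => u.f (x, y)) (u.f2 (x, y)) y := fun y => by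
    have h1 : HasDerivAt (fun y => (x, y)) ((0:ℝ), (1:ℝ)) y :=
      (hasDerivAt_const y x).prodMk (hasDerivAt_id y)
    exact ((u.df (x, y)).comp_hasDerivAt y h1).congr_deriv (by rw [lf_apply]; simp)
  apply strictMono_of_deriv_pos
  intro y
  rw [(hd y).deriv]
  exact h.mon _

lemma cot_aux {t t' φ φ' : ℝ} (h0 : 0 < φ) (h1 : φ ≤ φ') (h2 : φ' < π)
    (h3 : exp t * sin φ = exp t' * sin φ') : - (exp t * cos φ) ≤ - (exp t' * cos φ') := by
  have s1 : 0 < sin φ := sin_pos_of_pos_of_lt_pi h0 (by linarith)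
  have s2 : 0 < sin φ' := sin_pos_of_pos_of_lt_pi (by linarith) h2
  have s3 : 0 ≤ sin (φ' - φ) := sin_nonneg_of_nonneg_of_le_pi (by linarith) (by linarith)
  rw [sin_sub] at s3
  have e : (exp t * cos φ - exp t' * cos φ') * sin φ' =
      exp t * (sin φ' * cos φ - cos φ' * sin φ) := by linear_combination cos φ' * h3
  have : 0 ≤ (exp t * cos φ - exp t' * cos φ') * sin φ' := by
    rw [e]; exact mul_nonneg (exp_pos t).le s3
  have := nonneg_of_mul_nonneg_left this s2
  linarith

lemma Sol.Mono {u v : Sm} (h : Sol u v) : Mono (u.toFn h.posu) := by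
  intro t t' φ φ' h0 h1 h2 h3
  change u.f (lp t φ) ≤ u.f (lp t' φ')
  simp only [lp]
  rw [h3]
  exact (h.mono2 _).monotone (cot_aux h0 h1 h2 h3)

lemma Sol.Mono' {u v : Sm} (h : Sol u v) : HM.Mono (u.toFn h.posu).refl := by
  intro t t' φ φ' h0 h1 h2 h3
  change u.f (lp t (-φ)) ≤ u.f (lp t' (-φ'))
  simp only [lp, sin_neg, cos_neg, mul_neg]
  rw [h3]
  exact (h.mono2 _).monotone (cot_aux h0 h1 h2 h3)

/-- squared gradient -/
def Wg (u v : Sm) (q : ℝ × ℝ) : ℝ := u.f1 q ^ 2 + u.f2 q ^ 2 + v.f1 q ^ 2 + v.f2 q ^ 2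

lemma Wg_cont (u v : Sm) : Continuous (Wg u v) := by unfold Wg; fun_prop
lemma Wg_nonneg (u v : Sm) (q : ℝ × ℝ) : 0 ≤ Wg u v q := by unfold Wg; positivity

theorem Sol.energy {u v : Sm} (h : Sol u v) : ∃ C, 0 ≤ C ∧ ∀ T, 0 ≤ T →
    ∫ t in (0:ℝ)..T, ∫ p in (-π)..π, Wg u v (lp t p) ≤ C * (1 + 2 * T) := by
  set a := u.toFn h.posu with ha
  set b := v.toFn h.posv with hb
  have hs : Sys a b := h.sys
  obtain ⟨d, hd, hN⟩ := exists_lim hs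
  have hd1 := d_le_one hs h.Mono h.Mono' hd hN
  have hN1 : ∀ t, Nf a b t ≤ 1 := fun t => (hN t).trans hd1
  have hH0 := H_pos (a := a) (b := b) 0
  refine ⟨H a b 0, hH0.le, fun T hT => ?_⟩
  have hD : ∀ t, 0 ≤ t → exp (-2 * t) * D a b t ≤ H a b 0 := by
    intro t ht
    have e1 := H_le hs ht (hN1 t)
    have hHt := H_pos (a := a) (b := b) t
    have e2 : D a b t ≤ H a b t := by
      have := hN1 t; unfold Nf at this; rwa [div_le_one hHt] at this
    have e3 : exp (-2 * t) * (exp (2 * t)) = 1 := by rw [← exp_add]; simp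
    have e4 : H a b t ≤ H a b 0 * exp (2 * t) := by
      refine e1.trans (le_of_eq ?_); congr 2; ring
    have := mul_le_mul_of_nonneg_left (e2.trans e4) (exp_pos (-2 * t)).le
    refine this.trans (le_of_eq ?_)
    linear_combination H a b 0 * e3
  have hI : ∀ t, HasDerivAt (fun s => ∫ t in (0:ℝ)..s, ∫ p in (-π)..π, Wg u v (lp t p))
      (∫ p in (-π)..π, Wg u v (lp t p)) t := fun t =>
    (Continuous.integral_hasStrictDerivAt
      (continuous_param (F := fun t p => Wg u v (lp t p)) _ _
        ((Wg_cont u v).comp (by fun_prop))) _ t).hasDerivAt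
  have hE : ∀ t : ℝ, HasDerivAt (fun t => exp (-2 * t)) (-2 * exp (-2 * t)) t := fun t => by
    have := ((hasDerivAt_id t).const_mul (-2)).exp
    exact this.congr_deriv (by simp [mul_comm])
  have hg : ∀ t, HasDerivAt (fun t => exp (-2 * t) * D a b t + 2 * H a b 0 * t)
      (-2 * exp (-2 * t) * D a b t + exp (-2 * t) * (S a b t + Th a b t + 2 * G a b t)
        + 2 * H a b 0) t := fun t =>
    ((((hE t).mul (D_deriv hs t))).add ((hasDerivAt_id t).const_mul (2 * H a b 0))).congr_deriv (by simp)
  have := sub_le_sub_of_deriv_le hI hg hT (fun t ht => by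
    have e1 : exp (-2 * t) * (S a b t + Th a b t) = ∫ p in (-π)..π, Wg u v (lp t p) := by
      unfold S Th
      rw [← ii_add (by fun_prop) (by fun_prop), ← ii_smul]
      congr 1; ext p
      have e2 := lp_sq t p
      have e3 : exp (-2 * t) * (exp (2 * t)) = 1 := by rw [← exp_add]; simp
      simp only [ha, hb, Sm.toFn, Wg]
      rw [← e2] at e3
      linear_combination (u.f1 (lp t p) ^ 2 + u.f2 (lp t p) ^ 2 + v.f1 (lp t p) ^ 2 + v.f2 (lp t p) ^ 2) * e3
    have e4 := hD t ht.1.le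
    have e5 : 0 ≤ G a b t := intervalIntegral.integral_nonneg (by linarith [pi_pos])
      fun p _ => by positivity
    have e6 := mul_nonneg (exp_pos (-2 * t)).le e5
    rw [← e1]
    linarith)
  simp only [intervalIntegral.integral_same, mul_zero, exp_zero, one_mul, sub_zero, add_zero] at this
  have e1 := hD T hT
  have e2 := D_nonneg hs 0
  linarith

end HM

namespace HM
open Real Set Filter Topology

lemma lp_shift (t θ : ℝ) : lp t (θ + π / 2) = (exp t * cos θ, exp t * sin θ) := by
  simp [lp, sin_add_pi_div_two, cos_add_pi_div_two]

lemma radial_bound {u v : Sm} {C K T : ℝ} (hT : 0 ≤ T)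
    (hE : ∫ t in (0:ℝ)..T, ∫ p in (-π)..π, Wg u v (lp t p) ≤ C * (1 + 2 * T)) (hK : 0 ≤ K)
    {F : ℝ × ℝ → ℝ} (hFc : Continuous F)
    (hF : ∀ q, F q ≠ 0 → 1 ≤ q.1 ^ 2 + q.2 ^ 2 ∧ q.1 ^ 2 + q.2 ^ 2 ≤ exp (2 * T))
    (hFW : ∀ q, (q.1 ^ 2 + q.2 ^ 2) * F q ≤ K * Wg u v q) :
    ∫ q, F q ≤ K * (C * (1 + 2 * T)) := by
  have hpi := pi_pos
  set g : ℝ × ℝ → ℝ := fun p => p.1 * F (p.1 * cos p.2, p.1 * sin p.2) with hg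
  have hgc : Continuous g := by fun_prop
  have h1 : ∫ q, F q = ∫ p in Ioi (0:ℝ) ×ˢ Ioo (-π) π, g p := by
    rw [← integral_comp_polarCoord_symm]
    rfl
  have hexp : 1 ≤ exp T := one_le_exp hT
  have h2 : ∫ p in Ioi (0:ℝ) ×ˢ Ioo (-π) π, g p = ∫ p in Ioc 1 (exp T) ×ˢ Ioc (-π) π, g p := by
    have e1 : ∫ p in Icc 1 (exp T) ×ˢ Ioo (-π) π, g p = ∫ p in Ioi (0:ℝ) ×ˢ Ioo (-π) π, g p := by
      symm
      apply setIntegral_eq_of_subset_of_forall_sdiff_eq_zero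
        (measurableSet_Ioi.prod measurableSet_Ioo)
      · exact prod_mono (fun x hx => lt_of_lt_of_le one_pos hx.1) (subset_refl _)
      · rintro ⟨r, θ⟩ ⟨⟨hr, hθ⟩, hn⟩
        by_contra hne
        have hFne : F (r * cos θ, r * sin θ) ≠ 0 := fun h0 => hne (by simp [hg, h0])
        obtain ⟨k1, k2⟩ := hF _ hFne
        have e : (r * cos θ) ^ 2 + (r * sin θ) ^ 2 = r ^ 2 := by
          linear_combination r ^ 2 * sin_sq_add_cos_sq θ
        simp only [e] at k1 k2
        have hr0 : 0 < r := hr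
        refine hn ⟨⟨?_, ?_⟩, hθ⟩
        · by_contra! hh; simp only at hh; nlinarith
        · have : exp (2 * T) = exp T ^ 2 := by rw [sq, ← exp_add]; congr 1; ring
          rw [this] at k2
          exact (pow_le_pow_iff_left₀ hr0.le (exp_pos T).le (by norm_num)).1 k2
    rw [← e1]
    apply setIntegral_congr_set
    exact Measure.set_prod_ae_eq Ioc_ae_eq_Icc.symm Ioo_ae_eq_Ioc
  have hIntg : IntegrableOn g (Ioc 1 (exp T) ×ˢ Ioc (-π) π) (volume.prod volume) := by
    have := (hgc.continuousOn (s := Icc 1 (exp T) ×ˢ Icc (-π) π)).integrableOn_compact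
      (μ := volume) (isCompact_Icc.prod isCompact_Icc)
    exact this.mono_set (prod_mono Ioc_subset_Icc_self Ioc_subset_Icc_self)
  have h3 : ∫ p in Ioc 1 (exp T) ×ˢ Ioc (-π) π, g p = ∫ r in (1:ℝ)..exp T, ∫ θ in (-π)..π, g (r, θ) := by
    rw [Measure.volume_eq_prod, setIntegral_prod _ hIntg, intervalIntegral.integral_of_le hexp]
    congr 1; ext r
    rw [intervalIntegral.integral_of_le (by linarith)]
  have h4 : ∫ r in (1:ℝ)..exp T, ∫ θ in (-π)..π, g (r, θ)
      = ∫ t in (0:ℝ)..T, (∫ θ in (-π)..π, g (exp t, θ)) * exp t := by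
    have := intervalIntegral.integral_comp_mul_deriv (a := 0) (b := T) (f := exp) (f' := exp)
      (g := fun r => ∫ θ in (-π)..π, g (r, θ)) (fun t _ => hasDerivAt_exp t)
      continuous_exp.continuousOn (continuous_param (F := fun r θ => g (r, θ)) _ _ (by fun_prop))
    rw [exp_zero] at this
    rw [← this]; rfl
  have h5 : ∀ t, (∫ θ in (-π)..π, g (exp t, θ)) * exp t ≤ K * ∫ p in (-π)..π, Wg u v (lp t p) := by
    intro t
    have hc : Continuous fun p => Wg u v (lp t p) := (Wg_cont u v).comp (by fun_prop)
    have e1 : ∫ p in (-π)..π, Wg u v (lp t p) = ∫ θ in (-π)..π, Wg u v (lp t (θ + π / 2)) := by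
      rw [intervalIntegral.integral_comp_add_right (fun p => Wg u v (lp t p))]
      have := Function.Periodic.intervalIntegral_add_eq (f := fun p => Wg u v (lp t p)) (T := 2 * π)
        (fun p => by simp only [lp_per]) (-π) (-π + π / 2)
      rw [show -π + 2 * π = π by ring, show -π + π / 2 + 2 * π = π + π / 2 by ring] at this
      exact this
    rw [e1, ← ii_smul, ← intervalIntegral.integral_mul_const]
    apply ii_mono (by linarith) (by fun_prop) ((hc.comp (by fun_prop : Continuous fun θ => θ + π / 2)).const_mul K)
    intro θ _
    simp only [Function.comp_def]; rw [lp_shift]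
    have := hFW (exp t * cos θ, exp t * sin θ)
    refine le_trans (le_of_eq ?_) this
    simp only [hg]
    linear_combination (- exp t ^ 2 * F (exp t * cos θ, exp t * sin θ)) * sin_sq_add_cos_sq θ
  rw [h1, h2, h3, h4]
  have hc2 : Continuous fun t => ∫ p in (-π)..π, Wg u v (lp t p) :=
    continuous_param (F := fun t p => Wg u v (lp t p)) _ _ ((Wg_cont u v).comp (by fun_prop))
  have hc3 : Continuous fun r => ∫ θ in (-π)..π, g (r, θ) :=
    continuous_param (F := fun r θ => g (r, θ)) _ _ (by fun_prop)
  have h6 : ∫ t in (0:ℝ)..T, (∫ θ in (-π)..π, g (exp t, θ)) * exp t ≤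
      ∫ t in (0:ℝ)..T, K * ∫ p in (-π)..π, Wg u v (lp t p) :=
    ii_mono hT ((hc3.comp continuous_exp).mul continuous_exp) (hc2.const_mul K) (fun t _ => h5 t)
  rw [ii_smul] at h6
  exact h6.trans (mul_le_mul_of_nonneg_left hE hK)

lemma st_deriv : ∃ M, 0 ≤ M ∧ ∀ s, |deriv smoothTransition s| ≤ M ∧
    (deriv smoothTransition s ≠ 0 → 0 ≤ s ∧ s ≤ 1) := by
  have hz : ∀ s, deriv smoothTransition s ≠ 0 → 0 ≤ s ∧ s ≤ 1 := by
    intro s hs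
    by_contra hcon
    apply hs
    rw [not_and_or, not_le, not_le] at hcon
    rcases hcon with h | h
    · have : smoothTransition =ᶠ[𝓝 s] fun _ => 0 := by
        filter_upwards [Iio_mem_nhds h] with x hx using smoothTransition.zero_of_nonpos (le_of_lt hx)
      rw [this.deriv_eq]; simp
    · have : smoothTransition =ᶠ[𝓝 s] fun _ => 1 := by
        filter_upwards [Ioi_mem_nhds h] with x hx using smoothTransition.one_of_one_le (le_of_lt hx)
      rw [this.deriv_eq]; simp
  have hc : Continuous (deriv smoothTransition) :=
    (smoothTransition.contDiff (n := 1)).continuous_deriv le_rfl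
  obtain ⟨M, hM⟩ := (isCompact_Icc (a := (0:ℝ)) (b := 1)).exists_bound_of_continuousOn hc.continuousOn
  refine ⟨max M 0, le_max_right _ _, fun s => ⟨?_, hz s⟩⟩
  by_cases h : deriv smoothTransition s = 0
  · rw [h]; simp
  · exact (hM s (hz s h)).trans (le_max_left _ _)

/-- `C¹` compactly supported cutoff with its derivatives. -/
structure Cut where
  f : ℝ × ℝ → ℝ
  f1 : ℝ × ℝ → ℝ
  f2 : ℝ × ℝ → ℝ
  cf : Continuous f
  cf1 : Continuous f1
  cf2 : Continuous f2
  df : ∀ q, HasFDerivAt f (lf (f1 q) (f2 q)) q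
  cs : HasCompactSupport f

attribute [fun_prop] Cut.cf Cut.cf1 Cut.cf2

theorem Sol.cutoffs {u v : Sm} (h : Sol u v) : ∃ η : ℕ → Cut, (∀ n q, 0 ≤ (η n).f q) ∧
    (∀ n q, (η n).f q ≤ 1) ∧ (∀ q, ∀ᶠ n in atTop, (η n).f q = 1) ∧
    Tendsto (fun n => ∫ q, Wg u v q * ((η n).f1 q ^ 2 + (η n).f2 q ^ 2)) atTop (𝓝 0) := by
  obtain ⟨C, hC, hE⟩ := h.energy
  obtain ⟨M, hM, hst⟩ := st_deriv
  have hdc : Continuous (deriv smoothTransition) :=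
    (smoothTransition.contDiff (n := 1)).continuous_deriv le_rfl
  have hdd : ∀ s, HasDerivAt smoothTransition (deriv smoothTransition s) s := fun s =>
    ((smoothTransition.contDiff (n := 1)).differentiable (by norm_num) s).hasDerivAt
  have hne : ∀ q : ℝ × ℝ, 1 + (q.1 ^ 2 + q.2 ^ 2) ≠ 0 := fun q => by positivity
  set s : ℕ → ℝ × ℝ → ℝ := fun n q => 2 - log (1 + (q.1 ^ 2 + q.2 ^ 2)) / (n + 1) with hs
  have hsc : ∀ n, Continuous (s n) := fun n => by
    apply Continuous.sub continuous_const
    exact (Continuous.log (by fun_prop) hne).div_const _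
  set d1 : ℕ → ℝ × ℝ → ℝ := fun n q => deriv smoothTransition (s n q) *
    (- (2 * q.1 / (1 + (q.1 ^ 2 + q.2 ^ 2)) / (n + 1))) with hd1
  set d2 : ℕ → ℝ × ℝ → ℝ := fun n q => deriv smoothTransition (s n q) *
    (- (2 * q.2 / (1 + (q.1 ^ 2 + q.2 ^ 2)) / (n + 1))) with hd2
  have hsupp : ∀ n q, s n q ≤ 0 ∨ q.1 ^ 2 + q.2 ^ 2 ≤ exp (2 * (n + 1)) := by
    intro n q
    by_contra! hcon
    have hn : (0:ℝ) < n + 1 := by positivity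
    have e1 : log (1 + (q.1 ^ 2 + q.2 ^ 2)) < 2 * (n + 1) := by
      rw [← div_lt_iff₀ hn]; simp only [hs] at hcon; linarith [hcon.1]
    rw [log_lt_iff_lt_exp (by positivity)] at e1
    linarith [hcon.2]
  let η : ℕ → Cut := fun n =>
    { f := fun q => smoothTransition (s n q)
      f1 := d1 n
      f2 := d2 n
      cf := smoothTransition.continuous.comp (hsc n)
      cf1 := by
        apply Continuous.mul (hdc.comp (hsc n))
        exact ((Continuous.div (by fun_prop) (by fun_prop) hne).div_const _).neg
      cf2 := by
        apply Continuous.mul (hdc.comp (hsc n))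
        exact ((Continuous.div (by fun_prop) (by fun_prop) hne).div_const _).neg
      df := fun q => by
        have k1 : HasFDerivAt (fun q : ℝ × ℝ => 1 + (q.1 ^ 2 + q.2 ^ 2)) (lf (2 * q.1) (2 * q.2)) q := by
          have := (((hasFDerivAt_fst (𝕜 := ℝ) (p := q)).pow 2).add
            ((hasFDerivAt_snd (𝕜 := ℝ) (p := q)).pow 2)).const_add 1
          refine this.congr_fderiv ?_
          ext <;> simp [lf]
        have k2 := ((k1.log (hne q)).mul_const ((n:ℝ) + 1)⁻¹).const_sub 2
        have k3 := (hdd (s n q)).comp_hasFDerivAt q (f := s n) k2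
        refine k3.congr_fderiv ?_
        ext <;> simp [lf, hd1, hd2] <;> left <;> ring
      cs := by
        apply HasCompactSupport.of_support_subset_isCompact
          (K := Metric.closedBall 0 (exp (n + 1))) (isCompact_closedBall _ _)
        intro q hq
        have h1 : ¬ s n q ≤ 0 := fun h0 => hq (smoothTransition.zero_of_nonpos h0)
        have h2 := (hsupp n q).resolve_left h1
        rw [show exp (2 * ((n:ℝ) + 1)) = exp (n + 1) ^ 2 by rw [sq, ← exp_add]; congr 1; ring] at h2
        rw [mem_closedBall_zero_iff, Prod.norm_def]
        apply max_le
        · exact abs_le_of_sq_le_sq (by linarith [sq_nonneg q.2]) (exp_pos _).le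
        · exact abs_le_of_sq_le_sq (by linarith [sq_nonneg q.1]) (exp_pos _).le }
  refine ⟨η, fun n q => smoothTransition.nonneg _, fun n q => smoothTransition.le_one _, ?_, ?_⟩
  · intro q
    obtain ⟨m, hm⟩ := exists_nat_gt (log (1 + (q.1 ^ 2 + q.2 ^ 2)))
    filter_upwards [eventually_ge_atTop m] with n hn
    apply smoothTransition.one_of_one_le
    have : (m:ℝ) ≤ n := by exact_mod_cast hn
    have : log (1 + (q.1 ^ 2 + q.2 ^ 2)) / (n + 1) ≤ 1 := by
      rw [div_le_one (by positivity)]; linarith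
    simp only [hs]; linarith
  · have hbound : ∀ n : ℕ, ∫ q, Wg u v q * ((η n).f1 q ^ 2 + (η n).f2 q ^ 2) ≤
        12 * M ^ 2 * C * (1 / ((n:ℝ) + 1)) := by
      intro n
      have hn : (0:ℝ) < n + 1 := by positivity
      have hgrad : ∀ q, (q.1 ^ 2 + q.2 ^ 2) * ((η n).f1 q ^ 2 + (η n).f2 q ^ 2) ≤
          4 * M ^ 2 / (n + 1) ^ 2 := by
        intro q
        set ρ := q.1 ^ 2 + q.2 ^ 2 with hρ
        have hρ0 : 0 ≤ ρ := by positivity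
        have e1 : ρ * ((η n).f1 q ^ 2 + (η n).f2 q ^ 2) =
            4 * (deriv smoothTransition (s n q)) ^ 2 / (n + 1) ^ 2 * (ρ / (1 + ρ)) ^ 2 := by
          change ρ * (d1 n q ^ 2 + d2 n q ^ 2) = _
          simp only [hd1, hd2]
          rw [← hρ]
          have : (1 + ρ) ≠ 0 := hne q
          field_simp
          rw [hρ]; ring
        rw [e1]
        have e2 : (deriv smoothTransition (s n q)) ^ 2 ≤ M ^ 2 := by
          rw [← sq_abs]; exact pow_le_pow_left₀ (abs_nonneg _) (hst _).1 2
        have e3 : (ρ / (1 + ρ)) ^ 2 ≤ 1 := by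
          apply pow_le_one₀ (by positivity)
          rw [div_le_one (by positivity)]; linarith
        calc _ ≤ 4 * M ^ 2 / ((n:ℝ) + 1) ^ 2 * 1 := by gcongr
          _ = _ := mul_one _
      have := radial_bound (u := u) (v := v) (K := 4 * M ^ 2 / ((n:ℝ) + 1) ^ 2) hn.le (hE _ hn.le)
        (by positivity) (F := fun q => Wg u v q * ((η n).f1 q ^ 2 + (η n).f2 q ^ 2))
        (by have := Wg_cont u v; fun_prop)
        (by
          intro q hq
          have h1 : deriv smoothTransition (s n q) ≠ 0 := by
            intro h0
            apply hq
            have : (η n).f1 q = 0 := by change d1 n q = 0; simp only [hd1]; rw [h0, zero_mul]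
            have : (η n).f2 q = 0 := by change d2 n q = 0; simp only [hd2]; rw [h0, zero_mul]
            simp [*]
          obtain ⟨k1, k2⟩ := (hst _).2 h1
          have hp : 0 < 1 + (q.1 ^ 2 + q.2 ^ 2) := by positivity
          constructor
          · have : (n:ℝ) + 1 ≤ log (1 + (q.1 ^ 2 + q.2 ^ 2)) := by
              have : 1 ≤ log (1 + (q.1 ^ 2 + q.2 ^ 2)) / (n + 1) := by simp only [hs] at k2; linarith
              rwa [one_le_div hn] at this
            rw [le_log_iff_exp_le hp] at this
            have := add_one_le_exp ((n:ℝ) + 1)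
            have : (0:ℝ) ≤ n := by positivity
            linarith
          · have : log (1 + (q.1 ^ 2 + q.2 ^ 2)) ≤ 2 * (n + 1) := by
              rw [← div_le_iff₀ hn]; simp only [hs] at k1; linarith
            rw [log_le_iff_le_exp hp] at this
            linarith)
        (by
          intro q
          have := mul_le_mul_of_nonneg_left (hgrad q) (Wg_nonneg u v q)
          linarith)
      refine this.trans ?_
      have e : 4 * M ^ 2 / ((n:ℝ) + 1) ^ 2 * (C * (1 + 2 * (n + 1))) ≤
          4 * M ^ 2 / ((n:ℝ) + 1) ^ 2 * (C * (3 * (n + 1))) := by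
        gcongr
        have : (0:ℝ) ≤ n := by positivity
        linarith
      refine e.trans (le_of_eq ?_)
      field_simp; ring
    have hlim : Tendsto (fun n : ℕ => 12 * M ^ 2 * C * (1 / ((n:ℝ) + 1))) atTop (𝓝 0) := by
      have := tendsto_one_div_add_atTop_nhds_zero_nat.const_mul (12 * M ^ 2 * C)
      rwa [mul_zero] at this
    refine tendsto_of_tendsto_of_tendsto_of_le_of_le tendsto_const_nhds hlim (fun n => ?_) hbound
    exact integral_nonneg fun q => mul_nonneg (Wg_nonneg u v q) (by positivity)

end HM

namespace HM
open Real Set Filter Topology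

/-- `C¹` function on the plane. -/
structure C1 where
  f : ℝ × ℝ → ℝ
  f1 : ℝ × ℝ → ℝ
  f2 : ℝ × ℝ → ℝ
  cf : Continuous f
  cf1 : Continuous f1
  cf2 : Continuous f2
  df : ∀ q, HasFDerivAt f (lf (f1 q) (f2 q)) q

attribute [fun_prop] C1.cf C1.cf1 C1.cf2

lemma lf_inj {a b c d : ℝ} (h : lf a b = lf c d) : a = c ∧ b = d := by
  have h1 := congrArg (fun L => L (1, 0)) h
  have h2 := congrArg (fun L => L (0, 1)) h
  simp only [lf_apply] at h1 h2
  constructor <;> linarith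

lemma Cut.z (χ : Cut) {q : ℝ × ℝ} (hq : q ∉ tsupport χ.f) : χ.f q = 0 :=
  image_eq_zero_of_notMem_tsupport hq

lemma Cut.z12 (χ : Cut) {q : ℝ × ℝ} (hq : q ∉ tsupport χ.f) : χ.f1 q = 0 ∧ χ.f2 q = 0 := by
  have h0 : χ.f =ᶠ[𝓝 q] fun _ => 0 := notMem_tsupport_iff_eventuallyEq.1 hq
  have h1 : HasFDerivAt χ.f (0 : ℝ × ℝ →L[ℝ] ℝ) q :=
    (hasFDerivAt_const (0:ℝ) q).congr_of_eventuallyEq h0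
  have := (χ.df q).unique h1
  apply lf_inj
  rw [this]; ext <;> simp [lf]

lemma cs_of {K : Set (ℝ × ℝ)} (hK : IsCompact K) {g : ℝ × ℝ → ℝ} (h : ∀ q, q ∉ K → g q = 0) :
    HasCompactSupport g := HasCompactSupport.intro hK h

lemma Cut.int (χ : Cut) {g : ℝ × ℝ → ℝ} (hg : Continuous g)
    (h : ∀ q, q ∉ tsupport χ.f → g q = 0) : Integrable g :=
  hg.integrable_of_hasCompactSupport (cs_of χ.cs h)

lemma ibp1 (k : C1) (χ : Cut) : ∫ q, k.f q * χ.f1 q = - ∫ q, k.f1 q * χ.f q := by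
  have := integral_bilinear_hasFDerivAt_right_eq_neg_left_of_integrable (μ := volume) (f := k.f)
    (f' := fun q => lf (k.f1 q) (k.f2 q)) (g := χ.f) (g' := fun q => lf (χ.f1 q) (χ.f2 q))
    (v := ((1, 0) : ℝ × ℝ)) (B := ContinuousLinearMap.mul ℝ ℝ) ?_ ?_ ?_ (fun q _ => k.df q)
    (fun q _ => χ.df q)
  · simpa [lf_apply] using this
  · refine χ.int (by simp only [lf_apply, ContinuousLinearMap.mul_apply']; fun_prop) (fun q hq => ?_)
    simp [χ.z hq]
  · refine χ.int (by simp only [lf_apply, ContinuousLinearMap.mul_apply']; fun_prop) (fun q hq => ?_)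
    simp [χ.z12 hq, lf_apply]
  · refine χ.int (by simp only [ContinuousLinearMap.mul_apply']; fun_prop) (fun q hq => ?_)
    simp [χ.z hq]

lemma ibp2 (k : C1) (χ : Cut) : ∫ q, k.f q * χ.f2 q = - ∫ q, k.f2 q * χ.f q := by
  have := integral_bilinear_hasFDerivAt_right_eq_neg_left_of_integrable (μ := volume) (f := k.f)
    (f' := fun q => lf (k.f1 q) (k.f2 q)) (g := χ.f) (g' := fun q => lf (χ.f1 q) (χ.f2 q))
    (v := ((0, 1) : ℝ × ℝ)) (B := ContinuousLinearMap.mul ℝ ℝ) ?_ ?_ ?_ (fun q _ => k.df q)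
    (fun q _ => χ.df q)
  · simpa [lf_apply] using this
  · refine χ.int (by simp only [lf_apply, ContinuousLinearMap.mul_apply']; fun_prop) (fun q hq => ?_)
    simp [χ.z hq]
  · refine χ.int (by simp only [lf_apply, ContinuousLinearMap.mul_apply']; fun_prop) (fun q hq => ?_)
    simp [χ.z12 hq, lf_apply]
  · refine χ.int (by simp only [ContinuousLinearMap.mul_apply']; fun_prop) (fun q hq => ?_)
    simp [χ.z hq]

lemma deriv_under {K : Set (ℝ × ℝ)} (hK : IsCompact K) {G G' : ℝ → ℝ × ℝ → ℝ}
    (hG : Continuous fun x : ℝ × (ℝ × ℝ) => G x.1 x.2)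
    (hG' : Continuous fun x : ℝ × (ℝ × ℝ) => G' x.1 x.2)
    (hz : ∀ q, q ∉ K → G 0 q = 0) (hz' : ∀ h ∈ Icc (-1:ℝ) 1, ∀ q, q ∉ K → G' h q = 0)
    (hd : ∀ h q, HasDerivAt (fun h => G h q) (G' h q) h) :
    HasDerivAt (fun h => ∫ q, G h q) (∫ q, G' 0 q) 0 := by
  obtain ⟨M, hM⟩ := (isCompact_Icc (a := (-1:ℝ)) (b := 1) |>.prod hK).exists_bound_of_continuousOn
    hG'.continuousOn
  have hc : ∀ h, Continuous (G h) := fun h => hG.comp (Continuous.prodMk_right h)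
  have hc' : ∀ h, Continuous (G' h) := fun h => hG'.comp (Continuous.prodMk_right h)
  refine (hasDerivAt_integral_of_dominated_loc_of_deriv_le (s := Icc (-1:ℝ) 1)
    (bound := K.indicator fun _ => M) (Icc_mem_nhds (by norm_num) (by norm_num))
    (Eventually.of_forall fun h => (hc h).aestronglyMeasurable)
    ((hc 0).integrable_of_hasCompactSupport (cs_of hK hz)) (hc' 0).aestronglyMeasurable
    (Eventually.of_forall fun q h hh => ?_) ?_ (Eventually.of_forall fun q h _ => hd h q)).2
  · by_cases hq : q ∈ K
    · rw [indicator_of_mem hq]; exact hM (h, q) ⟨hh, hq⟩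
    · rw [indicator_of_notMem hq, hz' h hh q hq]; simp
  · exact (integrable_indicator_iff hK.measurableSet).2 (integrableOn_const hK.measure_lt_top.ne)

lemma shift_deriv {f : ℝ × ℝ → ℝ} {f1 f2 : ℝ × ℝ → ℝ} (hf : ∀ q, HasFDerivAt f (lf (f1 q) (f2 q)) q)
    (q : ℝ × ℝ) (c h : ℝ) :
    HasDerivAt (fun h => f (q.1 + c * h, q.2)) (c * f1 (q.1 + c * h, q.2)) h := by
  have h1 : HasDerivAt (fun h => (q.1 + c * h, q.2)) (c, (0:ℝ)) h :=
    (((hasDerivAt_id h).const_mul c).const_add q.1 |>.congr_deriv (by simp)).prodMk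
      (hasDerivAt_const _ _)
  exact ((hf _).comp_hasDerivAt h h1).congr_deriv (by rw [lf_apply]; ring)

lemma shift_deriv2 {f : ℝ × ℝ → ℝ} {f1 f2 : ℝ × ℝ → ℝ}
    (hf : ∀ q, HasFDerivAt f (lf (f1 q) (f2 q)) q)
    (h : ℝ) (q : ℝ × ℝ) :
    HasFDerivAt (fun q : ℝ × ℝ => f (q.1 + h, q.2)) (lf (f1 (q.1 + h, q.2)) (f2 (q.1 + h, q.2))) q := by
  have h1 : HasFDerivAt (fun q : ℝ × ℝ => (q.1 + h, q.2)) (ContinuousLinearMap.id ℝ (ℝ × ℝ)) q := by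
    have := (hasFDerivAt_id (𝕜 := ℝ) q).add_const ((h, 0) : ℝ × ℝ)
    have e : (fun q : ℝ × ℝ => (q.1 + h, q.2)) = fun x => id x + (h, 0) := by
      funext p; ext <;> simp
    rw [e]; exact this
  have h2 := (hf (q.1 + h, q.2)).comp q h1
  exact h2.congr_fderiv (by ext <;> simp)

/-- translate of a cutoff -/
noncomputable def Cut.tr (χ : Cut) (h : ℝ) : Cut where
  f q := χ.f (q.1 + h, q.2)
  f1 q := χ.f1 (q.1 + h, q.2)
  f2 q := χ.f2 (q.1 + h, q.2)
  cf := by fun_prop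
  cf1 := by fun_prop
  cf2 := by fun_prop
  df q := shift_deriv2 χ.df h q
  cs := by
    have := χ.cs.comp_homeomorph (Homeomorph.addRight ((h, 0) : ℝ × ℝ))
    convert this using 1
    ext q
    simp [Homeomorph.addRight]
    congr 1
    ext <;> simp

lemma curl (k : C1) (χ : Cut) : ∫ q, k.f2 q * χ.f1 q = ∫ q, k.f1 q * χ.f2 q := by
  have e1 : ∀ h, ∫ q, k.f2 q * χ.f (q.1 + 1 * h, q.2) = - ∫ q, k.f (q.1 + (-1) * h, q.2) * χ.f2 q := by
    intro h
    have a := ibp2 k (χ.tr h)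
    have b : ∫ q : ℝ × ℝ, k.f q * χ.f2 (q.1 + h, q.2) = ∫ q, k.f (q.1 + (-1) * h, q.2) * χ.f2 q := by
      rw [← integral_add_right_eq_self _ ((-h, 0) : ℝ × ℝ)]
      congr 1; ext q
      have e : q + (-h, 0) = (q.1 + -1 * h, q.2) := by ext <;> simp
      rw [e]; simp
    simp only [Cut.tr] at a
    rw [b] at a
    simp only [one_mul]
    linarith
  set K := Metric.cthickening 1 (tsupport χ.f)
  have hK : IsCompact K := χ.cs.isCompact.cthickening
  have hKin : ∀ h ∈ Icc (-1:ℝ) 1, ∀ q : ℝ × ℝ, q ∉ K → (q.1 + 1 * h, q.2) ∉ tsupport χ.f := by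
    intro h hh q hq hm
    refine hq (Metric.mem_cthickening_of_dist_le q _ 1 _ hm ?_)
    rw [Prod.dist_eq]
    simp [Real.dist_eq, abs_le, hh.1, hh.2]
  have d1 : HasDerivAt (fun h => ∫ q, k.f2 q * χ.f (q.1 + 1 * h, q.2))
      (∫ q, k.f2 q * (1 * χ.f1 (q.1 + 1 * 0, q.2))) 0 := by
    refine deriv_under hK (G := fun h q => k.f2 q * χ.f (q.1 + 1 * h, q.2))
      (G' := fun h q => k.f2 q * (1 * χ.f1 (q.1 + 1 * h, q.2))) (by fun_prop) (by fun_prop) ?_ ?_ ?_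
    · intro q hq; show _ * _ = _; rw [χ.z (hKin 0 (by simp) q hq)]; ring
    · intro h hh q hq; show _ * _ = _; rw [(χ.z12 (hKin h hh q hq)).1]; ring
    · intro h q; exact (shift_deriv χ.df q 1 h).const_mul _
  have d2 : HasDerivAt (fun h => ∫ q, k.f (q.1 + (-1) * h, q.2) * χ.f2 q)
      (∫ q, ((-1) * k.f1 (q.1 + (-1) * 0, q.2)) * χ.f2 q) 0 := by
    refine deriv_under χ.cs.isCompact (G := fun h q => k.f (q.1 + (-1) * h, q.2) * χ.f2 q)
      (G' := fun h q => ((-1) * k.f1 (q.1 + (-1) * h, q.2)) * χ.f2 q) (by fun_prop) (by fun_prop) ?_ ?_ ?_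
    · intro q hq; show _ * _ = _; rw [(χ.z12 hq).2]; ring
    · intro h hh q hq; show _ * _ = _; rw [(χ.z12 hq).2]; ring
    · intro h q; exact (shift_deriv k.df q (-1) h).mul_const _
  have d3 := d2.neg
  have e2 : (fun h => ∫ q, k.f2 q * χ.f (q.1 + 1 * h, q.2))
    = -(fun h => ∫ q, k.f (q.1 + (-1) * h, q.2) * χ.f2 q) := by
    funext h; exact e1 h
  rw [e2] at d1
  have := d1.unique d3
  rw [← integral_neg] at this
  simpa using this

/-- first derivatives of a `C²` function are `C¹` -/
noncomputable def Sm.d1 (u : Sm) : C1 := ⟨u.f1, u.f11, u.f12, u.cf1, u.cf11, u.cf12, u.df1⟩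
noncomputable def Sm.d2 (u : Sm) : C1 := ⟨u.f2, u.f12, u.f22, u.cf2, u.cf12, u.cf22, u.df2⟩
noncomputable def Sm.c1 (u : Sm) : C1 := ⟨u.f, u.f1, u.f2, u.cf, u.cf1, u.cf2, u.df⟩

/-- `k` is a weak solution of `Δ k = ρ`. -/
def WeakEq (k : C1) (ρ : ℝ × ℝ → ℝ) : Prop :=
  ∀ χ : Cut, ∫ q, (k.f1 q * χ.f1 q + k.f2 q * χ.f2 q + ρ q * χ.f q) = 0

lemma int_add3 {f g h : ℝ × ℝ → ℝ} (hf : Integrable f) (hg : Integrable g) (hh : Integrable h) :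
    ∫ q, (f q + g q + h q) = (∫ q, f q) + (∫ q, g q) + ∫ q, h q := by
  have : Integrable fun q => f q + g q := hf.add hg
  rw [integral_add this hh, integral_add hf hg]

lemma weak0 (u : Sm) {ρ : ℝ × ℝ → ℝ} (hρ : Continuous ρ) (h : ∀ q, u.f11 q + u.f22 q = ρ q) :
    WeakEq u.c1 ρ := by
  intro χ
  have a := ibp1 u.d1 χ
  have b := ibp2 u.d2 χ
  simp only [Sm.d1, Sm.d2] at a b
  simp only [Sm.c1]
  have i1 : Integrable fun q => u.f1 q * χ.f1 q :=
    χ.int (by fun_prop) (fun q hq => by simp [χ.z12 hq])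
  have i2 : Integrable fun q => u.f2 q * χ.f2 q :=
    χ.int (by fun_prop) (fun q hq => by simp [χ.z12 hq])
  have i3 : Integrable fun q => u.f11 q * χ.f q :=
    χ.int (by fun_prop) (fun q hq => by simp [χ.z hq])
  have i4 : Integrable fun q => u.f22 q * χ.f q :=
    χ.int (by fun_prop) (fun q hq => by simp [χ.z hq])
  have i5 : Integrable fun q => ρ q * χ.f q :=
    χ.int (by fun_prop) (fun q hq => by simp [χ.z hq])
  rw [int_add3 i1 i2 i5, a, b]
  have : ∫ q, ρ q * χ.f q = (∫ q, u.f11 q * χ.f q) + ∫ q, u.f22 q * χ.f q := by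
    rw [← integral_add i3 i4]; congr 1; ext q; rw [← h]; ring
  rw [this]; ring

lemma weak1 (u : Sm) (ρ : C1) (h : ∀ q, u.f11 q + u.f22 q = ρ.f q) :
    WeakEq u.d1 ρ.f1 := by
  intro χ
  have a := ibp1 ρ χ
  have b := curl u.d2 χ
  simp only [Sm.d1, Sm.d2] at a b ⊢
  have i1 : Integrable fun q => u.f11 q * χ.f1 q :=
    χ.int (by fun_prop) (fun q hq => by simp [χ.z12 hq])
  have i2 : Integrable fun q => u.f12 q * χ.f2 q :=
    χ.int (by fun_prop) (fun q hq => by simp [χ.z12 hq])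
  have i3 : Integrable fun q => u.f22 q * χ.f1 q :=
    χ.int (by fun_prop) (fun q hq => by simp [χ.z12 hq])
  have i5 : Integrable fun q => ρ.f1 q * χ.f q :=
    χ.int (by fun_prop) (fun q hq => by simp [χ.z hq])
  rw [int_add3 i1 i2 i5]
  have : ∫ q, ρ.f q * χ.f1 q = (∫ q, u.f11 q * χ.f1 q) + ∫ q, u.f22 q * χ.f1 q := by
    rw [← integral_add i1 i3]; congr 1; ext q; rw [← h]; ring
  linarith

lemma weak2 (u : Sm) (ρ : C1) (h : ∀ q, u.f11 q + u.f22 q = ρ.f q) :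
    WeakEq u.d2 ρ.f2 := by
  intro χ
  have a := ibp2 ρ χ
  have b := curl u.d1 χ
  simp only [Sm.d1, Sm.d2] at a b ⊢
  have i1 : Integrable fun q => u.f12 q * χ.f1 q :=
    χ.int (by fun_prop) (fun q hq => by simp [χ.z12 hq])
  have i2 : Integrable fun q => u.f22 q * χ.f2 q :=
    χ.int (by fun_prop) (fun q hq => by simp [χ.z12 hq])
  have i3 : Integrable fun q => u.f11 q * χ.f2 q :=
    χ.int (by fun_prop) (fun q hq => by simp [χ.z12 hq])
  have i5 : Integrable fun q => ρ.f2 q * χ.f q :=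
    χ.int (by fun_prop) (fun q hq => by simp [χ.z hq])
  rw [int_add3 i1 i2 i5]
  have : ∫ q, ρ.f q * χ.f2 q = (∫ q, u.f11 q * χ.f2 q) + ∫ q, u.f22 q * χ.f2 q := by
    rw [← integral_add i3 i2]; congr 1; ext q; rw [← h]; ring
  linarith

end HM

namespace HM
open Real Set Filter Topology

lemma lf_add (a b c d : ℝ) : lf a b + lf c d = lf (a + c) (b + d) := by
  ext <;> simp [lf]

lemma lf_smul (x a b : ℝ) : x • lf a b = lf (x * a) (x * b) := by
  ext <;> simp [lf]

noncomputable def C1.mul (a b : C1) : C1 where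
  f q := a.f q * b.f q
  f1 q := a.f q * b.f1 q + b.f q * a.f1 q
  f2 q := a.f q * b.f2 q + b.f q * a.f2 q
  cf := by fun_prop
  cf1 := by fun_prop
  cf2 := by fun_prop
  df q := ((a.df q).mul (b.df q)).congr_fderiv (by simp only [lf_smul, lf_add])

noncomputable def C1.comp (a : C1) (p p' : ℝ → ℝ) (hp : Continuous p) (hp' : Continuous p')
    (h : ∀ x, HasDerivAt p (p' x) x) : C1 where
  f q := p (a.f q)
  f1 q := p' (a.f q) * a.f1 q
  f2 q := p' (a.f q) * a.f2 q
  cf := by fun_prop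
  cf1 := by fun_prop
  cf2 := by fun_prop
  df q := ((h (a.f q)).comp_hasFDerivAt q (a.df q)).congr_fderiv (by simp only [lf_smul])

noncomputable def C1.inv (a : C1) (h : ∀ q, 0 < a.f q) : C1 where
  f q := (a.f q)⁻¹
  f1 q := -((a.f q) ^ 2)⁻¹ * a.f1 q
  f2 q := -((a.f q) ^ 2)⁻¹ * a.f2 q
  cf := a.cf.inv₀ fun q => (h q).ne'
  cf1 := ((a.cf.pow 2).inv₀ fun q => (pow_pos (h q) 2).ne').neg.mul a.cf1
  cf2 := ((a.cf.pow 2).inv₀ fun q => (pow_pos (h q) 2).ne').neg.mul a.cf2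
  df q := ((hasDerivAt_inv (h q).ne').comp_hasFDerivAt q (a.df q)).congr_fderiv (by simp only [lf_smul])

/-- `c a + d b` -/
noncomputable def C1.lin (a b : C1) (c d : ℝ) : C1 where
  f q := c * a.f q + d * b.f q
  f1 q := c * a.f1 q + d * b.f1 q
  f2 q := c * a.f2 q + d * b.f2 q
  cf := by fun_prop
  cf1 := by fun_prop
  cf2 := by fun_prop
  df q := (((a.df q).const_mul c).add ((b.df q).const_mul d)).congr_fderiv
    (by simp only [lf_smul, lf_add])

/-- the test function `η² k` -/
noncomputable def Cut.test (η : Cut) (k : C1) : Cut where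
  f q := η.f q ^ 2 * k.f q
  f1 q := 2 * η.f q * η.f1 q * k.f q + η.f q ^ 2 * k.f1 q
  f2 q := 2 * η.f q * η.f2 q * k.f q + η.f q ^ 2 * k.f2 q
  cf := by fun_prop
  cf1 := by fun_prop
  cf2 := by fun_prop
  df q := (((η.df q).pow 2).mul (k.df q)).congr_fderiv (by
    simp only [lf_smul, lf_add]; congr 1 <;> simp <;> ring)
  cs := cs_of η.cs (fun q hq => by simp [η.z hq])

lemma WeakEq.lin {a b : C1} {ρ τ : ℝ × ℝ → ℝ} (ha : WeakEq a ρ) (hb : WeakEq b τ)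
    (hρ : Continuous ρ) (hτ : Continuous τ) (c d : ℝ) :
    WeakEq (a.lin b c d) (fun q => c * ρ q + d * τ q) := by
  intro χ
  have i1 : Integrable fun q => c * (a.f1 q * χ.f1 q + a.f2 q * χ.f2 q + ρ q * χ.f q) :=
    χ.int (by fun_prop) (fun q hq => by simp [χ.z12 hq, χ.z hq])
  have i2 : Integrable fun q => d * (b.f1 q * χ.f1 q + b.f2 q * χ.f2 q + τ q * χ.f q) :=
    χ.int (by fun_prop) (fun q hq => by simp [χ.z12 hq, χ.z hq])
  have e := integral_add i1 i2
  rw [integral_const_mul, integral_const_mul, ha χ, hb χ] at e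
  rw [show (0:ℝ) = c * 0 + d * 0 by ring, ← e]
  congr 1; ext q; simp only [C1.lin]; ring

lemma vanish {Q : ℝ × ℝ → ℝ} (hQ : Continuous Q) (h0 : ∀ q, 0 ≤ Q q) {η : ℕ → Cut} {e : ℕ → ℝ}
    (h1 : ∀ q, ∀ᶠ n in atTop, (η n).f q = 1) (he : Tendsto e atTop (𝓝 0))
    (hle : ∀ n, ∫ q, (η n).f q ^ 2 * Q q ≤ e n) : ∀ q, Q q = 0 := by
  have hi : ∀ n, Integrable fun q => (η n).f q ^ 2 * Q q := fun n =>
    (η n).int (by fun_prop) (fun q hq => by simp [(η n).z hq])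
  have hz : ∫⁻ q, ENNReal.ofReal (Q q) = 0 := by
    have hF := lintegral_liminf_le (μ := volume) (u := atTop)
      (f := fun n q => ENNReal.ofReal ((η n).f q ^ 2 * Q q))
      (fun n => (by fun_prop : Continuous fun q => (η n).f q ^ 2 * Q q).measurable.ennreal_ofReal)
    have e1 : ∀ q, liminf (fun n => ENNReal.ofReal ((η n).f q ^ 2 * Q q)) atTop = ENNReal.ofReal (Q q) := by
      intro q
      apply Tendsto.liminf_eq
      apply tendsto_const_nhds.congr'
      filter_upwards [h1 q] with n hn
      rw [hn]; simp
    simp only [e1] at hF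
    have e2 : liminf (fun n => ∫⁻ q, ENNReal.ofReal ((η n).f q ^ 2 * Q q)) atTop = 0 := by
      apply Tendsto.liminf_eq
      have hb : Tendsto (fun n => ENNReal.ofReal (e n)) atTop (𝓝 0) := by
        have := ENNReal.tendsto_ofReal he
        simpa using this
      refine tendsto_of_tendsto_of_tendsto_of_le_of_le tendsto_const_nhds hb (fun n => zero_le) ?_
      intro n
      simp only []
      rw [← ofReal_integral_eq_lintegral_ofReal (hi n)
        (Eventually.of_forall fun q => mul_nonneg (sq_nonneg _) (h0 q))]
      exact ENNReal.ofReal_le_ofReal (hle n)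
    rw [e2] at hF
    exact le_antisymm hF zero_le
  rw [lintegral_eq_zero_iff hQ.measurable.ennreal_ofReal] at hz
  have hz2 : Q =ᵐ[volume] fun _ => 0 := by
    filter_upwards [hz] with q hq
    have : ENNReal.ofReal (Q q) = 0 := hq
    exact le_antisymm (ENNReal.ofReal_eq_zero.1 this) (h0 q)
  have := (hQ.ae_eq_iff_eq volume continuous_const).1 hz2
  intro q; rw [this]

/-- the profile used in the maximum principle -/
lemma glue_deriv (x : ℝ) : HasDerivAt expNegInvGlue ((x⁻¹) ^ 2 * expNegInvGlue x) x := by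
  have := expNegInvGlue.hasDerivAt_polynomial_eval_inv_mul 1 x
  simpa using this

lemma glue_cont' : Continuous fun x : ℝ => (x⁻¹) ^ 2 * expNegInvGlue x := by
  have := expNegInvGlue.continuous_polynomial_eval_inv_mul (Polynomial.X ^ 2)
  simpa using this

lemma glue_ineq (x : ℝ) : expNegInvGlue x ^ 2 ≤ (x⁻¹) ^ 2 * expNegInvGlue x * x ^ 2 := by
  rcases eq_or_ne x 0 with rfl | hx
  · simp [expNegInvGlue.zero]
  · have h0 := expNegInvGlue.nonneg x
    have h1 : expNegInvGlue x ≤ 1 := by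
      unfold expNegInvGlue
      split_ifs with h
      · norm_num
      · have : 0 < x⁻¹ := by push Not at h; positivity
        exact exp_le_one_iff.2 (by linarith)
    have : (x⁻¹) ^ 2 * expNegInvGlue x * x ^ 2 = expNegInvGlue x := by field_simp
    rw [this]; nlinarith

end HM

namespace HM
open Real Set Filter Topology

lemma quad_nonneg {A B p : ℝ} (hA : 0 ≤ A) (hB : 0 ≤ B) (h : p ^ 2 ≤ A * B) (X Y : ℝ) :
    0 ≤ A * X ^ 2 + 2 * p * X * Y + B * Y ^ 2 := by
  rcases hA.eq_or_lt with h0 | h0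
  · have : p = 0 := by rw [← h0] at h; nlinarith
    rw [← h0, this]; nlinarith [mul_nonneg hB (sq_nonneg Y)]
  · have : 0 ≤ A * (A * X ^ 2 + 2 * p * X * Y + B * Y ^ 2) := by
      nlinarith [sq_nonneg (A * X + p * Y), mul_nonneg (sub_nonneg.2 h) (sq_nonneg Y)]
    exact (mul_nonneg_iff_of_pos_left h0).1 this

lemma step1_alg {u u2 v v1 v2 v12 v22 g g1 g2 p p' η η1 η2 : ℝ} (e0 : v2 = g * v)
    (e1 : v12 = v * g1 + g * v1) (e2 : v22 = v * g2 + g * v2) (hp' : 0 ≤ p') (hp : p ^ 2 ≤ p' * g ^ 2) :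
    2 * u * v ^ 2 * u2 * η ^ 2 * p - v2 ^ 2 * (η1 ^ 2 + η2 ^ 2) ≤
    (v12 * (2 * η * η1 * (v * p) + η ^ 2 * (v * (p' * g1) + p * v1))
      + v22 * (2 * η * η2 * (v * p) + η ^ 2 * (v * (p' * g2) + p * v2))
      + (2 * v * u * u2 + u ^ 2 * v2) * (η ^ 2 * (v * p)))
    - (v1 * (2 * η * η1 * (v2 * p) + η ^ 2 * (v2 * (p' * g1) + p * v12))
      + v2 * (2 * η * η2 * (v2 * p) + η ^ 2 * (v2 * (p' * g2) + p * v22))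
      + v * u ^ 2 * (η ^ 2 * (v2 * p))) := by
  have q1 := mul_nonneg (sq_nonneg v) (quad_nonneg hp' (sq_nonneg g) hp (η * g1) η1)
  have q2 := mul_nonneg (sq_nonneg v) (quad_nonneg hp' (sq_nonneg g) hp (η * g2) η2)
  rw [← sub_nonneg]
  refine le_of_le_of_eq (add_nonneg q1 q2) ?_
  rw [e1, e2, e0]; ring

noncomputable def rho (u v : Sm) : C1 := u.c1.mul (v.c1.mul v.c1)

variable {u v : Sm}

lemma Sol.wu1 (h : Sol u v) : WeakEq u.d1 (rho u v).f1 :=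
  weak1 u _ (fun q => by rw [h.equ]; simp only [rho, C1.mul, Sm.c1]; ring)
lemma Sol.wu2 (h : Sol u v) : WeakEq u.d2 (rho u v).f2 :=
  weak2 u _ (fun q => by rw [h.equ]; simp only [rho, C1.mul, Sm.c1]; ring)
lemma Sol.wv1 (h : Sol u v) : WeakEq v.d1 (rho v u).f1 :=
  weak1 v _ (fun q => by rw [h.eqv]; simp only [rho, C1.mul, Sm.c1]; ring)
lemma Sol.wv2 (h : Sol u v) : WeakEq v.d2 (rho v u).f2 :=
  weak2 v _ (fun q => by rw [h.eqv]; simp only [rho, C1.mul, Sm.c1]; ring)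
lemma Sol.wv0 (h : Sol u v) : WeakEq v.c1 (rho v u).f :=
  weak0 v (rho v u).cf (fun q => by rw [h.eqv]; simp only [rho, C1.mul, Sm.c1]; ring)

lemma Cut.weak_int (χ : Cut) (k : C1) {ρ : ℝ × ℝ → ℝ} (hρ : Continuous ρ) :
    Integrable fun q => k.f1 q * χ.f1 q + k.f2 q * χ.f2 q + ρ q * χ.f q :=
  χ.int (by fun_prop) (fun q hq => by simp [χ.z12 hq, χ.z hq])

noncomputable def vg (v : Sm) (hv : ∀ q, 0 < v.f q) : C1 := v.d2.mul (v.c1.inv hv)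
noncomputable def vP (v : Sm) (hv : ∀ q, 0 < v.f q) : C1 :=
  (vg v hv).comp expNegInvGlue _ (expNegInvGlue.contDiff (n := 0)).continuous glue_cont' glue_deriv

lemma Wg_cut_int (η : Cut) : Integrable fun q => Wg u v q * (η.f1 q ^ 2 + η.f2 q ^ 2) :=
  η.int (by have := Wg_cont (u := u) (v := v); fun_prop) (fun q hq => by simp [η.z12 hq])

set_option maxHeartbeats 1000000 in
lemma Sol.step1_int (h : Sol u v) (η : Cut) :
    ∫ q, η.f q ^ 2 * (2 * u.f q * v.f q ^ 2 * u.f2 q * (vP v h.posv).f q) ≤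
      ∫ q, Wg u v q * (η.f1 q ^ 2 + η.f2 q ^ 2) := by
  have wA := h.wv2 (η.test (v.c1.mul (vP v h.posv)))
  have wB := h.wv0 (η.test (v.d2.mul (vP v h.posv)))
  have iA := (η.test (v.c1.mul (vP v h.posv))).weak_int v.d2 (rho v u).cf2
  have iB := (η.test (v.d2.mul (vP v h.posv))).weak_int v.c1 (rho v u).cf
  have iW := Wg_cut_int (u := u) (v := v) η
  have iL : Integrable fun q => η.f q ^ 2 * (2 * u.f q * v.f q ^ 2 * u.f2 q * (vP v h.posv).f q) :=
    η.int (by generalize vP v h.posv = P; fun_prop) (fun q hq => by simp [η.z hq])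
  have hmono := integral_mono (iL.sub iW) (iA.sub iB) (fun q => ?_)
  · have e1 := integral_sub iL iW
    have e2 := integral_sub iA iB
    rw [wA, wB] at e2
    simp only [Pi.sub_apply] at hmono
    linarith
  · have hv := (h.posv q).ne'
    set P := vP v h.posv with hP
    have hg : (vg v h.posv).f q = v.f2 q * (v.f q)⁻¹ := rfl
    have hg1 : (vg v h.posv).f1 q = v.f2 q * (-((v.f q) ^ 2)⁻¹ * v.f1 q) + (v.f q)⁻¹ * v.f12 q := rfl
    have hg2 : (vg v h.posv).f2 q = v.f2 q * (-((v.f q) ^ 2)⁻¹ * v.f2 q) + (v.f q)⁻¹ * v.f22 q := rfl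
    have key := step1_alg (u := u.f q) (u2 := u.f2 q) (v := v.f q) (v1 := v.f1 q) (v2 := v.f2 q)
      (v12 := v.f12 q) (v22 := v.f22 q) (g := (vg v h.posv).f q) (g1 := (vg v h.posv).f1 q)
      (g2 := (vg v h.posv).f2 q) (p := P.f q)
      (p' := (((vg v h.posv).f q)⁻¹) ^ 2 * expNegInvGlue ((vg v h.posv).f q))
      (η := η.f q) (η1 := η.f1 q) (η2 := η.f2 q) (by rw [hg]; field_simp)
      (by rw [hg1, hg]; field_simp; ring) (by rw [hg2, hg]; field_simp; ring)
      (mul_nonneg (sq_nonneg _) (expNegInvGlue.nonneg _)) (glue_ineq _)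
    simp only [Pi.sub_apply]
    have hP1 : P.f1 q = (((vg v h.posv).f q)⁻¹) ^ 2 * expNegInvGlue ((vg v h.posv).f q) * (vg v h.posv).f1 q := rfl
    have hP2 : P.f2 q = (((vg v h.posv).f q)⁻¹) ^ 2 * expNegInvGlue ((vg v h.posv).f q) * (vg v h.posv).f2 q := rfl
    rw [← hP1, ← hP2] at key
    have hW : v.f2 q ^ 2 * (η.f1 q ^ 2 + η.f2 q ^ 2) ≤ Wg u v q * (η.f1 q ^ 2 + η.f2 q ^ 2) := by
      apply mul_le_mul_of_nonneg_right _ (by positivity)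
      unfold Wg; nlinarith [sq_nonneg (u.f1 q), sq_nonneg (u.f2 q), sq_nonneg (v.f1 q)]
    simp only [Cut.test, C1.mul, Sm.c1, Sm.d2, rho]
    clear_value P
    refine le_trans (le_of_eq_of_le ?_ (sub_le_sub_left hW _)) (le_of_le_of_eq key ?_) <;> ring

lemma Sol.v2_nonpos (h : Sol u v) (q : ℝ × ℝ) : v.f2 q ≤ 0 := by
  obtain ⟨η, h0, h1, h2, h3⟩ := h.cutoffs
  have hz := vanish (Q := fun q => 2 * u.f q * v.f q ^ 2 * u.f2 q * (vP v h.posv).f q)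
    (by generalize vP v h.posv = P; fun_prop)
    (fun q => mul_nonneg (by have := h.posu q; have := h.mon q; positivity) (expNegInvGlue.nonneg _))
    h2 h3 (fun n => h.step1_int (η n)) q
  have hu := h.posu q
  have hm := h.mon q
  have hv := h.posv q
  have hp : expNegInvGlue (v.f2 q * (v.f q)⁻¹) = 0 := by
    rcases mul_eq_zero.1 hz with hh | hh
    · exfalso; have : 0 < 2 * u.f q * v.f q ^ 2 * u.f2 q := by positivity
      linarith
    · exact hh
  have := expNegInvGlue.zero_iff_nonpos.1 hp
  by_contra! hc
  have : 0 < v.f2 q * (v.f q)⁻¹ := by positivity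
  linarith

/-- Picone-type inequality -/
lemma picone_alg {f φ f1 f2 φ1 φ2 s1 s2 η η1 η2 ρ τ i : ℝ} (hi : φ * i = 1)
    (h1 : s1 = f * (-(φ ^ 2)⁻¹ * φ1) + i * f1) (h2 : s2 = f * (-(φ ^ 2)⁻¹ * φ2) + i * f2) :
    η ^ 2 * (1 / 2 * φ ^ 2 * (s1 ^ 2 + s2 ^ 2) + (ρ * f - τ * (f ^ 2 * i)))
      - 2 * f ^ 2 * (η1 ^ 2 + η2 ^ 2) ≤
    (f1 * (2 * η * η1 * f + η ^ 2 * f1) + f2 * (2 * η * η2 * f + η ^ 2 * f2) + ρ * (η ^ 2 * f))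
    - (φ1 * (2 * η * η1 * (f * (f * i)) + η ^ 2 * (f * s1 + f * i * f1))
      + φ2 * (2 * η * η2 * (f * (f * i)) + η ^ 2 * (f * s2 + f * i * f2))
      + τ * (η ^ 2 * (f * (f * i)))) := by
  have hφ : φ ≠ 0 := left_ne_zero_of_mul_eq_one hi
  have hi' : i = φ⁻¹ := eq_inv_of_mul_eq_one_right hi
  have e1 : f1 = φ * s1 + f * i * φ1 := by rw [h1, hi']; field_simp; ring
  have e2 : f2 = φ * s2 + f * i * φ2 := by rw [h2, hi']; field_simp; ring
  clear h1 h2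
  rw [← sub_nonneg]
  have : 0 ≤ 1 / 2 * (η * φ * s1 + 2 * f * η1) ^ 2 + 1 / 2 * (η * φ * s2 + 2 * f * η2) ^ 2 := by
    positivity
  refine le_of_le_of_eq this ?_
  rw [e1, e2, hi']; field_simp; ring

lemma picone {f φ : C1} {ρ τ : ℝ × ℝ → ℝ} (hf : WeakEq f ρ) (hφ : WeakEq φ τ) (hρ : Continuous ρ)
    (hτ : Continuous τ) (hp : ∀ q, 0 < φ.f q) (η : Cut) :
    ∫ q, η.f q ^ 2 * (1 / 2 * φ.f q ^ 2 * ((f.mul (φ.inv hp)).f1 q ^ 2 + (f.mul (φ.inv hp)).f2 q ^ 2)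
        + (ρ q * f.f q - τ q * (f.f q ^ 2 * (φ.inv hp).f q)))
      ≤ ∫ q, 2 * f.f q ^ 2 * (η.f1 q ^ 2 + η.f2 q ^ 2) := by
  have wA := hf (η.test f)
  have wB := hφ (η.test (f.mul (f.mul (φ.inv hp))))
  have iA := (η.test f).weak_int f hρ
  have iB := (η.test (f.mul (f.mul (φ.inv hp)))).weak_int φ hτ
  have iL : Integrable fun q => η.f q ^ 2 * (1 / 2 * φ.f q ^ 2 *
      ((f.mul (φ.inv hp)).f1 q ^ 2 + (f.mul (φ.inv hp)).f2 q ^ 2)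
        + (ρ q * f.f q - τ q * (f.f q ^ 2 * (φ.inv hp).f q))) :=
    η.int (by generalize f.mul (φ.inv hp) = S; generalize φ.inv hp = T; fun_prop) (fun q hq => by simp [η.z hq])
  have iW : Integrable fun q => 2 * f.f q ^ 2 * (η.f1 q ^ 2 + η.f2 q ^ 2) :=
    η.int (by fun_prop) (fun q hq => by simp [η.z12 hq])
  have hmono := integral_mono (iL.sub iW) (iA.sub iB) (fun q => ?_)
  · have e1 := integral_sub iL iW
    have e2 := integral_sub iA iB
    rw [wA, wB] at e2
    simp only [Pi.sub_apply] at hmono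
    linarith
  · have hi : φ.f q * (φ.inv hp).f q = 1 := mul_inv_cancel₀ (hp q).ne'
    exact picone_alg (f1 := f.f1 q) (f2 := f.f2 q) (φ1 := φ.f1 q) (φ2 := φ.f2 q) hi rfl rfl

end HM

namespace HM
open Real Set Filter Topology

variable {u v : Sm}

lemma step2_alg {u v u1 u2 v1 v2 ε i j S T ψ : ℝ} (hu : 0 < u) (hv : 0 < v) (hi : u2 * i = 1)
    (hψ : ψ = -1 * v2 + ε * v) (hj : ψ * j = 1) (i0 : 0 < i) (j0 : 0 < j) (hT : 0 ≤ T) :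
    S - ε * (2 * u * v ^ 2 * (u1 ^ 2 * i)) ≤
      (S + ((u * (v * v1 + v * v1) + v * v * u1) * u1 - (u * (v * v2 + v * v2) + v * v * u2) * (u1 ^ 2 * i)))
      + (T + ((v * (u * u1 + u * u1) + u * u * v1) * v1
        - (-1 * (v * (u * u2 + u * u2) + u * u * v2) + ε * (v * (u * u))) * (v1 ^ 2 * j))) := by
  have h1 : 0 ≤ 2 * u * v * (i * j * (ψ * u1 + u2 * v1) ^ 2) := by positivity
  have e2 : v2 = ε * v - ψ := by rw [hψ]; ring
  have hu2 : u2 ≠ 0 := left_ne_zero_of_mul_eq_one hi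
  have hψ0 : ψ ≠ 0 := left_ne_zero_of_mul_eq_one hj
  have hi' : i = u2⁻¹ := eq_inv_of_mul_eq_one_right hi
  have hj' : j = ψ⁻¹ := eq_inv_of_mul_eq_one_right hj
  clear hψ
  rw [← sub_nonneg]
  refine le_of_le_of_eq (add_nonneg h1 hT) ?_
  rw [e2, hi', hj']; field_simp; ring

noncomputable def psi (v : Sm) (ε : ℝ) : C1 := v.d2.lin v.c1 (-1) ε

lemma Sol.psi_pos (h : Sol u v) {ε : ℝ} (hε : 0 < ε) (q : ℝ × ℝ) : 0 < (psi v ε).f q := by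
  have h1 := h.v2_nonpos q
  have h2 := mul_pos hε (h.posv q)
  simp only [psi, C1.lin, Sm.d2, Sm.c1]
  linarith

noncomputable def sig (u : Sm) (hm : ∀ q, 0 < u.d2.f q) : C1 := u.d1.mul (u.d2.inv hm)

lemma Sol.mon' (h : Sol u v) : ∀ q, 0 < u.d2.f q := h.mon

set_option maxHeartbeats 1000000 in
lemma Sol.step2_int (h : Sol u v) {ε : ℝ} (hε : 0 < ε) (η : Cut) :
    ∫ q, η.f q ^ 2 * (1 / 2 * u.f2 q ^ 2 * ((sig u h.mon').f1 q ^ 2 + (sig u h.mon').f2 q ^ 2))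
      ≤ 2 * (∫ q, Wg u v q * (η.f1 q ^ 2 + η.f2 q ^ 2))
        + ε * ∫ q, η.f q ^ 2 * (2 * u.f q * v.f q ^ 2 * (u.f1 q ^ 2 * (u.d2.inv h.mon').f q)) := by
  have pA := picone h.wu1 h.wu2 (rho u v).cf1 (rho u v).cf2 h.mon' η
  have cψ : Continuous fun q => -1 * (rho v u).f2 q + ε * (rho v u).f q := by
    generalize rho v u = R; fun_prop
  have pB := picone h.wv1 (h.wv2.lin h.wv0 (rho v u).cf2 (rho v u).cf (-1) ε) (rho v u).cf1 cψ
    (h.psi_pos hε) η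
  set I := u.d2.inv h.mon' with hI
  set J := (psi v ε).inv (h.psi_pos hε) with hJ
  set T := v.d1.mul J with hT
  have hJ' : (v.d2.lin v.c1 (-1) ε).inv (h.psi_pos hε) = J := rfl
  have hS' : u.d1.mul I = sig u h.mon' := rfl
  rw [hJ', ← hT] at pB
  rw [hS'] at pA
  set S := sig u h.mon' with hS
  set R := rho u v with hR
  set R' := rho v u with hR'
  have iW := Wg_cut_int (u := u) (v := v) η
  have iL : Integrable fun q => η.f q ^ 2 * (1 / 2 * u.f2 q ^ 2 * (S.f1 q ^ 2 + S.f2 q ^ 2)) := by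
    clear_value S
    exact η.int (by fun_prop) (fun q hq => by simp [η.z hq])
  have iE : Integrable fun q => η.f q ^ 2 * (2 * u.f q * v.f q ^ 2 * (u.f1 q ^ 2 * I.f q)) := by
    clear_value I
    exact η.int (by fun_prop) (fun q hq => by simp [η.z hq])
  have iA : Integrable fun q => η.f q ^ 2 * (1 / 2 * u.d2.f q ^ 2 * (S.f1 q ^ 2 + S.f2 q ^ 2)
        + (R.f1 q * u.d1.f q - R.f2 q * (u.d1.f q ^ 2 * I.f q))) := by
    generalize u.d1 = A; generalize u.d2 = B
    clear_value S I R
    exact η.int (by fun_prop) (fun q hq => by simp [η.z hq])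
  have iB : Integrable fun q => η.f q ^ 2 * (1 / 2 * (v.d2.lin v.c1 (-1) ε).f q ^ 2 * (T.f1 q ^ 2 + T.f2 q ^ 2)
        + (R'.f1 q * v.d1.f q - (-1 * R'.f2 q + ε * R'.f q) * (v.d1.f q ^ 2 * J.f q))) := by
    generalize v.d2.lin v.c1 (-1) ε = A; generalize v.d1 = B
    clear_value T J R'
    exact η.int (by fun_prop) (fun q hq => by simp [η.z hq])
  have iU : Integrable fun q => 2 * u.d1.f q ^ 2 * (η.f1 q ^ 2 + η.f2 q ^ 2) := by
    generalize u.d1 = A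
    exact η.int (by fun_prop) (fun q hq => by simp [η.z12 hq])
  have iV : Integrable fun q => 2 * v.d1.f q ^ 2 * (η.f1 q ^ 2 + η.f2 q ^ 2) := by
    generalize v.d1 = A
    exact η.int (by fun_prop) (fun q hq => by simp [η.z12 hq])
  have m1 := integral_mono (iL.sub (iE.const_mul ε)) (iA.add iB) (fun q => ?_)
  · have m2 := integral_mono (iU.add iV) (iW.const_mul 2) (fun q => ?_)
    · have e1 := integral_sub iL (iE.const_mul ε)
      have e2 := integral_add iA iB
      have e3 := integral_add iU iV
      rw [integral_const_mul] at e1 m2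
      simp only [Pi.sub_apply, Pi.add_apply] at m1 m2
      linarith
    · simp only [Pi.add_apply, Sm.d1, Wg]
      have h0 : 0 ≤ (u.f2 q ^ 2 + v.f2 q ^ 2) * (η.f1 q ^ 2 + η.f2 q ^ 2) := by positivity
      linarith
  · have hi : u.f2 q * I.f q = 1 := mul_inv_cancel₀ (h.mon q).ne'
    have hp := h.psi_pos hε q
    have hj : (psi v ε).f q * J.f q = 1 := mul_inv_cancel₀ hp.ne'
    have key := step2_alg (u1 := u.f1 q) (v1 := v.f1 q) (ε := ε)
      (S := 1 / 2 * u.f2 q ^ 2 * (S.f1 q ^ 2 + S.f2 q ^ 2))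
      (T := 1 / 2 * (v.d2.lin v.c1 (-1) ε).f q ^ 2 * (T.f1 q ^ 2 + T.f2 q ^ 2))
      (v2 := v.f2 q) (ψ := (psi v ε).f q)
      (h.posu q) (h.posv q) hi rfl hj (inv_pos.2 (h.mon q)) (inv_pos.2 hp) (by positivity)
    have key2 := mul_le_mul_of_nonneg_left key (sq_nonneg (η.f q))
    have r1 : R.f1 q = u.f q * (v.f q * v.f1 q + v.f q * v.f1 q) + v.f q * v.f q * u.f1 q := rfl
    have r2 : R.f2 q = u.f q * (v.f q * v.f2 q + v.f q * v.f2 q) + v.f q * v.f q * u.f2 q := rfl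
    have r3 : R'.f1 q = v.f q * (u.f q * u.f1 q + u.f q * u.f1 q) + u.f q * u.f q * v.f1 q := rfl
    have r4 : R'.f2 q = v.f q * (u.f q * u.f2 q + u.f q * u.f2 q) + u.f q * u.f q * v.f2 q := rfl
    have r5 : R'.f q = v.f q * (u.f q * u.f q) := rfl
    have r6 : u.d1.f q = u.f1 q := rfl
    have r7 : v.d1.f q = v.f1 q := rfl
    have r8 : u.d2.f q = u.f2 q := rfl
    rw [← r1, ← r2, ← r3, ← r4, ← r5] at key2
    simp only [Pi.sub_apply, Pi.add_apply, r6, r7, r8]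
    refine le_of_eq_of_le ?_ (le_of_le_of_eq key2 ?_) <;> ring

lemma Sol.sig_zero (h : Sol u v) (q : ℝ × ℝ) : (sig u h.mon').f1 q = 0 ∧ (sig u h.mon').f2 q = 0 := by
  obtain ⟨η, h0, h1, h2, h3⟩ := h.cutoffs
  have h4 : ∀ n, ∫ q, (η n).f q ^ 2 *
      (1 / 2 * u.f2 q ^ 2 * ((sig u h.mon').f1 q ^ 2 + (sig u h.mon').f2 q ^ 2))
      ≤ 2 * (∫ q, Wg u v q * ((η n).f1 q ^ 2 + (η n).f2 q ^ 2)) := by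
    intro n
    have ht : Tendsto (fun ε : ℝ => 2 * (∫ q, Wg u v q * ((η n).f1 q ^ 2 + (η n).f2 q ^ 2))
        + ε * ∫ q, (η n).f q ^ 2 * (2 * u.f q * v.f q ^ 2 * (u.f1 q ^ 2 * (u.d2.inv h.mon').f q)))
        (𝓝[>] 0) (𝓝 (2 * (∫ q, Wg u v q * ((η n).f1 q ^ 2 + (η n).f2 q ^ 2)))) := by
      refine tendsto_nhdsWithin_of_tendsto_nhds ?_
      have := ((continuous_id (X := ℝ)).mul (continuous_const (y := ∫ q, (η n).f q ^ 2 * (2 * u.f q * v.f q ^ 2 * (u.f1 q ^ 2 * (u.d2.inv h.mon').f q))))).tendsto 0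
      have h5 := this.const_add (2 * (∫ q, Wg u v q * ((η n).f1 q ^ 2 + (η n).f2 q ^ 2)))
      simpa using h5
    refine ge_of_tendsto ht ?_
    filter_upwards [self_mem_nhdsWithin] with ε hε
    exact h.step2_int hε (η n)
  have h5 := h3.const_mul 2
  rw [mul_zero] at h5
  have hz := vanish (Q := fun q => 1 / 2 * u.f2 q ^ 2 * ((sig u h.mon').f1 q ^ 2 + (sig u h.mon').f2 q ^ 2))
    (by generalize sig u h.mon' = S; fun_prop) (fun q => by positivity) h2 h5 h4 q
  have hm := h.mon q
  have : (sig u h.mon').f1 q ^ 2 + (sig u h.mon').f2 q ^ 2 = 0 := by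
    rcases mul_eq_zero.1 hz with hh | hh
    · exfalso; have : 0 < 1 / 2 * u.f2 q ^ 2 := by positivity
      linarith
    · exact hh
  constructor <;> nlinarith [sq_nonneg ((sig u h.mon').f1 q), sq_nonneg ((sig u h.mon').f2 q)]

lemma Sol.sig_const (h : Sol u v) : ∃ σ : ℝ, ∀ q, u.f1 q = σ * u.f2 q := by
  refine ⟨(sig u h.mon').f 0, fun q => ?_⟩
  have hd : ∀ q, HasFDerivAt (sig u h.mon').f (0 : ℝ × ℝ →L[ℝ] ℝ) q := by
    intro q
    refine ((sig u h.mon').df q).congr_fderiv ?_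
    rw [(h.sig_zero q).1, (h.sig_zero q).2]; ext <;> simp [lf]
  have := is_const_of_fderiv_eq_zero (fun q => (hd q).differentiableAt) (fun q => (hd q).fderiv) 0 q
  rw [this]
  show u.f1 q = u.f1 q * (u.f2 q)⁻¹ * u.f2 q
  have := (h.mon q).ne'
  field_simp

lemma Sm.translate (u : Sm) {σ : ℝ} (hσ : ∀ q, u.f1 q = σ * u.f2 q) (q : ℝ × ℝ) (s : ℝ) :
    u.f (q.1 + s, q.2 - σ * s) = u.f q := by
  have hd : ∀ s, HasDerivAt (fun s => u.f (q.1 + s, q.2 - σ * s)) 0 s := by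
    intro s
    have h1 : HasDerivAt (fun s => (q.1 + s, q.2 - σ * s)) ((1:ℝ), -σ) s :=
      ((hasDerivAt_id s).const_add q.1).prodMk
        ((((hasDerivAt_id s).const_mul σ).const_sub q.2).congr_deriv (by simp))
    exact ((u.df _).comp_hasDerivAt s h1).congr_deriv (by rw [lf_apply, hσ]; ring)
  have := is_const_of_deriv_eq_zero (fun s => (hd s).differentiableAt) (fun s => (hd s).deriv) s 0
  simpa using this

lemma trans_fderiv {f f1 f2 : ℝ × ℝ → ℝ} (hf : ∀ q, HasFDerivAt f (lf (f1 q) (f2 q)) q) (a b : ℝ)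
    (hi : ∀ q, f (q.1 + a, q.2 + b) = f q) (q : ℝ × ℝ) :
    f1 (q.1 + a, q.2 + b) = f1 q ∧ f2 (q.1 + a, q.2 + b) = f2 q := by
  have h1 : HasFDerivAt (fun q : ℝ × ℝ => (q.1 + a, q.2 + b)) (ContinuousLinearMap.id ℝ (ℝ × ℝ)) q := by
    have := (hasFDerivAt_id (𝕜 := ℝ) q).add_const ((a, b) : ℝ × ℝ)
    have e : (fun q : ℝ × ℝ => (q.1 + a, q.2 + b)) = fun x => id x + (a, b) := by
      funext p; ext <;> simp
    rw [e]; exact this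
  have h2 := (hf (q.1 + a, q.2 + b)).comp q h1
  have h3 : f ∘ (fun q : ℝ × ℝ => (q.1 + a, q.2 + b)) = f := funext hi
  rw [h3] at h2
  have := h2.unique (hf q)
  apply lf_inj
  rw [← this]; ext <;> simp

/-- Product-form of the main theorem. -/
theorem Sol.main (h : Sol u v) : ∃ σ : ℝ, ∀ (q : ℝ × ℝ) (s : ℝ),
    u.f (q.1 + s, q.2 - σ * s) = u.f q ∧ v.f (q.1 + s, q.2 - σ * s) = v.f q := by
  obtain ⟨σ, hσ⟩ := h.sig_const
  refine ⟨σ, fun q s => ⟨u.translate hσ q s, ?_⟩⟩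
  have t0 : ∀ q : ℝ × ℝ, u.f (q.1 + s, q.2 + -(σ * s)) = u.f q := fun q => by
    have := u.translate hσ q s
    rwa [sub_eq_add_neg] at this
  have t1 := trans_fderiv u.df s (-(σ * s)) t0
  have t2 := trans_fderiv u.df1 s (-(σ * s)) (fun q => (t1 q).1)
  have t3 := trans_fderiv u.df2 s (-(σ * s)) (fun q => (t1 q).2)
  rw [sub_eq_add_neg]
  have e1 := h.equ (q.1 + s, q.2 + -(σ * s))
  rw [(t2 q).1, (t3 q).2, t0, h.equ q] at e1
  have e2 := mul_left_cancel₀ (h.posu q).ne' e1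
  exact ((pow_left_inj₀ (h.posv _).le (h.posv _).le two_ne_zero).1 e2).symm

end HM

namespace HM
open Real Set Filter Topology

/-- linear coordinates on the Euclidean plane, possibly reflected -/
noncomputable def Lc (c : ℝ) : ℝ × ℝ →L[ℝ] EuclideanSpace ℝ (Fin 2) :=
  (ContinuousLinearMap.fst ℝ ℝ ℝ).smulRight (EuclideanSpace.single 0 1)
    + (ContinuousLinearMap.snd ℝ ℝ ℝ).smulRight (c • EuclideanSpace.single 1 1)

lemma Lc_apply (c : ℝ) (q : ℝ × ℝ) : Lc c q =
    q.1 • EuclideanSpace.single 0 1 + q.2 • (c • EuclideanSpace.single 1 1) := by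
  simp [Lc]

lemma Lc_10 (c : ℝ) : Lc c (1, 0) = EuclideanSpace.single 0 1 := by simp [Lc_apply]
lemma Lc_01 (c : ℝ) : Lc c (0, 1) = c • EuclideanSpace.single 1 1 := by simp [Lc_apply]

lemma Lc_norm {c : ℝ} (hc : c ^ 2 = 1) (q : ℝ × ℝ) : ‖Lc c q‖ = √(q.1 ^ 2 + q.2 ^ 2) := by
  rw [EuclideanSpace.norm_eq]
  congr 1
  simp [Lc_apply, Fin.sum_univ_two, mul_pow, hc]

lemma to_lf (A : ℝ × ℝ →L[ℝ] ℝ) : A = lf (A (1, 0)) (A (0, 1)) := by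
  ext <;> simp [lf]

/-- the `Sm` structure of a `C²` function -/
noncomputable def mkSm (w : EuclideanSpace ℝ (Fin 2) → ℝ) (hw : ContDiff ℝ 2 w) (c : ℝ) : Sm :=
  have d0 : Differentiable ℝ w := hw.differentiable (by norm_num)
  have hw1 : ContDiff ℝ 1 (fderiv ℝ w) := hw.fderiv_right (by norm_num)
  have d1 : Differentiable ℝ (fderiv ℝ w) := hw1.differentiable (by norm_num)
  have c1 : Continuous (fderiv ℝ w) := hw1.continuous
  have c2 : Continuous (fderiv ℝ (fderiv ℝ w)) := hw1.continuous_fderiv (by norm_num)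
  have key : ∀ (e : EuclideanSpace ℝ (Fin 2)) (q : ℝ × ℝ),
      HasFDerivAt (fun q => fderiv ℝ w (Lc c q) e)
        (lf (fderiv ℝ (fderiv ℝ w) (Lc c q) (Lc c (1, 0)) e)
          (fderiv ℝ (fderiv ℝ w) (Lc c q) (Lc c (0, 1)) e)) q := by
    intro e q
    have h1 := ((d1 (Lc c q)).hasFDerivAt.comp q (Lc c).hasFDerivAt).clm_apply (hasFDerivAt_const e q)
    refine h1.congr_fderiv ?_
    rw [to_lf (_ + _)]
    congr 1 <;> simp
  { f := fun q => w (Lc c q)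
    f1 := fun q => fderiv ℝ w (Lc c q) (Lc c (1, 0))
    f2 := fun q => fderiv ℝ w (Lc c q) (Lc c (0, 1))
    f11 := fun q => fderiv ℝ (fderiv ℝ w) (Lc c q) (Lc c (1, 0)) (Lc c (1, 0))
    f12 := fun q => fderiv ℝ (fderiv ℝ w) (Lc c q) (Lc c (0, 1)) (Lc c (1, 0))
    f22 := fun q => fderiv ℝ (fderiv ℝ w) (Lc c q) (Lc c (0, 1)) (Lc c (0, 1))
    cf := hw.continuous.comp (Lc c).continuous
    cf1 := (c1.comp (Lc c).continuous).clm_apply continuous_const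
    cf2 := (c1.comp (Lc c).continuous).clm_apply continuous_const
    cf11 := ((c2.comp (Lc c).continuous).clm_apply continuous_const).clm_apply continuous_const
    cf12 := ((c2.comp (Lc c).continuous).clm_apply continuous_const).clm_apply continuous_const
    cf22 := ((c2.comp (Lc c).continuous).clm_apply continuous_const).clm_apply continuous_const
    df := fun q => by
      refine ((d0 (Lc c q)).hasFDerivAt.comp q (Lc c).hasFDerivAt).congr_fderiv ?_
      rw [to_lf (ContinuousLinearMap.comp _ _)]
      rfl
    df1 := fun q => key _ q
    df2 := fun q => by
      have hs := (hw.contDiffAt (x := Lc c q)).isSymmSndFDerivAt (by simp)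
      rw [hs (Lc c (0, 1)) (Lc c (1, 0))]
      exact key _ q }

lemma mkSm_f (w : EuclideanSpace ℝ (Fin 2) → ℝ) (hw : ContDiff ℝ 2 w) (c : ℝ) (q : ℝ × ℝ) :
    (mkSm w hw c).f q = w (Lc c q) := rfl

lemma mkSm_lapl (w : EuclideanSpace ℝ (Fin 2) → ℝ) (hw : ContDiff ℝ 2 w) {c : ℝ} (hc : c ^ 2 = 1)
    (q : ℝ × ℝ) : (mkSm w hw c).f11 q + (mkSm w hw c).f22 q = lapl w (Lc c q) := by
  have hw1 : ContDiff ℝ 1 (fderiv ℝ w) := hw.fderiv_right (by norm_num)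
  have d1 : Differentiable ℝ (fderiv ℝ w) := hw1.differentiable (by norm_num)
  have key : ∀ x e : EuclideanSpace ℝ (Fin 2),
      fderiv ℝ (fun y => fderiv ℝ w y e) x e = fderiv ℝ (fderiv ℝ w) x e e := by
    intro x e
    have := ((d1 x).hasFDerivAt.clm_apply (hasFDerivAt_const e x)).fderiv
    rw [this]; simp
  unfold lapl
  rw [Fin.sum_univ_two, key, key]
  simp only [mkSm, Lc_10, Lc_01]
  simp only [map_smul, ContinuousLinearMap.smul_apply, smul_eq_mul]
  linear_combination (fderiv ℝ (fderiv ℝ w) (Lc c q) (EuclideanSpace.single 1 1) (EuclideanSpace.single 1 1)) * hc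

lemma mkSol {u v : EuclideanSpace ℝ (Fin 2) → ℝ}
    (hu : ContDiff ℝ 2 u) (hv : ContDiff ℝ 2 v)
    (hequ : ∀ x, lapl u x = u x * (v x) ^ 2)
    (heqv : ∀ x, lapl v x = v x * (u x) ^ 2)
    (hupos : ∀ x, 0 < u x) (hvpos : ∀ x, 0 < v x) {c : ℝ} (hc : c ^ 2 = 1)
    (hmon : ∀ x, 0 < c * fderiv ℝ u x (EuclideanSpace.single 1 1))
    {C α : ℝ} (hC : 0 < C) (hα : 1 ≤ α)
    (hgrowth : ∀ x, u x + v x ≤ C * (1 + ‖x‖) ^ α) : Sol (mkSm u hu c) (mkSm v hv c) where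
  equ q := by rw [mkSm_lapl u hu hc, hequ]; rfl
  eqv q := by rw [mkSm_lapl v hv hc, heqv]; rfl
  posu q := hupos _
  posv q := hvpos _
  mon q := by
    show 0 < fderiv ℝ u (Lc c q) (Lc c (0, 1))
    rw [Lc_01, map_smul]
    exact hmon _
  growth := ⟨C, α, hC.le, by linarith, fun q => by
    have := hgrowth (Lc c q)
    rw [Lc_norm hc] at this
    exact this⟩

lemma Lc_surj {c : ℝ} (hc : c ^ 2 = 1) (x : EuclideanSpace ℝ (Fin 2)) : Lc c (x 0, c * x 1) = x := by
  ext i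
  fin_cases i
  · simp [Lc_apply]
  · simp [Lc_apply]; linear_combination x 1 * hc

lemma exists_inv {u v : EuclideanSpace ℝ (Fin 2) → ℝ}
    (hu : ContDiff ℝ 2 u) (hv : ContDiff ℝ 2 v)
    (hequ : ∀ x, lapl u x = u x * (v x) ^ 2)
    (heqv : ∀ x, lapl v x = v x * (u x) ^ 2)
    (hupos : ∀ x, 0 < u x) (hvpos : ∀ x, 0 < v x) {c : ℝ} (hc : c ^ 2 = 1)
    (hmon : ∀ x, 0 < c * fderiv ℝ u x (EuclideanSpace.single 1 1))
    {C α : ℝ} (hC : 0 < C) (hα : 1 ≤ α)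
    (hgrowth : ∀ x, u x + v x ≤ C * (1 + ‖x‖) ^ α) :
    ∃ m : ℝ, ∀ (x : EuclideanSpace ℝ (Fin 2)) (s : ℝ),
      u (x + s • !₂[1, -m]) = u x ∧ v (x + s • !₂[1, -m]) = v x := by
  obtain ⟨σ, hσ⟩ := (mkSol hu hv hequ heqv hupos hvpos hc hmon hC hα hgrowth).main
  refine ⟨c * σ, fun x s => ?_⟩
  have := hσ (x 0, c * x 1) s
  simp only [mkSm_f, Lc_surj hc] at this
  have e : Lc c (x 0 + s, c * x 1 - σ * s) = x + s • !₂[1, -(c * σ)] := by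
    ext i
    fin_cases i
    · simp [Lc_apply]
    · simp [Lc_apply]; linear_combination x 1 * hc
  rwa [e] at this

lemma one_dim_of_inv {u v : EuclideanSpace ℝ (Fin 2) → ℝ} {m : ℝ}
    (h : ∀ (x : EuclideanSpace ℝ (Fin 2)) (s : ℝ),
      u (x + s • !₂[1, -m]) = u x ∧ v (x + s • !₂[1, -m]) = v x) :
    ∃ (U V : ℝ → ℝ) (ν : EuclideanSpace ℝ (Fin 2)), ‖ν‖ = 1 ∧
      ∀ x, u x = U ⟪ν, x⟫ ∧ v x = V ⟪ν, x⟫ := by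
  set r : ℝ := (√(1 + m ^ 2))⁻¹ with hr
  have hpos : 0 < 1 + m ^ 2 := by positivity
  have hr2 : r ^ 2 * (1 + m ^ 2) = 1 := by
    rw [hr, inv_pow, sq_sqrt hpos.le]; field_simp
  set ν : EuclideanSpace ℝ (Fin 2) := !₂[r * m, r] with hν
  refine ⟨fun τ => u (τ • ν), fun τ => v (τ • ν), ν, ?_, fun x => ?_⟩
  · rw [EuclideanSpace.norm_eq, sqrt_eq_one]
    simp [hν, Fin.sum_univ_two]
    linear_combination hr2
  · have hin : ⟪ν, x⟫ = r * m * x 0 + r * x 1 := by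
      simp [hν, PiLp.inner_apply, Fin.sum_univ_two]; ring
    have e : x = ⟪ν, x⟫ • ν + (r ^ 2 * (x 0 - m * x 1)) • !₂[1, -m] := by
      rw [hin]
      ext i
      fin_cases i
      · simp [hν]; linear_combination (- x 0) * hr2
      · simp [hν]; linear_combination (- x 1) * hr2
    have h1 := h (⟪ν, x⟫ • ν) (r ^ 2 * (x 0 - m * x 1))
    rw [← e] at h1
    exact h1

end HM

/-- **Theorem 1.2 (half-monotone solutions).** Any half-monotone solution of
`Δu = u v²`, `Δv = v u²`, `u, v > 0` on `ℝ²` with arbitrary algebraic growth at infinity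
is one dimensional. -/
theorem half_monotone_solution_one_dimensional
    (u v : EuclideanSpace ℝ (Fin 2) → ℝ)
    (hu : ContDiff ℝ 2 u) (hv : ContDiff ℝ 2 v)
    (hequ : ∀ x, lapl u x = u x * (v x) ^ 2)
    (heqv : ∀ x, lapl v x = v x * (u x) ^ 2)
    (hupos : ∀ x, 0 < u x) (hvpos : ∀ x, 0 < v x)
    (hmon : (∀ x, 0 < fderiv ℝ u x (EuclideanSpace.single 1 1)) ∨
            (∀ x, fderiv ℝ v x (EuclideanSpace.single 1 1) < 0))
    (C α : ℝ) (hC : 0 < C) (hα : 1 ≤ α)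
    (hgrowth : ∀ x, u x + v x ≤ C * (1 + ‖x‖) ^ α) :
    ∃ (U V : ℝ → ℝ) (ν : EuclideanSpace ℝ (Fin 2)), ‖ν‖ = 1 ∧
      ∀ x, u x = U ⟪ν, x⟫ ∧ v x = V ⟪ν, x⟫ := by
  rcases hmon with hm | hm
  · obtain ⟨m, h⟩ := HM.exists_inv hu hv hequ heqv hupos hvpos (c := 1) (by norm_num)
      (fun x => by rw [one_mul]; exact hm x) hC hα hgrowth
    exact HM.one_dim_of_inv h
  · obtain ⟨m, h⟩ := HM.exists_inv hv hu heqv hequ hvpos hupos (c := -1) (by norm_num)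
      (fun x => by have := hm x; linarith) hC hα (fun x => by rw [add_comm]; exact hgrowth x)
    exact HM.one_dim_of_inv fun x s => (h x s).symm
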